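/- Let C = {v, w} be a mild contour from x to y in a ray category P such that v⃗ is transit, with α = v⃗_1, β = w⃗_1 and ρ = π(y) = αω. If ω is an identity and v⃗_2 = β (case (DB)), then the full subcategory P(C) is a dumb-bell. -/

import Mathlib

set_option autoImplicit false

/-- A ray category (Bautista–Gabriel–Roiter–Salmerón).  The fields `pipow x`
record the powers of the generator `π(x)` of the radical of `P(x,x)`. -/
structure RayCategory : Type 1 where
  Obj : Type
  Hom : Obj → Obj → Type
  id : ∀ x : Obj, Hom x x
  comp : ∀ {x y z : Obj}, Hom y z → Hom x y → Hom x z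
  zero : ∀ x y : Obj, Hom x y
  comp_id : ∀ {x y : Obj} (f : Hom x y), comp f (id x) = f
  id_comp : ∀ {x y : Obj} (f : Hom x y), comp (id y) f = f
  assoc : ∀ {x y z w : Obj} (h : Hom z w) (g : Hom y z) (f : Hom x y),
      comp (comp h g) f = comp h (comp g f)
  /-- axiom b : zero morphisms -/
  zero_comp : ∀ {x y z : Obj} (f : Hom x y), comp (zero y z) f = zero x z
  comp_zero : ∀ {x y z : Obj} (f : Hom y z), comp f (zero x y) = zero x z
  /-- axiom a : the objects are pairwise non-isomorphic -/
  no_iso : ∀ {x y : Obj} (f : Hom x y) (g : Hom y x),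
      comp g f = id x → comp f g = id y → x = y
  /-- axiom c : local finiteness -/
  finite_target : ∀ x : Obj, {y : Obj | ∃ f : Hom x y, f ≠ zero x y}.Finite
  finite_source : ∀ x : Obj, {y : Obj | ∃ f : Hom y x, f ≠ zero y x}.Finite
  /-- the powers of the generator `π(x)` of `P(x,x)`; `pipow x 1 = π(x)`. -/
  pipow : ∀ x : Obj, ℕ → Hom x x
  pipow_zero : ∀ x, pipow x 0 = id x
  pipow_succ : ∀ x n, pipow x (n + 1) = comp (pipow x 1) (pipow x n)
  nilp : Obj → ℕ
  nilp_pos : ∀ x, 1 ≤ nilp x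
  /-- axiom d : `P(x,x) = {id, σ, …, σ^{n-1} ≠ 0 = σ^n}` -/
  endo_cyclic : ∀ (x : Obj) (f : Hom x x), ∃ i : ℕ, f = pipow x i
  pipow_nilp : ∀ x, pipow x (nilp x) = zero x x
  pipow_nilp_ne : ∀ x, pipow x (nilp x - 1) ≠ zero x x
  /-- axiom e : `P(x,y)` is cyclic under the action of `P(x,x)` or of `P(y,y)` -/
  hom_cyclic : ∀ x y : Obj, ∃ g : Hom x y,
      (∀ f : Hom x y, ∃ i : ℕ, f = comp (pipow y i) g) ∨
      (∀ f : Hom x y, ∃ i : ℕ, f = comp g (pipow x i))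
  /-- axiom f : cancellation -/
  cancel : ∀ {x y z w : Obj} (kappa : Hom x y) (mu nu : Hom y z) (lam : Hom z w),
      comp lam (comp mu kappa) = comp lam (comp nu kappa) →
      comp lam (comp mu kappa) ≠ zero x w → mu = nu

namespace RayCategory

variable (P : RayCategory)

/-- the generator of the radical of `P(x,x)` -/
def pi (x : P.Obj) : P.Hom x x := P.pipow x 1

/-- powers of an endomorphism -/
def pow {x : P.Obj} (f : P.Hom x x) : ℕ → P.Hom x x
  | 0 => P.id x
  | n + 1 => P.comp f (pow f n)

/-- `f` is an identity morphism -/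
def IsId {x y : P.Obj} (f : P.Hom x y) : Prop := ∃ _ : x = y, HEq f (P.id x)

/-- irreducible morphisms (= arrows of the quiver of `P`): nonzero morphisms which are
not identities and cannot be written as a product of two non-identity morphisms -/
def IsIrreducible {x y : P.Obj} (f : P.Hom x y) : Prop :=
  f ≠ P.zero x y ∧ ¬ P.IsId f ∧
    ∀ (z : P.Obj) (g : P.Hom z y) (h : P.Hom x z), f = P.comp g h → P.IsId g ∨ P.IsId h

/-- irreducibility inside the full subcategory supported by `S` -/
def IsIrreducibleOn (S : Set P.Obj) {x y : P.Obj} (f : P.Hom x y) : Prop :=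
  f ≠ P.zero x y ∧ ¬ P.IsId f ∧
    ∀ z ∈ S, ∀ (g : P.Hom z y) (h : P.Hom x z), f = P.comp g h → P.IsId g ∨ P.IsId h

/-- the sub-bimodule `P(y,y) μ P(x,x)` of `P(x,y)` generated by `μ` -/
def Bimod {x y : P.Obj} (mu : P.Hom x y) : Set (P.Hom x y) :=
  {f | ∃ i j : ℕ, f = P.comp (P.pipow y i) (P.comp mu (P.pipow x j))}

/-- `μ` is transit : the sub-bimodule generated by `μ` is cyclic over `P(y,y)` -/
def IsTransit {x y : P.Obj} (mu : P.Hom x y) : Prop :=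
  mu ≠ P.zero x y ∧
    ∃ g ∈ P.Bimod mu, ∀ f ∈ P.Bimod mu, ∃ i : ℕ, f = P.comp (P.pipow y i) g

/-- `μ` is cotransit : the sub-bimodule generated by `μ` is cyclic over `P(x,x)` -/
def IsCotransit {x y : P.Obj} (mu : P.Hom x y) : Prop :=
  mu ≠ P.zero x y ∧
    ∃ g ∈ P.Bimod mu, ∀ f ∈ P.Bimod mu, ∃ j : ℕ, f = P.comp g (P.pipow x j)

/-- `μ` is deep : `π(y)μ = 0 = μπ(x)` -/
def IsDeep {x y : P.Obj} (mu : P.Hom x y) : Prop :=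
  mu ≠ P.zero x y ∧ P.comp (P.pi y) mu = P.zero x y ∧ P.comp mu (P.pi x) = P.zero x y

/-- transport of a morphism along equalities of objects -/
def castHom {a b c d : P.Obj} (h1 : a = c) (h2 : b = d) (f : P.Hom a b) : P.Hom c d :=
  cast (by rw [h1, h2]) f

/-- the composite `a_{i+j-1} ⋯ a_{i+1} a_i : x_i → x_{i+j}` of a chain of morphisms -/
def chain (x : ℕ → P.Obj) (a : ∀ i : ℕ, P.Hom (x i) (x (i + 1))) (i : ℕ) :
    ∀ j : ℕ, P.Hom (x i) (x (i + j))
  | 0 => P.id (x i)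
  | j + 1 => P.comp (a (i + j)) (chain x a i j)

end RayCategory

/-- Paths in the quiver `Q_P` of a ray category `P` (the arrow `f` of `cons f hf p`
is the *last* arrow of the path). -/
inductive RPath (P : RayCategory) : P.Obj → P.Obj → Type
  | nil (x : P.Obj) : RPath P x x
  | cons {x y z : P.Obj} (f : P.Hom y z) (hf : P.IsIrreducible f) (p : RPath P x y) :
      RPath P x z

namespace RPath

variable {P : RayCategory}

/-- the morphism `v⃗` of `P` obtained by composing the arrows of a path `v` -/
def toHom : ∀ {x y : P.Obj}, RPath P x y → P.Hom x y
  | _, _, .nil x => P.id x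
  | _, _, .cons f _ p => P.comp f p.toHom

def length : ∀ {x y : P.Obj}, RPath P x y → ℕ
  | _, _, .nil _ => 0
  | _, _, .cons _ _ p => p.length + 1

/-- the set of points visited by a path -/
def points : ∀ {x y : P.Obj}, RPath P x y → Set P.Obj
  | _, _, .nil x => {x}
  | _, _, @RPath.cons _ _ _ z _ _ p => insert z p.points

/-- concatenation of paths -/
def append : ∀ {x y z : P.Obj}, RPath P y z → RPath P x y → RPath P x z
  | _, _, _, .nil _, p => p
  | _, _, _, .cons f hf q, p => .cons f hf (q.append p)

/-- the arrow `g` occurs in the path -/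
def HasArrow : ∀ {x y : P.Obj}, RPath P x y → ∀ {a b : P.Obj}, P.Hom a b → Prop
  | _, _, .nil _, _, _, _ => False
  | _, _, .cons f _ p, _, _, g => HEq f g ∨ p.HasArrow g

/-- one step of the interlacing relation: `v = p v' q`, `w = p w' q` with
`v⃗' = w⃗' ≠ 0` and `p`, `q` not both identities -/
def InterlaceStep {x y : P.Obj} (v w : RPath P x y) : Prop :=
  ∃ (a b : P.Obj) (p : RPath P b y) (v' w' : RPath P a b) (q : RPath P x a),
    v = p.append (v'.append q) ∧ w = p.append (w'.append q) ∧
    v'.toHom = w'.toHom ∧ v'.toHom ≠ P.zero a b ∧ ¬ (p.length = 0 ∧ q.length = 0)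

/-- two paths are interlaced if they lie in the transitive closure of the relation above -/
def Interlaced {x y : P.Obj} (v w : RPath P x y) : Prop :=
  Relation.TransGen (fun v' w' : RPath P x y => InterlaceStep v' w') v w

end RPath

/-- a chain of arrows as a path -/
def pchain (P : RayCategory) (x : ℕ → P.Obj) (a : ∀ i : ℕ, P.Hom (x i) (x (i + 1)))
    (ha : ∀ i, P.IsIrreducible (a i)) (i : ℕ) : ∀ j : ℕ, RPath P (x i) (x (i + j))
  | 0 => .nil (x i)
  | j + 1 => .cons (a (i + j)) (ha (i + j)) (pchain P x a ha i j)

/-- A contour `C = {v,w}` of `P` from `x` to `y` : a pair of different, non-interlaced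
paths with `v⃗ = w⃗ ≠ 0`. -/
structure Contour (P : RayCategory) (x y : P.Obj) : Type where
  v : RPath P x y
  w : RPath P x y
  ne : v ≠ w
  hom_eq : v.toHom = w.toHom
  nz : v.toHom ≠ P.zero x y
  nint : ¬ RPath.Interlaced v w
/-- A module over the linearization `k(D/I)` of the quotient by the ideal generated by the
morphisms in `I` of the full subcategory of `P` supported by `D`:
a `k`-linear functor defined on the morphisms between points of `D`, vanishing on `I`.
For `D = Set.univ` and `I = fun _ _ _ => False` this is exactly a `k(P)`-module. -/
structure RMod (P : RayCategory) (k : Type) [Field k] (D : Set P.Obj)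
    (I : ∀ a b : P.Obj, P.Hom a b → Prop) where
  M : P.Obj → Type
  [acg : ∀ x, AddCommGroup (M x)]
  [mod : ∀ x, Module k (M x)]
  act : ∀ {x y : P.Obj}, P.Hom x y → (M x →ₗ[k] M y)
  act_id : ∀ x ∈ D, act (P.id x) = LinearMap.id
  act_comp : ∀ {x y z : P.Obj}, x ∈ D → y ∈ D → z ∈ D →
      ∀ (g : P.Hom y z) (f : P.Hom x y), act (P.comp g f) = (act g).comp (act f)
  act_zero : ∀ {x y : P.Obj}, x ∈ D → y ∈ D → act (P.zero x y) = 0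
  supp : ∀ x : P.Obj, x ∉ D → ∀ m : M x, m = 0
  killed : ∀ {a b : P.Obj} (f : P.Hom a b), I a b f → act f = 0

attribute [instance] RMod.acg RMod.mod

/-- morphisms of modules -/
structure RModHom {P : RayCategory} {k : Type} [Field k] {D : Set P.Obj}
    {I : ∀ a b : P.Obj, P.Hom a b → Prop} (M N : RMod P k D I) where
  app : ∀ x : P.Obj, M.M x →ₗ[k] N.M x
  natural : ∀ {x y : P.Obj} (f : P.Hom x y), (N.act f).comp (app x) = (app y).comp (M.act f)

/-- isomorphism of modules -/
def RModIso {P : RayCategory} {k : Type} [Field k] {D : Set P.Obj}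
    {I : ∀ a b : P.Obj, P.Hom a b → Prop} (M N : RMod P k D I) : Prop :=
  ∃ φ : RModHom M N, ∀ x, Function.Bijective (φ.app x)

namespace RMod

variable {P : RayCategory} {k : Type} [Field k] {D : Set P.Obj}
  {I : ∀ a b : P.Obj, P.Hom a b → Prop}

/-- finite-dimensional: the sum of the dimensions of all `M x` is finite -/
def FinDim (M : RMod P k D I) : Prop :=
  (∀ x, FiniteDimensional k (M.M x)) ∧ {x : P.Obj | ∃ m : M.M x, m ≠ 0}.Finite

def Nonzero (M : RMod P k D I) : Prop := ∃ x, ∃ m : M.M x, m ≠ 0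

/-- indecomposable: nonzero, and the only idempotent endomorphisms are `0` and `id` -/
def Indec (M : RMod P k D I) : Prop :=
  M.Nonzero ∧ ∀ e : RModHom M M, (∀ x, (e.app x).comp (e.app x) = e.app x) →
    (∀ x, e.app x = 0) ∨ (∀ x, e.app x = LinearMap.id)

end RMod

/-- the full subcategory supported by `D` of the quotient of `P` by the ideal generated
by `I` is (locally) representation-finite: for any field `k`, every point lies in the
support of only finitely many isomorphism classes of finite-dimensional indecomposables -/
def RepFin (P : RayCategory) (D : Set P.Obj) (I : ∀ a b : P.Obj, P.Hom a b → Prop) : Prop :=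
  ∀ (k : Type) [Field k], ∀ x : P.Obj,
    ∃ (ι : Type) (_ : Finite ι) (rep : ι → RMod P k D I),
      ∀ M : RMod P k D I, M.FinDim → M.Indec → (∃ m : M.M x, m ≠ 0) →
        ∃ i : ι, RModIso (rep i) M

/-- the trivial ideal -/
def RayCategory.noIdeal (P : RayCategory) : ∀ a b : P.Obj, P.Hom a b → Prop :=
  fun _ _ _ => False

/-- `P` is locally representation-finite -/
def LocRepFin (P : RayCategory) : Prop := RepFin P Set.univ P.noIdeal

/-- the ideal of `P` generated by the morphism `μ` -/
def IdealOf (P : RayCategory) {a b : P.Obj} (mu : P.Hom a b) :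
    ∀ s t : P.Obj, P.Hom s t → Prop :=
  fun s t f => ∃ (g : P.Hom b t) (h : P.Hom s a), f = P.comp g (P.comp mu h)

/-- an ideal of a ray category -/
structure RIdeal (P : RayCategory) where
  mem : ∀ a b : P.Obj, P.Hom a b → Prop
  zero_mem : ∀ a b : P.Obj, mem a b (P.zero a b)
  comp_mem_left : ∀ {a b c : P.Obj} (g : P.Hom b c) (f : P.Hom a b),
      mem a b f → mem a c (P.comp g f)
  comp_mem_right : ∀ {a b c : P.Obj} (g : P.Hom b c) (f : P.Hom a b),
      mem b c g → mem a c (P.comp g f)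

/-- `P` is minimal representation-infinite: not locally representation-finite, but every
proper quotient (quotient by an ideal containing a nonzero morphism) is locally
representation-finite -/
def MinRepInfinite (P : RayCategory) : Prop :=
  ¬ LocRepFin P ∧ ∀ J : RIdeal P,
    (∃ (a b : P.Obj) (f : P.Hom a b), f ≠ P.zero a b ∧ J.mem a b f) →
      RepFin P Set.univ J.mem

/-- support of the indecomposable projective module `P_x` over the quotient of `P` by `I` -/
def ProjSupp (P : RayCategory) (I : ∀ a b : P.Obj, P.Hom a b → Prop) (x : P.Obj) :
    Set P.Obj :=
  {y : P.Obj | ∃ f : P.Hom x y, f ≠ P.zero x y ∧ ¬ I x y f}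

/-- support of the indecomposable injective module `I_y` over the quotient of `P` by `I` -/
def InjSupp (P : RayCategory) (I : ∀ a b : P.Obj, P.Hom a b → Prop) (y : P.Obj) :
    Set P.Obj :=
  {z : P.Obj | ∃ f : P.Hom z y, f ≠ P.zero z y ∧ ¬ I z y f}

namespace Contour

variable {P : RayCategory} {x y : P.Obj} (C : Contour P x y)

/-- points of the contour = points of the full subcategory `P(C)` -/
def points : Set P.Obj := C.v.points ∪ C.w.points

/-- the contour is non-deep -/
def NonDeep : Prop := ¬ P.IsDeep C.v.toHom

/-- the ideal generated by `π(y)v⃗`, so that `P' = P/π(y)v⃗` (transit case) -/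
def It : ∀ a b : P.Obj, P.Hom a b → Prop := IdealOf P (P.comp (P.pi y) C.v.toHom)

/-- the ideal generated by `v⃗π(x)` (cotransit case) -/
def Ic : ∀ a b : P.Obj, P.Hom a b → Prop := IdealOf P (P.comp C.v.toHom (P.pi x))

/-- decisive subcategories of `P' = P/π(y)v⃗` for `C` (transit case) -/
def DecisiveT (D : Set P.Obj) : Prop :=
  x ∈ D ∧ y ∈ D ∧ D ⊆ ProjSupp P C.It x ∪ InjSupp P C.It y

/-- decisive subcategories (cotransit case) -/
def DecisiveC (D : Set P.Obj) : Prop :=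
  x ∈ D ∧ y ∈ D ∧ D ⊆ ProjSupp P C.Ic x ∪ InjSupp P C.Ic y

/-- mildness in the transit case: `C` is non-deep, `v⃗` is transit, and every decisive
full subcategory of `P/π(y)v⃗` with at most 4 points is representation-finite -/
def MildTransit : Prop :=
  C.NonDeep ∧ P.IsTransit C.v.toHom ∧
    ∀ D : Set P.Obj, C.DecisiveT D → D.Finite → D.ncard ≤ 4 → RepFin P D C.It

/-- mildness in the cotransit case (dual) -/
def MildCotransit : Prop :=
  C.NonDeep ∧ P.IsCotransit C.v.toHom ∧
    ∀ D : Set P.Obj, C.DecisiveC D → D.Finite → D.ncard ≤ 4 → RepFin P D C.Ic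

/-- a mild contour -/
def Mild : Prop := C.MildTransit ∨ C.MildCotransit

/-- equality of contours (with possibly different endpoints), as sets `{v,w}` -/
def Same {x' y' : P.Obj} (C' : Contour P x' y') : Prop :=
  ∃ (_ : x = x') (_ : y = y'),
    (HEq C.v C'.v ∧ HEq C.w C'.w) ∨ (HEq C.v C'.w ∧ HEq C.w C'.v)

end Contour
/-- the full subcategory on `{x,y}` is a dumb-bell with loops `lam`, `rho`, arrow `mu`
and nilpotency indices `r`, `s` -/
def DumbBellData (P : RayCategory) (x y : P.Obj) (lam : P.Hom x x) (mu : P.Hom x y)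
    (rho : P.Hom y y) (r s : ℕ) : Prop :=
  x ≠ y ∧
  P.IsIrreducibleOn {x, y} lam ∧ P.IsIrreducibleOn {x, y} mu ∧ P.IsIrreducibleOn {x, y} rho ∧
  (∀ a b : P.Obj, a ∈ ({x, y} : Set P.Obj) → b ∈ ({x, y} : Set P.Obj) →
      ∀ f : P.Hom a b, P.IsIrreducibleOn {x, y} f → HEq f lam ∨ HEq f mu ∨ HEq f rho) ∧
  P.comp mu lam = P.comp rho mu ∧
  P.pow lam r = P.zero x x ∧ P.pow rho s = P.zero y y ∧
  P.pow lam (r - 1) ≠ P.zero x x ∧ P.pow rho (s - 1) ≠ P.zero y y ∧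
  min r s = 3 ∧ max r s ≤ 5 ∧
  (∀ f : P.Hom x x, ∃ i : ℕ, f = P.pow lam i) ∧
  (∀ f : P.Hom y y, ∃ i : ℕ, f = P.pow rho i) ∧
  (∀ f : P.Hom x y, f = P.zero x y ∨ ∃ i : ℕ, f = P.comp mu (P.pow lam i)) ∧
  (∀ i : ℕ, i < min r s → P.comp mu (P.pow lam i) ≠ P.zero x y) ∧
  (∀ f : P.Hom y x, f = P.zero y x)

/-- the full subcategory supported by `S` is a dumb-bell -/
def IsDumbBellOn (P : RayCategory) (S : Set P.Obj) : Prop :=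
  ∃ (x y : P.Obj) (lam : P.Hom x x) (mu : P.Hom x y) (rho : P.Hom y y) (r s : ℕ),
    DumbBellData P x y lam mu rho r s ∧ S = {x, y}

/-- the full subcategory on the points `x 0, …, x (n-1)` is a penny-farthing with arrows
`a i` (`a i = α_{i+1} : x_i → x_{i+1}`, indices mod `n`) and loop `rho` at `x 0` -/
def PennyData (P : RayCategory) (n : ℕ) (x : ℕ → P.Obj)
    (a : ∀ i : ℕ, P.Hom (x i) (x (i + 1))) (rho : P.Hom (x 0) (x 0)) : Prop :=
  1 ≤ n ∧
  (∀ i, x (i + n) = x i) ∧ (∀ i, HEq (a (i + n)) (a i)) ∧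
  (∀ i j, i < n → j < n → x i = x j → i = j) ∧
  (∀ i, P.IsIrreducibleOn (Set.range x) (a i)) ∧
  P.IsIrreducibleOn (Set.range x) rho ∧
  (∀ b c : P.Obj, b ∈ Set.range x → c ∈ Set.range x → ∀ f : P.Hom b c,
      P.IsIrreducibleOn (Set.range x) f → HEq f rho ∨ ∃ i, i < n ∧ HEq f (a i)) ∧
  -- relation α₁αₙ = 0
  P.chain x a (n - 1) 2 = P.zero (x (n - 1)) (x (n - 1 + 2)) ∧
  -- relation αₙ⋯α₁ = ρ²
  (∀ h : x (0 + n) = x 0, P.castHom rfl h (P.chain x a 0 n) = P.comp rho rho) ∧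
  -- relations 0 = α_{e i}⋯α₁ ρ αₙ⋯α_{i+1} for a non-decreasing e : {1,…,n-1} → {1,…,n}
  ∃ e : ℕ → ℕ,
    (∀ i, 1 ≤ i → i ≤ n - 1 → 1 ≤ e i ∧ e i ≤ n) ∧
    (∀ i j, 1 ≤ i → i ≤ j → j ≤ n - 1 → e i ≤ e j) ∧
    (∀ i, 1 ≤ i → i ≤ n - 1 → ∀ h : x (i + (n - i)) = x 0,
      P.comp (P.chain x a 0 (e i))
        (P.comp rho (P.castHom rfl h (P.chain x a i (n - i)))) =
      P.zero (x i) (x (0 + e i)))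

/-- the full subcategory supported by `S` is a penny-farthing -/
def IsPennyFarthingOn (P : RayCategory) (S : Set P.Obj) : Prop :=
  ∃ (n : ℕ) (x : ℕ → P.Obj) (a : ∀ i : ℕ, P.Hom (x i) (x (i + 1))) (rho : P.Hom (x 0) (x 0)),
    PennyData P n x a rho ∧ S = Set.range x

/-- the full subcategory on `{x,z,t,y}` is a diamond with arrows
`gam : x → z`, `lam : z → x`, `del : x → t`, `bet : t → y`, `alp : z → y`, `kap : y → z` -/
def DiamondData (P : RayCategory) (x z t y : P.Obj) (gam : P.Hom x z) (lam : P.Hom z x)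
    (del : P.Hom x t) (bet : P.Hom t y) (alp : P.Hom z y) (kap : P.Hom y z) : Prop :=
  (x ≠ z ∧ x ≠ t ∧ x ≠ y ∧ z ≠ t ∧ z ≠ y ∧ t ≠ y) ∧
  P.IsIrreducibleOn {x, z, t, y} gam ∧ P.IsIrreducibleOn {x, z, t, y} lam ∧
  P.IsIrreducibleOn {x, z, t, y} del ∧ P.IsIrreducibleOn {x, z, t, y} bet ∧
  P.IsIrreducibleOn {x, z, t, y} alp ∧ P.IsIrreducibleOn {x, z, t, y} kap ∧
  (∀ a b : P.Obj, a ∈ ({x, z, t, y} : Set P.Obj) → b ∈ ({x, z, t, y} : Set P.Obj) →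
      ∀ f : P.Hom a b, P.IsIrreducibleOn {x, z, t, y} f →
        HEq f gam ∨ HEq f lam ∨ HEq f del ∨ HEq f bet ∨ HEq f alp ∨ HEq f kap) ∧
  P.comp alp gam = P.comp bet del ∧
  P.comp lam kap = P.zero y x ∧
  P.comp kap alp = P.comp gam lam

/-- the full subcategory supported by `S` is a diamond -/
def IsDiamondOn (P : RayCategory) (S : Set P.Obj) : Prop :=
  ∃ (x z t y : P.Obj) (gam : P.Hom x z) (lam : P.Hom z x) (del : P.Hom x t)
    (bet : P.Hom t y) (alp : P.Hom z y) (kap : P.Hom y z),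
    DiamondData P x z t y gam lam del bet alp kap ∧ S = {x, z, t, y}

local infixr:80 "⊚" => RayCategory.comp _

open RayCategory

namespace RayCategory

variable {P : RayCategory} {x y z w : P.Obj}

theorem pipow_add (x : P.Obj) (m n : ℕ) : P.pipow x (m + n) = P.pipow x m ⊚ P.pipow x n := by
  induction m with
  | zero => rw [Nat.zero_add, P.pipow_zero, P.id_comp]
  | succ m ih => rw [Nat.add_right_comm, P.pipow_succ, ih, P.pipow_succ x m, P.assoc]

theorem pipow_pow (f : P.Hom x x) (n : ℕ) (hf : f = P.pipow x 1) : P.pow f n = P.pipow x n := by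
  subst hf
  induction n with
  | zero => exact (P.pipow_zero x).symm
  | succ n ih => rw [pow, ih, ← P.pipow_succ]

theorem pipow_eq_zero {n : ℕ} (h : P.nilp x ≤ n) : P.pipow x n = P.zero x x := by
  obtain ⟨m, rfl⟩ := Nat.exists_eq_add_of_le h
  rw [pipow_add, P.pipow_nilp, P.zero_comp]

theorem pipow_ne_zero {n : ℕ} (h : n < P.nilp x) : P.pipow x n ≠ P.zero x x := by
  intro h0
  apply P.pipow_nilp_ne x
  have : P.nilp x - 1 = (P.nilp x - 1 - n) + n := by omega
  rw [this, pipow_add, h0, P.comp_zero]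

theorem pipow_eq_zero_iff {n : ℕ} : P.pipow x n = P.zero x x ↔ P.nilp x ≤ n :=
  ⟨fun h => by by_contra h'; exact pipow_ne_zero (by omega) h, pipow_eq_zero⟩

theorem id_ne_zero (x : P.Obj) : P.id x ≠ P.zero x x := by
  rw [← P.pipow_zero]; exact pipow_ne_zero (P.nilp_pos x)

theorem cancelL {g : P.Hom y z} {a b : P.Hom x y} (h : g ⊚ a = g ⊚ b)
    (h0 : g ⊚ a ≠ P.zero x z) : a = b := by
  refine P.cancel (P.id x) a b g ?_ ?_ <;> simpa only [P.comp_id]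

theorem cancelR {a b : P.Hom y z} {g : P.Hom x y} (h : a ⊚ g = b ⊚ g)
    (h0 : a ⊚ g ≠ P.zero x z) : a = b := by
  refine P.cancel g a b (P.id z) ?_ ?_ <;> simpa only [P.id_comp]

theorem ne_zero_left {g : P.Hom y z} {f : P.Hom x y} (h : g ⊚ f ≠ P.zero x z) :
    g ≠ P.zero y z := by
  rintro rfl; exact h (P.zero_comp _)

theorem ne_zero_right {g : P.Hom y z} {f : P.Hom x y} (h : g ⊚ f ≠ P.zero x z) :
    f ≠ P.zero x y := by
  rintro rfl; exact h (P.comp_zero _)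

theorem pipow_comp_pipow (i j : ℕ) (f : P.Hom z x) :
    P.pipow x i ⊚ P.pipow x j ⊚ f = P.pipow x (i + j) ⊚ f := by
  rw [← P.assoc, ← pipow_add]

/-- A nonzero morphism is not fixed by a nontrivial multiplication with radical powers. -/
theorem absorb {f : P.Hom x y} (h0 : f ≠ P.zero x y) {i j : ℕ}
    (h : P.pipow y i ⊚ f ⊚ P.pipow x j = f) : i = 0 ∧ j = 0 := by
  have key : ∀ n, P.pipow y (n * i) ⊚ f ⊚ P.pipow x (n * j) = f := by
    intro n
    induction n with
    | zero => simp only [Nat.zero_mul, P.pipow_zero, P.comp_id, P.id_comp]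
    | succ n ih =>
      rw [Nat.succ_mul, Nat.succ_mul, pipow_add, pipow_add]
      have : P.pipow x (n * j) ⊚ P.pipow x j = P.pipow x j ⊚ P.pipow x (n * j) := by
        rw [← pipow_add, ← pipow_add, Nat.add_comm]
      rw [this]
      calc _ = P.pipow y (n * i) ⊚ (P.pipow y i ⊚ f ⊚ P.pipow x j) ⊚ P.pipow x (n * j) := by
            simp only [P.assoc]
        _ = f := by rw [h, ih]
  constructor
  · by_contra hi
    apply h0
    rw [← key (P.nilp y), pipow_eq_zero (n := P.nilp y * i), P.zero_comp]
    exact Nat.le_mul_of_pos_right _ (Nat.pos_of_ne_zero hi)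
  · by_contra hi
    apply h0
    rw [← key (P.nilp x), pipow_eq_zero (n := P.nilp x * j), P.comp_zero, P.comp_zero]
    exact Nat.le_mul_of_pos_right _ (Nat.pos_of_ne_zero hi)

theorem pipow_comp_inj {f : P.Hom x y} {i j : ℕ} (h : P.pipow y i ⊚ f = P.pipow y j ⊚ f)
    (h0 : P.pipow y i ⊚ f ≠ P.zero x y) : i = j := by
  wlog hij : i ≤ j generalizing i j
  · exact (this h.symm (h ▸ h0) (by omega)).symm
  obtain ⟨d, rfl⟩ := Nat.exists_eq_add_of_le hij
  rw [← pipow_comp_pipow] at h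
  have h1 := cancelL h h0
  have := absorb (ne_zero_right h0) (i := d) (j := 0) (by rw [P.pipow_zero, P.comp_id, ← h1])
  omega

theorem comp_pipow_inj {f : P.Hom x y} {i j : ℕ} (h : f ⊚ P.pipow x i = f ⊚ P.pipow x j)
    (h0 : f ⊚ P.pipow x i ≠ P.zero x y) : i = j := by
  wlog hij : i ≤ j generalizing i j
  · exact (this h.symm (h ▸ h0) (by omega)).symm
  obtain ⟨d, rfl⟩ := Nat.exists_eq_add_of_le hij
  rw [Nat.add_comm, pipow_add, ← P.assoc] at h
  have h1 := cancelR h h0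
  have := absorb (ne_zero_left h0) (i := 0) (j := d) (by rw [P.pipow_zero, P.id_comp, ← h1])
  omega

theorem pipow_inj {i j : ℕ} (h : P.pipow x i = P.pipow x j) (h0 : P.pipow x i ≠ P.zero x x) :
    i = j := by
  apply comp_pipow_inj (f := P.id x) <;> simpa only [P.id_comp]

/-- No proper retracts. -/
theorem eq_of_retract {f : P.Hom x y} {g : P.Hom y x} (h : g ⊚ f = P.id x) : x = y := by
  obtain ⟨n, hn⟩ := P.endo_cyclic y (f ⊚ g)
  have hne : f ⊚ g ≠ P.zero y y := by
    intro h0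
    apply id_ne_zero x
    calc P.id x = g ⊚ (f ⊚ g) ⊚ f := by rw [P.assoc, ← P.assoc, h, P.id_comp]
      _ = _ := by rw [h0, P.zero_comp, P.comp_zero]
  have hid : (f ⊚ g) ⊚ (f ⊚ g) = f ⊚ g := by
    rw [P.assoc, ← P.assoc g, h, P.id_comp]
  have := absorb hne (i := n) (j := 0) (by rw [P.pipow_zero, P.comp_id, ← hn, hid])
  rw [this.1, P.pipow_zero] at hn
  exact P.no_iso f g h hn

theorem endo_of_ne (hne : x ≠ y) (f : P.Hom x y) (g : P.Hom y x) :
    ∃ i, g ⊚ f = P.pipow x (i + 1) := by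
  obtain ⟨i, hi⟩ := P.endo_cyclic x (g ⊚ f)
  cases i with
  | zero => exact absurd (eq_of_retract (hi.trans (P.pipow_zero x))) hne
  | succ i => exact ⟨i, hi⟩

theorem isId_self {f : P.Hom x x} : P.IsId f ↔ f = P.id x :=
  ⟨fun ⟨_, h⟩ => eq_of_heq h, fun h => ⟨rfl, heq_of_eq h⟩⟩

theorem IsId.eq {f : P.Hom x y} (h : P.IsId f) : x = y := h.1

theorem isId_id (x : P.Obj) : P.IsId (P.id x) := ⟨rfl, HEq.rfl⟩

theorem not_isId {f : P.Hom x y} (h : x ≠ y) : ¬ P.IsId f := fun h' => h h'.eq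

/-- A product of two morphisms is an identity only if both factors are. -/
theorem isId_comp {g : P.Hom y z} {f : P.Hom x y} (h : P.IsId (g ⊚ f)) :
    P.IsId g ∧ P.IsId f := by
  obtain rfl := h.eq
  rw [isId_self] at h
  obtain rfl := eq_of_retract h
  obtain ⟨i, rfl⟩ := P.endo_cyclic x g
  obtain ⟨j, rfl⟩ := P.endo_cyclic x f
  rw [← pipow_add, ← P.pipow_zero] at h
  have := pipow_inj h.symm (by rw [P.pipow_zero]; exact id_ne_zero x)
  obtain ⟨rfl, rfl⟩ : i = 0 ∧ j = 0 := by omega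
  simp only [P.pipow_zero, isId_id, and_self]

theorem pipow_isId {n : ℕ} : P.IsId (P.pipow x n) ↔ n = 0 := by
  rw [isId_self]
  constructor
  · intro h
    rw [← P.pipow_zero] at h
    exact (pipow_inj h.symm (by rw [P.pipow_zero]; exact id_ne_zero x)).symm
  · rintro rfl; exact P.pipow_zero x

theorem IsIrreducible.on {f : P.Hom x y} (h : P.IsIrreducible f) (S : Set P.Obj) :
    P.IsIrreducibleOn S f := ⟨h.1, h.2.1, fun u _ => h.2.2 u⟩

theorem IsIrreducibleOn.mono {f : P.Hom x y} {S T : Set P.Obj} (h : P.IsIrreducibleOn S f)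
    (hT : T ⊆ S) : P.IsIrreducibleOn T f := ⟨h.1, h.2.1, fun u hu => h.2.2 u (hT hu)⟩

theorem irreducibleOn_loop {S : Set P.Obj} (hx : x ∈ S) {f : P.Hom x x}
    (h : P.IsIrreducibleOn S f) : f = P.pipow x 1 := by
  obtain ⟨i, rfl⟩ := P.endo_cyclic x f
  have h1 : i ≠ 0 := fun h0 => h.2.1 (pipow_isId.2 h0)
  by_contra h2
  have h3 : i ≠ 1 := by rintro rfl; exact h2 rfl
  have := h.2.2 x hx (P.pipow x 1) (P.pipow x (i - 1)) (by rw [← pipow_add]; congr 1; omega)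
  rw [pipow_isId, pipow_isId] at this
  omega

theorem irreducible_loop {f : P.Hom x x} (h : P.IsIrreducible f) : f = P.pipow x 1 :=
  irreducibleOn_loop (Set.mem_univ x) (h.on Set.univ)

instance hom_finite (x y : P.Obj) : Finite (P.Hom x y) := by
  obtain ⟨g, h | h⟩ := P.hom_cyclic x y
  · refine Finite.of_surjective (fun i : Fin (P.nilp y + 1) => P.pipow y i ⊚ g) fun f => ?_
    obtain ⟨i, rfl⟩ := h f
    refine ⟨⟨min i (P.nilp y), by omega⟩, ?_⟩
    rcases le_total i (P.nilp y) with h | h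
    · simp only [min_eq_left h]
    · simp only [min_eq_right h, pipow_eq_zero h, P.pipow_nilp]
  · refine Finite.of_surjective (fun i : Fin (P.nilp x + 1) => g ⊚ P.pipow x i) fun f => ?_
    obtain ⟨i, rfl⟩ := h f
    refine ⟨⟨min i (P.nilp x), by omega⟩, ?_⟩
    rcases le_total i (P.nilp x) with h | h
    · simp only [min_eq_left h]
    · simp only [min_eq_right h, pipow_eq_zero h, P.pipow_nilp]

/-- the factorizations of a morphism into two factors -/
def Fac (f : P.Hom x y) : Set (Σ u : P.Obj, P.Hom u y × P.Hom x u) :=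
  {t | f = t.2.1 ⊚ t.2.2}

theorem fac_finite {f : P.Hom x y} (h0 : f ≠ P.zero x y) : (Fac f).Finite := by
  refine ((P.finite_target x).preimage' (f := Sigma.fst) fun u _ => ?_).subset
    fun t ht => ⟨t.2.2, ?_⟩
  · refine (Set.finite_range (fun a : P.Hom u y × P.Hom x u =>
      (⟨u, a⟩ : Σ u : P.Obj, P.Hom u y × P.Hom x u))).subset ?_
    rintro ⟨_, a⟩ rfl
    exact ⟨a, rfl⟩
  have ht : f = t.2.1 ⊚ t.2.2 := ht
  exact ne_zero_right (ht ▸ h0)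

theorem fac_card_left {g : P.Hom z y} {h : P.Hom x z} (h0 : g ⊚ h ≠ P.zero x y)
    (hh : ¬ P.IsId h) : (Fac g).ncard < (Fac (g ⊚ h)).ncard := by
  let F : (Σ u : P.Obj, P.Hom u y × P.Hom z u) → (Σ u : P.Obj, P.Hom u y × P.Hom x u) :=
    fun t => ⟨t.1, t.2.1, t.2.2 ⊚ h⟩
  have hF : Set.InjOn F (Fac g) := by
    rintro ⟨u, a, b⟩ h1 ⟨u', a', b'⟩ h2 h3
    have h1 : g = a ⊚ b := h1
    have h2 : g = a' ⊚ b' := h2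
    simp only [F, Sigma.mk.injEq] at h3
    obtain ⟨rfl, h3⟩ := h3
    rw [heq_eq_eq, Prod.mk.injEq] at h3
    obtain ⟨rfl, h3⟩ := h3
    rw [cancelR h3 (ne_zero_right (g := a) (by rwa [← P.assoc, ← h1]))]
  rw [← hF.ncard_image]
  refine Set.ncard_lt_ncard ⟨?_, fun hsub => ?_⟩ (fac_finite h0)
  · rintro _ ⟨⟨u, a, b⟩, h1, rfl⟩
    have h1 : g = a ⊚ b := h1
    change g ⊚ h = a ⊚ b ⊚ h
    rw [h1, P.assoc]
  · have : (⟨x, g ⊚ h, P.id x⟩ : Σ u : P.Obj, P.Hom u y × P.Hom x u) ∈ Fac (g ⊚ h) :=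
      (P.comp_id _).symm
    obtain ⟨⟨u, a, b⟩, -, h2⟩ := hsub this
    simp only [F, Sigma.mk.injEq] at h2
    obtain ⟨rfl, h2⟩ := h2
    rw [heq_eq_eq, Prod.mk.injEq] at h2
    exact hh (isId_comp (h2.2 ▸ isId_id _)).2

theorem fac_card_right {g : P.Hom z y} {h : P.Hom x z} (h0 : g ⊚ h ≠ P.zero x y)
    (hg : ¬ P.IsId g) : (Fac h).ncard < (Fac (g ⊚ h)).ncard := by
  let F : (Σ u : P.Obj, P.Hom u z × P.Hom x u) → (Σ u : P.Obj, P.Hom u y × P.Hom x u) :=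
    fun t => ⟨t.1, g ⊚ t.2.1, t.2.2⟩
  have hF : Set.InjOn F (Fac h) := by
    rintro ⟨u, a, b⟩ h1 ⟨u', a', b'⟩ h2 h3
    have h1 : h = a ⊚ b := h1
    have h2 : h = a' ⊚ b' := h2
    simp only [F, Sigma.mk.injEq] at h3
    obtain ⟨rfl, h3⟩ := h3
    rw [heq_eq_eq, Prod.mk.injEq] at h3
    obtain ⟨h3, rfl⟩ := h3
    rw [cancelL h3 (ne_zero_left (f := b) (by rwa [P.assoc, ← h1]))]
  rw [← hF.ncard_image]
  refine Set.ncard_lt_ncard ⟨?_, fun hsub => ?_⟩ (fac_finite h0)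
  · rintro _ ⟨⟨u, a, b⟩, h1, rfl⟩
    have h1 : h = a ⊚ b := h1
    change g ⊚ h = (g ⊚ a) ⊚ b
    rw [h1, P.assoc]
  · have : (⟨y, P.id y, g ⊚ h⟩ : Σ u : P.Obj, P.Hom u y × P.Hom x u) ∈ Fac (g ⊚ h) :=
      (P.id_comp _).symm
    obtain ⟨⟨u, a, b⟩, -, h2⟩ := hsub this
    simp only [F, Sigma.mk.injEq] at h2
    obtain ⟨rfl, h2⟩ := h2
    rw [heq_eq_eq, Prod.mk.injEq] at h2
    exact hg (isId_comp (h2.1 ▸ isId_id _)).1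

end RayCategory

namespace RPath

variable {P : RayCategory} {x y z w : P.Obj}

theorem toHom_nil (x : P.Obj) : (RPath.nil (P := P) x).toHom = P.id x := by rw [toHom]

theorem nil_append (p : RPath P x y) : (RPath.nil y).append p = p := by rw [append]

theorem points_nil (x : P.Obj) : (RPath.nil (P := P) x).points = {x} := by rw [points]

theorem points_cons (f : P.Hom y z) (hf : P.IsIrreducible f) (p : RPath P x y) :
    (RPath.cons f hf p).points = insert z p.points := by rw [points]

theorem toHom_append (q : RPath P y z) (p : RPath P x y) :
    (q.append p).toHom = q.toHom ⊚ p.toHom := by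
  induction q with
  | nil => rw [nil_append, toHom_nil, P.id_comp]
  | cons f hf q ih => simp only [append, toHom, ih, P.assoc]

theorem append_assoc (r : RPath P z w) (q : RPath P y z) (p : RPath P x y) :
    (r.append q).append p = r.append (q.append p) := by
  induction r with
  | nil => rw [nil_append, nil_append]
  | cons f hf r ih => simp only [append, ih]

theorem append_nil (q : RPath P y z) : q.append (.nil y) = q := by
  induction q with
  | nil => rw [nil_append]
  | cons f hf q ih => simp only [append, ih]

/-- Every nonzero morphism is a product of irreducible ones. -/
theorem exists_toHom_eq (f : P.Hom x y) (h0 : f ≠ P.zero x y) :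
    ∃ v : RPath P x y, v.toHom = f := by
  induction hn : (RayCategory.Fac f).ncard using Nat.strong_induction_on generalizing x y with
  | _ n ih =>
  by_cases hid : P.IsId f
  · obtain rfl := hid.eq
    exact ⟨.nil x, by rw [toHom_nil, RayCategory.isId_self.1 hid]⟩
  by_cases hirr : P.IsIrreducible f
  · exact ⟨.cons f hirr (.nil x), by rw [toHom, toHom_nil, P.comp_id]⟩
  have : ∃ (z : P.Obj) (g : P.Hom z y) (h : P.Hom x z),
      f = g ⊚ h ∧ ¬ P.IsId g ∧ ¬ P.IsId h := by
    by_contra hc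
    push Not at hc
    refine hirr ⟨h0, hid, fun z g h e => ?_⟩
    by_contra hc'
    rw [not_or] at hc'
    exact hc'.2 (hc z g h e hc'.1)
  obtain ⟨z, g, h, rfl, hg, hh⟩ := this
  subst hn
  obtain ⟨v, hv⟩ := ih _ (RayCategory.fac_card_left h0 hh) g (RayCategory.ne_zero_left h0) rfl
  obtain ⟨w, hw⟩ := ih _ (RayCategory.fac_card_right h0 hg) h (RayCategory.ne_zero_right h0) rfl
  exact ⟨v.append w, by rw [toHom_append, hv, hw]⟩

theorem toHom_of_length_eq_zero {p : RPath P x y} (h : p.length = 0) : P.IsId p.toHom := by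
  cases p with
  | nil => rw [toHom_nil]; exact RayCategory.isId_id _
  | cons => simp [length] at h

/-- paths with the same composite and a common nontrivial last segment are interlaced -/
theorem interlaceStep_left {r : RPath P y z} (hr : r.length ≠ 0) {v w : RPath P x y}
    (h : v.toHom = w.toHom) (h0 : v.toHom ≠ P.zero x y) :
    InterlaceStep (r.append v) (r.append w) :=
  ⟨x, y, r, v, w, .nil x, by rw [append_nil], by rw [append_nil], h, h0, fun h => hr h.1⟩

/-- paths with the same composite and a common nontrivial first segment are interlaced -/
theorem interlaceStep_right {r : RPath P x y} (hr : r.length ≠ 0) {v w : RPath P y z}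
    (h : v.toHom = w.toHom) (h0 : v.toHom ≠ P.zero y z) :
    InterlaceStep (v.append r) (w.append r) :=
  ⟨y, z, .nil z, v, w, r, by rw [nil_append], by rw [nil_append], h, h0, fun h => hr h.2⟩

/-- a path through `t` factors through `t` -/
theorem exists_factor {p : RPath P x y} {t : P.Obj} (ht : t ∈ p.points) :
    ∃ (g : P.Hom t y) (h : P.Hom x t), p.toHom = g ⊚ h := by
  induction p with
  | nil =>
    rw [points_nil, Set.mem_singleton_iff] at ht
    subst ht
    exact ⟨P.id _, P.id _, by rw [toHom_nil, P.comp_id]⟩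
  | cons f hf p ih =>
    rw [points_cons, Set.mem_insert_iff] at ht
    rcases ht with rfl | ht
    · exact ⟨P.id _, _, (P.id_comp _).symm⟩
    · obtain ⟨g, h, e⟩ := ih ht
      exact ⟨f ⊚ g, h, by rw [toHom, e, P.assoc]⟩

end RPath

namespace RModHom

variable {P : RayCategory} {k : Type} [Field k] {D : Set P.Obj}
  {I : ∀ a b : P.Obj, P.Hom a b → Prop} {M N L : RMod P k D I}

theorem nat_apply (φ : RModHom M N) {x y : P.Obj} (f : P.Hom x y) (m : M.M x) :
    N.act f (φ.app x m) = φ.app y (M.act f m) :=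
  LinearMap.congr_fun (φ.natural f) m

/-- composition of module homomorphisms -/
def comp (ψ : RModHom N L) (φ : RModHom M N) : RModHom M L where
  app x := ψ.app x ∘ₗ φ.app x
  natural f := by
    ext m
    simp only [LinearMap.comp_apply, nat_apply]

/-- the difference of two module homomorphisms -/
def sub (ψ φ : RModHom M N) : RModHom M N where
  app x := ψ.app x - φ.app x
  natural f := by
    ext m
    simp only [LinearMap.comp_apply, nat_apply, LinearMap.sub_apply, map_sub]

/-- the identity -/
def ident (M : RMod P k D I) : RModHom M M where
  app _ := LinearMap.id
  natural _ := rfl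

/-- the inverse of a bijective homomorphism -/
noncomputable def inv (φ : RModHom M N) (h : ∀ x, Function.Bijective (φ.app x)) :
    RModHom N M where
  app x := (LinearEquiv.ofBijective (φ.app x) (h x)).symm.toLinearMap
  natural {x y} f := by
    ext n
    obtain ⟨m, rfl⟩ := (h x).2 n
    apply (h y).1
    have h1 : ∀ (z : P.Obj) (m : M.M z),
        (LinearEquiv.ofBijective (φ.app z) (h z)).symm (φ.app z m) = m := fun z m =>
      (LinearEquiv.ofBijective (φ.app z) (h z)).symm_apply_apply m
    simp only [LinearMap.comp_apply, LinearEquiv.coe_coe, h1, nat_apply]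

theorem inv_injective (φ : RModHom M N) (h : ∀ x, Function.Bijective (φ.app x)) (x : P.Obj) :
    Function.Injective ((φ.inv h).app x) :=
  (LinearEquiv.ofBijective (φ.app x) (h x)).symm.injective

/-- the image of an endomorphism as a module -/
def image (e : RModHom M M) : RMod P k D I where
  M x := LinearMap.range (e.app x)
  act {x y} f := (M.act f).restrict (p := LinearMap.range (e.app x))
    (q := LinearMap.range (e.app y)) (by
      rintro _ ⟨m, rfl⟩
      exact ⟨M.act f m, (e.nat_apply f m).symm⟩)
  act_id x hx := by ext m; simp only [M.act_id x hx]; rfl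
  act_comp hx hy hz g f := by ext m; simp only [M.act_comp hx hy hz]; rfl
  act_zero hx hy := by ext m; simp only [M.act_zero hx hy]; rfl
  supp x hx m := Subtype.ext (M.supp x hx _)
  killed f hf := by ext m; simp only [M.killed f hf]; rfl

/-- the inclusion of the image -/
def imageIncl (e : RModHom M M) : RModHom e.image M where
  app x := (LinearMap.range (e.app x)).subtype
  natural _ := rfl

/-- the projection onto the image -/
def imageProj (e : RModHom M M) : RModHom M e.image where
  app x := (e.app x).rangeRestrict
  natural f := LinearMap.ext fun m => Subtype.ext (e.nat_apply f m)

end RModHom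

namespace RMod

variable {P : RayCategory} {k : Type} [Field k] {D : Set P.Obj}
  {I : ∀ a b : P.Obj, P.Hom a b → Prop}

/-- Every nonzero element of a finite-dimensional module has a nonzero component in some
indecomposable direct summand. -/
theorem exists_indec_summand (M : RMod P k D I) (hM : M.FinDim) (p : P.Obj) (u : M.M p)
    (hu : u ≠ 0) : ∃ (N : RMod P k D I) (i : RModHom N M) (r : RModHom M N),
      N.FinDim ∧ N.Indec ∧ r.app p u ≠ 0 ∧ ∀ x, Function.Injective (i.app x) := by
  classical
  have hfd := hM.1
  let rk : RModHom M M → ℕ := fun e =>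
    ∑ x ∈ hM.2.toFinset, Module.finrank k (LinearMap.range (e.app x))
  let Q : ℕ → Prop := fun n => ∃ e : RModHom M M,
    (∀ x, (e.app x).comp (e.app x) = e.app x) ∧ e.app p u ≠ 0 ∧ rk e = n
  have hQ : ∃ n, Q n := ⟨_, RModHom.ident M, fun _ => rfl, hu, rfl⟩
  obtain ⟨e, he, heu, hrk⟩ := Nat.find_spec hQ
  have hmin : ∀ f : RModHom M M, (∀ x, (f.app x).comp (f.app x) = f.app x) →
      f.app p u ≠ 0 → rk e ≤ rk f := fun f h1 h2 => hrk ▸ Nat.find_min' hQ ⟨f, h1, h2, rfl⟩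
  have he' : ∀ x m, e.app x (e.app x m) = e.app x m := fun x m => LinearMap.congr_fun (he x) m
  -- an idempotent below `e` which does not kill `u` equals `e`
  have key : ∀ f : RModHom M M, (∀ x m, f.app x (f.app x m) = f.app x m) →
      (∀ x m, e.app x (f.app x m) = f.app x m) → (∀ x m, f.app x (e.app x m) = f.app x m) →
      f.app p u ≠ 0 → ∀ x m, f.app x m = e.app x m := by
    intro f h1 h2 h3 h4 x m
    by_cases hx : x ∈ hM.2.toFinset
    · have hle : ∀ x, LinearMap.range (f.app x) ≤ LinearMap.range (e.app x) := by
        rintro x _ ⟨m, rfl⟩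
        exact ⟨_, h2 x m⟩
      have hr := hmin f (fun x => LinearMap.ext (h1 x)) h4
      have heq : LinearMap.range (f.app x) = LinearMap.range (e.app x) := by
        refine Submodule.eq_of_le_of_finrank_le (hle x) ?_
        by_contra hlt
        refine absurd hr (not_le.2 (Finset.sum_lt_sum (fun y _ => ?_) ⟨x, hx, not_le.1 hlt⟩))
        exact Submodule.finrank_mono (hle y)
      obtain ⟨m', hm'⟩ : e.app x m ∈ LinearMap.range (f.app x) := heq ▸ ⟨m, rfl⟩
      rw [← h3, ← hm', h1]
    · have hz : ∀ m : M.M x, m = 0 := by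
        intro m
        by_contra hm
        exact hx (hM.2.mem_toFinset.2 ⟨m, hm⟩)
      rw [hz (f.app x m), hz (e.app x m)]
  refine ⟨e.image, e.imageIncl, e.imageProj, ⟨fun x => ?_, ?_⟩, ⟨⟨p, e.imageProj.app p u, ?_⟩, ?_⟩,
    ?_, fun x => Subtype.val_injective⟩
  · change FiniteDimensional k (LinearMap.range (e.app x))
    infer_instance
  · refine hM.2.subset ?_
    rintro x ⟨m, hm⟩
    exact ⟨m.1, fun h => hm (Subtype.ext h)⟩
  · exact fun h => heu (congrArg Subtype.val h)
  · intro f hf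
    have hf' : ∀ x m, f.app x (f.app x m) = f.app x m := fun x m => LinearMap.congr_fun (hf x) m
    have hpi : ∀ x (m : e.image.M x), e.imageProj.app x (e.imageIncl.app x m) = m := by
      rintro x ⟨_, m, rfl⟩
      exact Subtype.ext (he' x m)
    have hip : ∀ x m, e.imageIncl.app x (e.imageProj.app x m) = e.app x m := fun _ _ => rfl
    let g : RModHom M M := e.imageIncl.comp (f.comp e.imageProj)
    have hg : ∀ x m, g.app x m = e.imageIncl.app x (f.app x (e.imageProj.app x m)) :=
      fun _ _ => rfl
    have hei : ∀ x m, e.app x (e.imageIncl.app x m) = e.imageIncl.app x m := by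
      intro x m
      rw [← hip, hpi]
    have hpe : ∀ x m, e.imageProj.app x (e.app x m) = e.imageProj.app x m := by
      intro x m
      rw [← hip, hpi]
    have hgg : ∀ x m, g.app x (g.app x m) = g.app x m := by
      intro x m
      rw [hg, hg, hpi, hf']
    have heg : ∀ x m, e.app x (g.app x m) = g.app x m := fun x m => by rw [hg, hei]
    have hge : ∀ x m, g.app x (e.app x m) = g.app x m := fun x m => by rw [hg, hg, hpe]
    have hinj : ∀ x, Function.Injective (e.imageIncl.app x) := fun x => Subtype.val_injective
    by_cases hu' : g.app p u = 0
    · left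
      have := key (e.sub g) ?_ ?_ ?_ ?_
      · intro x
        ext m
        obtain ⟨_, m, rfl⟩ := m
        have h1 : e.app x m - g.app x m = e.app x m := this x m
        rw [sub_eq_self, hg] at h1
        exact Subtype.ext h1
      · intro x m
        change e.app x (e.app x m - g.app x m) - g.app x (e.app x m - g.app x m) =
          e.app x m - g.app x m
        simp only [map_sub, he', heg, hge, hgg, sub_self, sub_zero]
      · intro x m
        change e.app x (e.app x m - g.app x m) = e.app x m - g.app x m
        rw [map_sub, he', heg]
      · intro x m
        change e.app x (e.app x m) - g.app x (e.app x m) = e.app x m - g.app x m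
        rw [he', hge]
      · change e.app p u - g.app p u ≠ 0
        rwa [hu', sub_zero]
    · right
      have := key g hgg heg hge hu'
      intro x
      ext m
      obtain ⟨_, m, rfl⟩ := m
      exact Subtype.ext ((hg x m).symm.trans (this x m))
  · exact fun h => heu (congrArg Subtype.val h)

/-- A one-parameter family of finite-dimensional modules with marked elements which are killed
by all homomorphisms to other members of the family prevents representation-finiteness. -/
theorem not_repFin_of_family (M : ℚ → RMod P ℚ D I) (hM : ∀ l, (M l).FinDim) (p : P.Obj)
    (u : ∀ l, (M l).M p) (hu : ∀ l, u l ≠ 0)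
    (hom : ∀ l m, l ≠ m → ∀ φ : RModHom (M l) (M m), φ.app p (u l) = 0) : ¬ RepFin P D I := by
  intro hR
  obtain ⟨ι, hι, rep, hrep⟩ := hR ℚ p
  choose N i r hN hind hr hi using fun l => exists_indec_summand (M l) (hM l) p (u l) (hu l)
  choose c hc using fun l => hrep (N l) (hN l) (hind l) ⟨_, hr l⟩
  choose φ hφ using hc
  obtain ⟨l, m, hlm, hcc⟩ := Finite.exists_ne_map_eq_of_infinite c
  have key : ∀ (j : ι) (ψ : RModHom (rep j) (N m)), j = c l →
      (∀ x, Function.Bijective (ψ.app x)) → False := by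
    rintro _ ψ rfl hψ
    have h0 := hom l m hlm ((i m).comp (ψ.comp (((φ l).inv (hφ l)).comp (r l))))
    refine hr l ((φ l).inv_injective (hφ l) p ((hψ p).1 (hi m p ?_)))
    rw [map_zero, map_zero, map_zero]
    exact h0
  exact key (c m) (φ m) hcc.symm (hφ m)

end RMod

/-- the ideal generated by a morphism -/
def RIdeal.of {P : RayCategory} {a b : P.Obj} (mu : P.Hom a b) : RIdeal P where
  mem := IdealOf P mu
  zero_mem s t := ⟨P.zero b t, P.zero s a, by rw [P.zero_comp]⟩
  comp_mem_left := by
    rintro s t u k f ⟨g, h, rfl⟩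
    exact ⟨k ⊚ g, h, by rw [P.assoc]⟩
  comp_mem_right := by
    rintro s t u k f ⟨g, h, rfl⟩
    exact ⟨g, h ⊚ f, by simp only [P.assoc]⟩

/-- A representation of the full subcategory on the points `d j`, together with a subspace
`A h` for each morphism `h` ending in one of these points, which controls the elements of the
coinduced module. -/
structure CoRep {P : RayCategory} (I : RIdeal P) {J : Type} (d : J → P.Obj) where
  V : J → Type
  [acg : ∀ j, AddCommGroup (V j)]
  [mod : ∀ j, Module ℚ (V j)]
  [fin : ∀ j, FiniteDimensional ℚ (V j)]
  act : ∀ {i j : J}, P.Hom (d i) (d j) → (V i →ₗ[ℚ] V j)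
  act_id : ∀ i v, act (P.id (d i)) v = v
  act_comp : ∀ {i j l : J} (g : P.Hom (d j) (d l)) (f : P.Hom (d i) (d j)) (v : V i),
    act (g ⊚ f) v = act g (act f v)
  A : ∀ {a : P.Obj} {i : J}, P.Hom a (d i) → Submodule ℚ (V i)
  A_comp : ∀ {a b : P.Obj} {i : J} (h : P.Hom b (d i)) (f : P.Hom a b), A (h ⊚ f) ≤ A h
  A_act : ∀ {i j : J} (f : P.Hom (d i) (d j)) (v : V i), act f v ∈ A f
  A_mem : ∀ {a : P.Obj} {i : J} (h : P.Hom a (d i)), I.mem a (d i) h → A h = ⊥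

namespace CoRep

attribute [instance] CoRep.acg CoRep.mod CoRep.fin

variable {P : RayCategory} {I : RIdeal P} {J : Type} {d : J → P.Obj} (S : CoRep I d)

theorem eq_zero_of_mem {a : P.Obj} {i : J} {h : P.Hom a (d i)} {v : S.V i} (hv : v ∈ S.A h)
    (hI : I.mem a (d i) h) : v = 0 := by
  rwa [S.A_mem h hI, Submodule.mem_bot] at hv

/-- the space of the coinduced module at a point -/
def space (D : Set P.Obj) (a : P.Obj) : Submodule ℚ (∀ i, P.Hom a (d i) → S.V i) where
  carrier := {t | (a ∉ D → t = 0) ∧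
    (∀ i j (g : P.Hom (d i) (d j)) (h : P.Hom a (d i)), t j (g ⊚ h) = S.act g (t i h)) ∧
    ∀ i (h : P.Hom a (d i)), t i h ∈ S.A h}
  zero_mem' := ⟨fun _ => rfl, fun i j g h => (map_zero (S.act g)).symm,
    fun i h => (S.A h).zero_mem⟩
  add_mem' := by
    rintro t t' ⟨h1, h2, h3⟩ ⟨h1', h2', h3'⟩
    refine ⟨fun ha => by rw [h1 ha, h1' ha, add_zero], fun i j g h => ?_, fun i h =>
      (S.A h).add_mem (h3 i h) (h3' i h)⟩
    simp only [Pi.add_apply, h2, h2', map_add]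
  smul_mem' := by
    rintro c t ⟨h1, h2, h3⟩
    refine ⟨fun ha => by rw [h1 ha, smul_zero], fun i j g h => ?_, fun i h =>
      (S.A h).smul_mem c (h3 i h)⟩
    simp only [Pi.smul_apply, h2, map_smul]

open Classical in
/-- the action on the coinduced module -/
noncomputable def coact (D : Set P.Obj) {a b : P.Obj} (f : P.Hom a b) :
    S.space D a →ₗ[ℚ] S.space D b :=
  if hb : b ∈ D then
    { toFun := fun t => ⟨fun i h => t.1 i (h ⊚ f), fun h => absurd hb h,
        fun i j g h => (congrArg (t.1 j) (P.assoc g h f)).trans (t.2.2.1 i j g _),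
        fun i h => S.A_comp h f (t.2.2.2 i (h ⊚ f))⟩
      map_add' := fun _ _ => rfl
      map_smul' := fun _ _ => rfl }
  else 0

theorem coact_apply {D : Set P.Obj} {a b : P.Obj} (f : P.Hom a b) (hb : b ∈ D)
    (t : S.space D a) (i : J) (h : P.Hom b (d i)) : (S.coact D f t).1 i h = t.1 i (h ⊚ f) := by
  rw [coact, dif_pos hb]
  rfl

/-- the coinduced module -/
noncomputable def coind (D : Set P.Obj) : RMod P ℚ D I.mem where
  M := fun a => S.space D a
  act := fun f => S.coact D f
  act_id x hx := by
    ext t i h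
    simp only [S.coact_apply _ hx, P.comp_id, LinearMap.id_apply]
  act_comp hx hy hz g f := by
    ext t i h
    simp only [S.coact_apply _ hz, S.coact_apply _ hy, P.assoc, LinearMap.comp_apply]
  act_zero {x y} hx hy := by
    ext t i h
    rw [S.coact_apply _ hy, P.comp_zero]
    exact S.eq_zero_of_mem (t.2.2.2 i _) (I.zero_mem _ _)
  supp x hx t := Subtype.ext (t.2.1 hx)
  killed {a b} f hf := by
    by_cases hb : b ∈ D
    · ext t i h
      rw [S.coact_apply _ hb]
      exact S.eq_zero_of_mem (t.2.2.2 i _) (I.comp_mem_left _ _ hf)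
    · ext1 t
      exact Subtype.ext ((S.coact D f t).2.1 hb)

theorem coind_finDim [Finite J] {D : Set P.Obj} (hD : D.Finite) : (S.coind D).FinDim := by
  refine ⟨fun x => ?_, hD.subset ?_⟩
  · change FiniteDimensional ℚ (S.space D x)
    infer_instance
  · rintro x ⟨t, ht⟩
    by_contra hx
    exact ht ((S.coind D).supp x hx t)

/-- the element of the coinduced module given by a vector -/
def yo (D : Set P.Obj) {j : J} (hj : d j ∈ D) (v : S.V j) : S.space D (d j) :=
  ⟨fun _ h => S.act h v, fun h => absurd hj h, fun _ _ g h => S.act_comp g h v,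
    fun _ h => S.A_act h v⟩

/-- Criterion for representation-infiniteness in terms of families of `CoRep`s. -/
theorem not_repFin [Finite J] {D : Set P.Obj} (hD : D.Finite) (hdD : ∀ j, d j ∈ D)
    (S : ℚ → CoRep I d) (p : J) (u : ∀ l, (S l).V p) (hu : ∀ l, u l ≠ 0)
    (hom : ∀ l m, l ≠ m → ∀ F : ∀ i, (S l).V i →ₗ[ℚ] (S m).V i,
      (∀ i j (f : P.Hom (d i) (d j)) v, F j ((S l).act f v) = (S m).act f (F i v)) →
      (∀ a ∈ D, ∀ t ∈ (S l).space D a, ∀ i (h : P.Hom a (d i)), F i (t i h) ∈ (S m).A h) →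
      F p (u l) = 0) : ¬ RepFin P D I.mem := by
  refine RMod.not_repFin_of_family (fun l => (S l).coind D) (fun l => (S l).coind_finDim hD)
    (d p) (fun l => (S l).yo D (hdD p) (u l)) (fun l h => hu l ?_) ?_
  · have := congrFun (congrFun (congrArg Subtype.val h) p) (P.id _)
    exact ((S l).act_id p (u l)).symm.trans this
  · intro l m hlm φ
    -- the value of `φ` on the element given by `v` is given by its value at the identity
    let F : ∀ i, (S l).V i →ₗ[ℚ] (S m).V i := fun i =>
      { toFun := fun v => (φ.app (d i) ((S l).yo D (hdD i) v)).1 i (P.id _)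
        map_add' := fun v w => by
          have : (S l).yo D (hdD i) (v + w) = (S l).yo D (hdD i) v + (S l).yo D (hdD i) w :=
            Subtype.ext (funext fun j => funext fun h => map_add ((S l).act h) v w)
          rw [this]
          exact congrFun (congrFun (congrArg Subtype.val (map_add (φ.app (d i)) _ _)) i) _
        map_smul' := fun c v => by
          have : (S l).yo D (hdD i) (c • v) = c • (S l).yo D (hdD i) v :=
            Subtype.ext (funext fun j => funext fun h => map_smul ((S l).act h) c v)
          rw [this]
          exact congrFun (congrFun (congrArg Subtype.val (map_smul (φ.app (d i)) _ _)) i) _ }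
    have key : ∀ a ∈ D, ∀ (t : (S l).space D a) i (h : P.Hom a (d i)),
        F i (t.1 i h) = (φ.app a t).1 i h := by
      intro a ha t i h
      have h1 : (S l).yo D (hdD i) (t.1 i h) = (S l).coact D h t := by
        refine Subtype.ext (funext fun j => funext fun g => ?_)
        rw [(S l).coact_apply h (hdD i)]
        exact (t.2.2.1 _ _ g h).symm
      have h2 : φ.app (d i) ((S l).coact D h t) = (S m).coact D h (φ.app a t) :=
        (φ.nat_apply h t).symm
      change (φ.app (d i) ((S l).yo D (hdD i) (t.1 i h))).1 i (P.id _) = _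
      rw [h1, h2]
      exact ((S m).coact_apply h (hdD i) _ i (P.id _)).trans
        (congrArg ((φ.app a t).1 i) (P.id_comp h))
    have h0 := hom l m hlm F (fun i j f v => ?_) (fun a ha t ht i h => ?_)
    · refine Subtype.ext (funext fun j => funext fun h => ?_)
      have h1 := (φ.app (d p) ((S l).yo D (hdD p) (u l))).2.2.1 p j h (P.id _)
      rw [P.comp_id] at h1
      refine h1.trans ?_
      change (S m).act h (F p (u l)) = 0
      rw [h0, map_zero]
    · have h1 := key _ (hdD i) ((S l).yo D (hdD i) v) j f
      refine h1.trans ?_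
      have h2 := (φ.app (d i) ((S l).yo D (hdD i) v)).2.2.1 i j f (P.id _)
      rw [P.comp_id] at h2
      exact h2
    · have h1 := key a ha ⟨t, ht⟩ i h
      rw [h1]
      exact (φ.app a ⟨t, ht⟩).2.2.2 i h

end CoRep

namespace CoRep

variable {P : RayCategory} {I : RIdeal P} {J : Type} {d : J → P.Obj}

open Classical in
/-- a representation killed by an ideal, without further constraints on the coinduced module -/
noncomputable def ofKilled (V : J → Type) [∀ j, AddCommGroup (V j)] [∀ j, Module ℚ (V j)]
    [∀ j, FiniteDimensional ℚ (V j)] (act : ∀ i j, P.Hom (d i) (d j) → (V i →ₗ[ℚ] V j))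
    (act_id : ∀ i v, act i i (P.id (d i)) v = v)
    (act_comp : ∀ i j l (g : P.Hom (d j) (d l)) (f : P.Hom (d i) (d j)) (v : V i),
      act i l (g ⊚ f) v = act j l g (act i j f v))
    (killed : ∀ i j (f : P.Hom (d i) (d j)), I.mem _ _ f → act i j f = 0) : CoRep I d where
  V := V
  act {i j} := act i j
  act_id := act_id
  act_comp {i j l} := act_comp i j l
  A {a i} h := if I.mem a (d i) h then ⊥ else ⊤
  A_comp {a b i} h f := by
    split_ifs with h1 h2
    · exact bot_le
    · exact bot_le
    · exact absurd (I.comp_mem_right _ _ (by assumption)) h1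
    · exact le_top
  A_act {i j} f v := by
    split_ifs with h
    · rw [killed i j f h]; exact Submodule.zero_mem _
    · trivial
  A_mem {a i} h hI := if_pos hI

/-- Criterion for representation-infiniteness in terms of families of representations of a full
subcategory. -/
theorem not_repFin_of_act [Finite J] {D : Set P.Obj} (hD : D.Finite) (hdD : ∀ j, d j ∈ D)
    (V : J → Type) [∀ j, AddCommGroup (V j)] [∀ j, Module ℚ (V j)]
    [∀ j, FiniteDimensional ℚ (V j)] (act : ℚ → ∀ i j, P.Hom (d i) (d j) → (V i →ₗ[ℚ] V j))
    (act_id : ∀ c i v, act c i i (P.id (d i)) v = v)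
    (act_comp : ∀ c i j l (g : P.Hom (d j) (d l)) (f : P.Hom (d i) (d j)) (v : V i),
      act c i l (g ⊚ f) v = act c j l g (act c i j f v))
    (killed : ∀ c i j (f : P.Hom (d i) (d j)), I.mem _ _ f → act c i j f = 0)
    (p : J) (u : V p) (hu : u ≠ 0)
    (hom : ∀ l m, l ≠ m → ∀ F : ∀ i, V i →ₗ[ℚ] V i,
      (∀ i j (f : P.Hom (d i) (d j)) v, F j (act l i j f v) = act m i j f (F i v)) →
      F p u = 0) : ¬ RepFin P D I.mem :=
  not_repFin hD hdD (fun c => ofKilled V (act c) (act_id c) (act_comp c) (killed c)) p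
    (fun _ => u) (fun _ => hu) fun l m hlm F hF _ => hom l m hlm F hF

open Classical in
/-- Irreducible morphisms of a full subcategory forming a cycle of type `Ã` after separation of
sources and targets prevent representation-finiteness. -/
theorem not_repFin_of_cycle [Finite J] (hd : Function.Injective d) {D : Set P.Obj}
    (hD : D.Finite) (hdD : ∀ j, d j ∈ D)
    (hI : ∀ i j (f : P.Hom (d i) (d j)), I.mem _ _ f → ¬ P.IsIrreducibleOn (Set.range d) f)
    (hIid : ∀ i, ¬ I.mem _ _ (P.id (d i))) (s : Σ i j, P.Hom (d i) (d j))
    (hs : P.IsIrreducibleOn (Set.range d) s.2.2) (p : J)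
    (hp : ∃ (i : J) (f : P.Hom (d i) (d p)), P.IsIrreducibleOn (Set.range d) f ∧ ⟨i, p, f⟩ ≠ s)
    (eqs : ∀ a b : J → ℚ, (∀ i j (f : P.Hom (d i) (d j)), P.IsIrreducibleOn (Set.range d) f →
      ⟨i, j, f⟩ ≠ s → a i = b j) → a s.1 = b p ∧ b s.2.1 = b p) : ¬ RepFin P D I.mem := by
  let wt : ℚ → ∀ i j, P.Hom (d i) (d j) → ℚ := fun l i j f =>
    if P.IsIrreducibleOn (Set.range d) f then if ⟨i, j, f⟩ = s then l else 1 else 0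
  have hwt0 : ∀ l i j (f : P.Hom (d i) (d j)), ¬ P.IsIrreducibleOn (Set.range d) f →
      wt l i j f = 0 := fun l i j f h => if_neg h
  have hwt1 : ∀ l i j (f : P.Hom (d i) (d j)), P.IsIrreducibleOn (Set.range d) f →
      ⟨i, j, f⟩ ≠ s → wt l i j f = 1 := fun l i j f h h' => (if_pos h).trans (if_neg h')
  let N : ℚ → (ℚ × ℚ →ₗ[ℚ] ℚ × ℚ) := fun c =>
    LinearMap.prod 0 (c • LinearMap.fst ℚ ℚ ℚ)
  have hN : ∀ c v, N c v = (0, c * v.1) := fun _ _ => rfl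
  let act : ℚ → ∀ i j, P.Hom (d i) (d j) → (ℚ × ℚ →ₗ[ℚ] ℚ × ℚ) := fun l i j f =>
    if P.IsId f then LinearMap.id else N (wt l i j f)
  have hact1 : ∀ l i j (f : P.Hom (d i) (d j)), P.IsId f → act l i j f = LinearMap.id :=
    fun l i j f h => if_pos h
  have hact2 : ∀ l i j (f : P.Hom (d i) (d j)), ¬ P.IsId f → act l i j f = N (wt l i j f) :=
    fun l i j f h => if_neg h
  refine not_repFin_of_act hD hdD (fun _ => ℚ × ℚ) act (fun l i v => by rw [hact1 _ _ _ _ (isId_id _)]; rfl)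
    (fun l i j k g f v => by
      by_cases hg : P.IsId g
      · obtain rfl := hd hg.eq
        rw [hact1 _ _ _ _ hg, isId_self.1 hg, P.id_comp]; rfl
      by_cases hf : P.IsId f
      · obtain rfl := hd hf.eq
        rw [hact1 _ _ _ _ hf, isId_self.1 hf, P.comp_id]; rfl
      have h1 : ¬ P.IsId (g ⊚ f) := fun h => hg (isId_comp h).1
      rw [hact2 _ _ _ _ hg, hact2 _ _ _ _ hf, hact2 _ _ _ _ h1, hwt0, hN, hN, hN, zero_mul,
        mul_zero]
      intro h
      rcases h.2.2 _ ⟨j, rfl⟩ g f rfl with h | h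
      · exact hg h
      · exact hf h)
    (fun l i j f hf => by
      have h1 : ¬ P.IsId f := by
        intro h
        obtain rfl := hd h.eq
        rw [isId_self.1 h] at hf
        exact hIid _ hf
      rw [hact2 _ _ _ _ h1, hwt0 _ _ _ _ (hI _ _ _ hf)]
      refine LinearMap.ext fun v => ?_
      rw [hN, zero_mul]; rfl)
    p (0, 1) (fun h => one_ne_zero (congrArg Prod.snd h)) ?_
  intro l m hlm F hF
  have key : ∀ i j (f : P.Hom (d i) (d j)), P.IsIrreducibleOn (Set.range d) f →
      wt l i j f • F j (0, 1) = (0, wt m i j f * (F i (1, 0)).1) := by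
    intro i j f hf
    have h := hF i j f (1, 0)
    rw [hact2 _ _ _ _ hf.2.1, hact2 _ _ _ _ hf.2.1, hN, hN] at h
    rw [← h, ← map_smul]
    rw [Prod.smul_mk, smul_zero, smul_eq_mul]
  obtain ⟨e1, e2⟩ := eqs (fun i => (F i (1, 0)).1) (fun i => (F i (0, 1)).2) (by
    intro i j f hf hfs
    have h := congrArg Prod.snd (key i j f hf)
    simp only [hwt1 _ _ _ _ hf hfs, one_smul, one_mul] at h
    exact h.symm)
  have e3 := congrArg Prod.snd (key _ _ _ hs)
  have hs' : ∀ l, wt l _ _ s.2.2 = l := fun l => (if_pos hs).trans (if_pos rfl)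
  simp only [hs', Prod.smul_snd, smul_eq_mul] at e3
  rw [e1, e2, ← sub_eq_zero, ← sub_mul] at e3
  have e4 := (mul_eq_zero.1 e3).resolve_left (sub_ne_zero.2 hlm)
  obtain ⟨i, f, hf, hfs⟩ := hp
  have e5 := congrArg Prod.fst (key i p f hf)
  simp only [hwt1 _ _ _ _ hf hfs, one_smul] at e5
  exact Prod.ext e5 e4

/-- Criterion for representation-infiniteness in terms of a nilpotent endomorphism and
subspaces of a vector space. -/
theorem not_repFin_of_subspaces {y : P.Obj} {D : Set P.Obj} (hD : D.Finite) (hy : y ∈ D)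
    {n : ℕ} (Y : Module.End ℚ (Fin n → ℚ)) (hY : Y ^ P.nilp y = 0)
    (A : ℚ → ∀ a, P.Hom a y → Submodule ℚ (Fin n → ℚ))
    (A_comp : ∀ l a b (h : P.Hom b y) (f : P.Hom a b), A l a (h ⊚ f) ≤ A l b h)
    (A_act : ∀ l i v, (Y ^ i) v ∈ A l y (P.pipow y i))
    (A_mem : ∀ l a (h : P.Hom a y), I.mem a y h → A l a h = ⊥)
    (u : Fin n → ℚ) (hu : u ≠ 0)
    (hom : ∀ l m, l ≠ m → ∀ F : Module.End ℚ (Fin n → ℚ), (∀ v, F (Y v) = Y (F v)) →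
      (∀ a ∈ D, ∀ t : P.Hom a y → Fin n → ℚ, (∀ h, t (P.pipow y 1 ⊚ h) = Y (t h)) →
        (∀ h, t h ∈ A l a h) → ∀ h, F (t h) ∈ A m a h) → F u = 0) :
    ¬ RepFin P D I.mem := by
  let act : P.Hom y y → Module.End ℚ (Fin n → ℚ) := fun f => Y ^ (P.endo_cyclic y f).choose
  have hact : ∀ i, act (P.pipow y i) = Y ^ i := by
    intro i
    have h1 := (P.endo_cyclic y (P.pipow y i)).choose_spec
    change Y ^ (P.endo_cyclic y (P.pipow y i)).choose = _
    generalize (P.endo_cyclic y (P.pipow y i)).choose = j at h1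
    by_cases h0 : P.pipow y i = P.zero y y
    · have hz : ∀ k, P.pipow y k = P.zero y y → Y ^ k = 0 := by
        intro k hk
        rw [pipow_eq_zero_iff] at hk
        obtain ⟨c, rfl⟩ := Nat.exists_eq_add_of_le hk
        rw [pow_add, hY, zero_mul]
      rw [hz i h0, hz j (h1 ▸ h0)]
    · rw [pipow_inj h1 h0]
  let S : ℚ → CoRep I (fun _ : Unit => y) := fun l =>
    { V := fun _ => Fin n → ℚ
      act := fun f => act f
      act_id := fun _ v => by
        change act (P.id y) v = v
        rw [← P.pipow_zero, hact, pow_zero]; rfl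
      act_comp := fun g f v => by
        change act (g ⊚ f) v = act g (act f v)
        obtain ⟨i, rfl⟩ := P.endo_cyclic y g
        obtain ⟨j, rfl⟩ := P.endo_cyclic y f
        rw [← pipow_add, hact, hact, hact, pow_add]; rfl
      A := fun {a _} h => A l a h
      A_comp := fun h f => A_comp l _ _ h f
      A_act := fun f v => by
        change act f v ∈ A l y f
        obtain ⟨i, rfl⟩ := P.endo_cyclic y f
        rw [hact]; exact A_act l i v
      A_mem := fun h hI => A_mem l _ h hI }
  refine not_repFin hD (fun _ => hy) S () (fun _ => u) (fun _ => hu) ?_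
  intro l m hlm F hF hF'
  have hF1 : ∀ f v, F () (act f v) = act f (F () v) := fun f v => hF () () f v
  refine hom l m hlm (F ()) (fun v => ?_) fun a ha t ht htA h => ?_
  · have := hF1 (P.pipow y 1) v
    rwa [hact, pow_one] at this
  · refine hF' a ha (fun _ => t) ⟨fun h => absurd ha h, fun _ _ g h => ?_, fun _ h => htA h⟩ () h
    change t (g ⊚ h) = act g (t h)
    obtain ⟨i, rfl⟩ := P.endo_cyclic y g
    rw [hact]
    induction i with
    | zero => rw [P.pipow_zero, P.id_comp, pow_zero]; rfl
    | succ i ih => rw [P.pipow_succ, P.assoc, ht, ih, pow_succ']; rfl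

end CoRep

/-- a sequence of morphisms whose nonzero members are pairwise different -/
def IsWordSeq {P : RayCategory} {a b : P.Obj} (w : ℕ → P.Hom a b) : Prop :=
  ∀ i j, w i = w j → w i ≠ P.zero a b → i = j

section Words

variable {P : RayCategory} {a b c : P.Obj} {V W : Type} [AddCommGroup V] [Module ℚ V]
  [AddCommGroup W] [Module ℚ W]

theorem isWordSeq_pipow (a : P.Obj) : IsWordSeq (P.pipow a) := fun _ _ h h0 => pipow_inj h h0

theorem isWordSeq_comp_pipow (f : P.Hom a b) : IsWordSeq fun i => f ⊚ P.pipow a i :=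
  fun _ _ h h0 => comp_pipow_inj h h0

theorem isWordSeq_pipow_comp (f : P.Hom a b) : IsWordSeq fun i => P.pipow b i ⊚ f :=
  fun _ _ h h0 => pipow_comp_inj h h0

open Classical in
/-- the linear maps `A i` as an action of the morphisms `w i` -/
noncomputable def wordAct (w : ℕ → P.Hom a b) (A : ℕ → (V →ₗ[ℚ] W)) (f : P.Hom a b) :
    V →ₗ[ℚ] W := if h : ∃ i, f = w i then A h.choose else 0

variable {I : RIdeal P} {w : ℕ → P.Hom a b} {A : ℕ → (V →ₗ[ℚ] W)}

theorem wordAct_apply (hw : IsWordSeq w) (hA : ∀ i, I.mem a b (w i) → A i = 0) (i : ℕ) :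
    wordAct w A (w i) = A i := by
  have h : ∃ j, w i = w j := ⟨i, rfl⟩
  rw [wordAct, dif_pos h]
  have h1 := h.choose_spec
  generalize h.choose = j at h1
  by_cases h0 : w i = P.zero a b
  · rw [hA i (h0 ▸ I.zero_mem a b), hA j (h1 ▸ h0 ▸ I.zero_mem a b)]
  · rw [hw i j h1 h0]

theorem wordAct_killed (hA : ∀ i, I.mem a b (w i) → A i = 0) {f : P.Hom a b}
    (hf : I.mem a b f) : wordAct w A f = 0 := by
  rw [wordAct]
  split_ifs with h
  · exact hA _ (h.choose_spec ▸ hf)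
  · rfl

end Words

namespace RayCategory

variable {P : RayCategory} {b y : P.Obj}

theorem pipow_comp_comp_pipow {f : P.Hom b y} {m : ℕ}
    (h : P.pipow y 1 ⊚ f = f ⊚ P.pipow b m) (i : ℕ) :
    P.pipow y i ⊚ f = f ⊚ P.pipow b (m * i) := by
  induction i with
  | zero => rw [Nat.mul_zero, P.pipow_zero, P.pipow_zero, P.id_comp, P.comp_id]
  | succ i ih =>
    rw [P.pipow_succ, P.assoc, ih, ← P.assoc, h, P.assoc, ← pipow_add, Nat.mul_succ, Nat.add_comm]

end RayCategory

/-- the two points `b` and `y` -/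
def twoPoints {P : RayCategory} (b y : P.Obj) : Bool → P.Obj
  | false => b
  | true => y

namespace CoRep

variable {P : RayCategory} {I : RIdeal P} {b y : P.Obj}

/-- Criterion for representation-infiniteness in terms of modules over two points with
morphisms in only one direction. -/
theorem not_repFin_of_twoPoints {D : Set P.Obj} (hD : D.Finite)
    (hb : b ∈ D) (hy : y ∈ D) {f : P.Hom b y} {m : ℕ}
    (hgen : ∀ h : P.Hom b y, ∃ i, h = f ⊚ P.pipow b i)
    (hrel : P.pipow y 1 ⊚ f = f ⊚ P.pipow b m) (h0 : ∀ h : P.Hom y b, h = P.zero y b)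
    {n k : ℕ} (X : ℚ → Module.End ℚ (Fin n → ℚ)) (Y : ℚ → Module.End ℚ (Fin k → ℚ))
    (B : ℚ → ((Fin n → ℚ) →ₗ[ℚ] (Fin k → ℚ)))
    (hBX : ∀ c v, B c ((X c ^ m) v) = Y c (B c v))
    (kX : ∀ c i, I.mem _ _ (P.pipow b i) → X c ^ i = 0)
    (kY : ∀ c i, I.mem _ _ (P.pipow y i) → Y c ^ i = 0)
    (kB : ∀ c i, I.mem _ _ (f ⊚ P.pipow b i) → B c ∘ₗ X c ^ i = 0)
    (u : Fin n → ℚ) (hu : u ≠ 0)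
    (hom : ∀ l m, l ≠ m → ∀ (F : Module.End ℚ (Fin n → ℚ)) (G : Module.End ℚ (Fin k → ℚ)),
      (∀ v, F (X l v) = X m (F v)) → (∀ v, G (Y l v) = Y m (G v)) →
      (∀ v, G (B l v) = B m (F v)) → F u = 0) : ¬ RepFin P D I.mem := by
  let V : Bool → Type := fun j => Fin (bif j then k else n) → ℚ
  have aX := fun c => wordAct_apply (isWordSeq_pipow b) (kX c)
  have aY := fun c => wordAct_apply (isWordSeq_pipow y) (kY c)
  have aB := fun c => wordAct_apply (isWordSeq_comp_pipow f) (kB c)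
  let act : ℚ → ∀ i j, P.Hom (twoPoints b y i) (twoPoints b y j) → (V i →ₗ[ℚ] V j) :=
    fun c i j => match i, j with
      | false, false => wordAct (P.pipow b) (fun i => X c ^ i)
      | false, true => wordAct (fun i => f ⊚ P.pipow b i) (fun i => B c ∘ₗ X c ^ i)
      | true, false => 0
      | true, true => wordAct (P.pipow y) (fun i => Y c ^ i)
  have killed : ∀ c i j h, I.mem _ _ h → act c i j h = 0 := by
    intro c i j h hI
    match i, j with
    | false, false => exact wordAct_killed (kX c) hI
    | false, true => exact wordAct_killed (kB c) hI
    | true, false => rfl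
    | true, true => exact wordAct_killed (kY c) hI
  have hBXi : ∀ c i v, B c ((X c ^ (m * i)) v) = (Y c ^ i) (B c v) := by
    intro c i v
    induction i with
    | zero => rfl
    | succ i ih =>
      rw [Nat.mul_succ, Nat.add_comm, pow_add, Module.End.mul_apply, hBX, ih, pow_succ',
        Module.End.mul_apply]
  refine not_repFin_of_act (d := twoPoints b y) hD (fun j => by cases j <;> assumption) V act
    ?_ ?_ killed false u hu ?_
  · intro c i v
    match i with
    | false =>
      change wordAct (P.pipow b) (fun i => X c ^ i) (P.id b) v = v
      rw [← P.pipow_zero, aX]; rfl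
    | true =>
      change wordAct (P.pipow y) (fun i => Y c ^ i) (P.id y) v = v
      rw [← P.pipow_zero, aY]; rfl
  · intro c i j l g h v
    match i, j, l with
    | false, true, false =>
      have hg : I.mem _ _ g := (show g = P.zero y b from h0 g) ▸ I.zero_mem _ _
      rw [killed c _ _ _ (I.comp_mem_right g h hg), killed c _ _ _ hg]
      rfl
    | true, true, false =>
      have hg : I.mem _ _ g := (show g = P.zero y b from h0 g) ▸ I.zero_mem _ _
      rw [killed c _ _ _ (I.comp_mem_right g h hg), killed c _ _ _ hg]
      rfl
    | true, false, _ =>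
      have hh : I.mem _ _ h := (show h = P.zero y b from h0 h) ▸ I.zero_mem _ _
      rw [killed c _ _ _ (I.comp_mem_left g h hh), killed c _ _ _ hh]
      exact (map_zero _).symm
    | false, false, false =>
      obtain ⟨i, rfl⟩ : ∃ i, g = P.pipow b i := P.endo_cyclic b g
      obtain ⟨j, rfl⟩ : ∃ j, h = P.pipow b j := P.endo_cyclic b h
      change wordAct (P.pipow b) (fun i => X c ^ i) (P.pipow b i ⊚ P.pipow b j) v =
        wordAct (P.pipow b) (fun i => X c ^ i) (P.pipow b i)
          (wordAct (P.pipow b) (fun i => X c ^ i) (P.pipow b j) v)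
      rw [← pipow_add, aX, aX, aX, pow_add]; rfl
    | true, true, true =>
      obtain ⟨i, rfl⟩ : ∃ i, g = P.pipow y i := P.endo_cyclic y g
      obtain ⟨j, rfl⟩ : ∃ j, h = P.pipow y j := P.endo_cyclic y h
      change wordAct (P.pipow y) (fun i => Y c ^ i) (P.pipow y i ⊚ P.pipow y j) v =
        wordAct (P.pipow y) (fun i => Y c ^ i) (P.pipow y i)
          (wordAct (P.pipow y) (fun i => Y c ^ i) (P.pipow y j) v)
      rw [← pipow_add, aY, aY, aY, pow_add]; rfl
    | false, false, true =>
      obtain ⟨i, rfl⟩ : ∃ i, g = f ⊚ P.pipow b i := hgen g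
      obtain ⟨j, rfl⟩ : ∃ j, h = P.pipow b j := P.endo_cyclic b h
      change wordAct (fun i => f ⊚ P.pipow b i) (fun i => B c ∘ₗ X c ^ i)
          ((f ⊚ P.pipow b i) ⊚ P.pipow b j) v =
        wordAct (fun i => f ⊚ P.pipow b i) (fun i => B c ∘ₗ X c ^ i) (f ⊚ P.pipow b i)
          (wordAct (P.pipow b) (fun i => X c ^ i) (P.pipow b j) v)
      rw [P.assoc, ← pipow_add, aB, aB, aX, pow_add]; rfl
    | false, true, true =>
      obtain ⟨i, rfl⟩ : ∃ i, g = P.pipow y i := P.endo_cyclic y g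
      obtain ⟨j, rfl⟩ : ∃ j, h = f ⊚ P.pipow b j := hgen h
      change wordAct (fun i => f ⊚ P.pipow b i) (fun i => B c ∘ₗ X c ^ i)
          (P.pipow y i ⊚ f ⊚ P.pipow b j) v =
        wordAct (P.pipow y) (fun i => Y c ^ i) (P.pipow y i)
          (wordAct (fun i => f ⊚ P.pipow b i) (fun i => B c ∘ₗ X c ^ i) (f ⊚ P.pipow b j) v)
      rw [← P.assoc, pipow_comp_comp_pipow hrel, P.assoc, ← pipow_add, aB, aB, aY, pow_add]
      exact hBXi c i _
  · intro l m' hlm F hF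
    refine hom l m' hlm (F false) (F true) (fun v => ?_) (fun v => ?_) (fun v => ?_)
    · have h : F false (wordAct (P.pipow b) (fun i => X l ^ i) (P.pipow b 1) v) =
        wordAct (P.pipow b) (fun i => X m' ^ i) (P.pipow b 1) (F false v) :=
        hF false false (P.pipow b 1) v
      rwa [aX, aX, pow_one, pow_one] at h
    · have h : F true (wordAct (P.pipow y) (fun i => Y l ^ i) (P.pipow y 1) v) =
        wordAct (P.pipow y) (fun i => Y m' ^ i) (P.pipow y 1) (F true v) :=
        hF true true (P.pipow y 1) v
      rwa [aY, aY, pow_one, pow_one] at h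
    · have h : F true (wordAct (fun i => f ⊚ P.pipow b i) (fun i => B l ∘ₗ X l ^ i)
          (f ⊚ P.pipow b 0) v) = wordAct (fun i => f ⊚ P.pipow b i) (fun i => B m' ∘ₗ X m' ^ i)
          (f ⊚ P.pipow b 0) (F false v) :=
        hF false true (f ⊚ P.pipow b 0) v
      rw [aB, aB] at h
      exact h

end CoRep

namespace CoRep

variable {P : RayCategory} {I : RIdeal P} {x y : P.Obj}

/-- the coordinate functions -/
abbrev co {n : ℕ} (i : Fin n) : (Fin n → ℚ) →ₗ[ℚ] ℚ := LinearMap.proj i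

/-- the unit vectors -/
abbrev un {n : ℕ} (i : Fin n) : Fin n → ℚ := Pi.single i 1

theorem comp_pow_eq_zero {n k : ℕ} {B : (Fin n → ℚ) →ₗ[ℚ] (Fin k → ℚ)}
    {X : Module.End ℚ (Fin n → ℚ)} {i j : ℕ} (h : B ∘ₗ X ^ i = 0) (hij : i ≤ j) :
    B ∘ₗ X ^ j = 0 := by
  obtain ⟨l, rfl⟩ := Nat.exists_eq_add_of_le hij
  rw [pow_add, Module.End.mul_eq_comp, ← LinearMap.comp_assoc, h, LinearMap.zero_comp]

theorem not_repFin_four_four {D : Set P.Obj} (hD : D.Finite) (hx : x ∈ D) (hy : y ∈ D)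
    {f : P.Hom x y} (hgen : ∀ h : P.Hom x y, ∃ i, h = f ⊚ P.pipow x i)
    (h0 : ∀ h : P.Hom y x, h = P.zero y x) (hrel : P.pipow y 1 ⊚ f = f ⊚ P.pipow x 1)
    (hX : ∀ i, I.mem _ _ (P.pipow x i) → 4 ≤ i) (hY : ∀ i, I.mem _ _ (P.pipow y i) → 4 ≤ i)
    (hB : ∀ i, I.mem _ _ (f ⊚ P.pipow x i) → 2 ≤ i) : ¬ RepFin P D I.mem := by
  let X : Module.End ℚ (Fin 8 → ℚ) :=
    .pi ![0, 0, co 0, co 1, 0, co 2 + co 4, co 3, co 5]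
  let Y : ℚ → Module.End ℚ (Fin 8 → ℚ) := fun c =>
    .pi ![0, co 0, 0, co 1 + co 2, c • co 1 + co 2, co 1, co 3, co 4]
  let B : (Fin 8 → ℚ) →ₗ[ℚ] (Fin 8 → ℚ) := .pi ![0, 0, 0, co 0, co 1, 0, co 2, co 3]
  have X4 : X ^ 4 = 0 := by
    ext i j
    fin_cases j <;> simp [X, pow_succ]
  have Y4 : ∀ c, Y c ^ 4 = 0 := by
    intro c
    ext i j
    fin_cases j <;> simp [Y, pow_succ]
  have BX : B ∘ₗ X ^ 2 = 0 := by
    ext i j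
    fin_cases j <;> simp [X, B, pow_succ]
  refine not_repFin_of_twoPoints hD hx hy hgen hrel h0 (fun _ => X) Y (fun _ => B) ?_
    (fun c i hi => pow_eq_zero_of_le (hX i hi) X4)
    (fun c i hi => pow_eq_zero_of_le (hY i hi) (Y4 c))
    (fun c i hi => comp_pow_eq_zero BX (hB i hi)) (X (X (X (un 0))))
    (fun h => ?_) ?_
  · intro c v
    ext i
    fin_cases i <;> simp [X, Y, B]
  · simpa [X] using congrFun h 7
  · intro l m hlm F G hX hY hB
    have r1 : X (X (F (un 0))) = X (F (un 4)) := by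
      rw [← hX, ← hX, ← hX]
      refine congrArg _ (funext fun i => ?_)
      fin_cases i <;> simp [X]
    have r2 : X (X (X (F (un 1)))) = 0 := by
      rw [← hX, ← hX, ← hX, ← map_zero F]
      refine congrArg _ (funext fun i => ?_)
      fin_cases i <;> simp [X]
    have r3 : B (F (un 4)) = 0 := by
      rw [← hB, ← map_zero G]
      refine congrArg _ (funext fun i => ?_)
      fin_cases i <;> simp [B]
    have r4 : Y m (G (un 2)) = B (F (un 0) + F (un 1)) := by
      rw [← hY, ← map_add, ← hB]
      refine congrArg _ (funext fun i => ?_)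
      fin_cases i <;> simp [Y, B]
    have r5 : Y m (Y m (Y m (G (un 0)))) = Y m (B (F (un 0) + l • F (un 1))) := by
      rw [← hY, ← hY, ← hY, ← map_smul, ← map_add, ← hB, ← hY]
      refine congrArg _ (funext fun i => ?_)
      fin_cases i <;> simp [Y, B]
    have ha : F (un 0) 0 = 0 := by
      have e1 : F (un 0) 1 = F (un 4) 3 := congrFun r1 6
      have e2 : F (un 1) 0 = 0 := by simpa [X] using congrFun r2 7
      have e3 : F (un 4) 3 = 0 := congrFun r3 7
      have e4 : G (un 2) 1 + G (un 2) 2 = F (un 0) 0 + F (un 1) 0 := congrFun r4 3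
      have e5 : m * G (un 2) 1 + G (un 2) 2 = F (un 0) 1 + F (un 1) 1 := congrFun r4 4
      have e6 : G (un 2) 1 = 0 := congrFun r4 5
      have e7 : G (un 0) 0 = F (un 0) 0 + l * F (un 1) 0 := by simpa [Y, B] using congrFun r5 6
      have e8 : m * G (un 0) 0 = F (un 0) 1 + l * F (un 1) 1 := by simpa [Y, B] using congrFun r5 7
      grind
    rw [hX, hX, hX]
    ext i
    fin_cases i <;> simp [X, ha]

theorem not_repFin_six_three {D : Set P.Obj} (hD : D.Finite) (hx : x ∈ D) (hy : y ∈ D)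
    {f : P.Hom x y} (hgen : ∀ h : P.Hom x y, ∃ i, h = f ⊚ P.pipow x i)
    (h0 : ∀ h : P.Hom y x, h = P.zero y x) (hrel : P.pipow y 1 ⊚ f = f ⊚ P.pipow x 1)
    (hX : ∀ i, I.mem _ _ (P.pipow x i) → 6 ≤ i) (hY : ∀ i, I.mem _ _ (P.pipow y i) → 3 ≤ i)
    (hB : ∀ i, I.mem _ _ (f ⊚ P.pipow x i) → 2 ≤ i) : ¬ RepFin P D I.mem := by
  let X : Module.End ℚ (Fin 18 → ℚ) :=
    .pi ![0, 0, 0, co 0, co 1, co 2, 0, 0, co 3 + co 6, co 4, co 5, co 7, co 8, co 9 + co 11,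
      co 10, co 12, co 13, co 15]
  let Y : ℚ → Module.End ℚ (Fin 9 → ℚ) := fun c =>
    .pi ![0, 0, co 0 + co 1, co 0 + c • co 1, co 0, co 1, co 2, co 3, co 4]
  let B : (Fin 18 → ℚ) →ₗ[ℚ] (Fin 9 → ℚ) := .pi ![0, 0, co 0, co 1, co 2, 0, co 3, co 4, co 5]
  have X6 : X ^ 6 = 0 := by
    ext i j
    fin_cases j <;> simp [X, pow_succ]
  have Y3 : ∀ c, Y c ^ 3 = 0 := by
    intro c
    ext i j
    fin_cases j <;> simp [Y, pow_succ]
  have BX : B ∘ₗ X ^ 2 = 0 := by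
    ext i j
    fin_cases j <;> simp [X, B, pow_succ]
  refine not_repFin_of_twoPoints hD hx hy hgen hrel h0 (fun _ => X) Y (fun _ => B) ?_
    (fun c i hi => pow_eq_zero_of_le (hX i hi) X6)
    (fun c i hi => pow_eq_zero_of_le (hY i hi) (Y3 c))
    (fun c i hi => comp_pow_eq_zero BX (hB i hi)) (X (X (X (X (X (un 0))))))
    (fun h => ?_) ?_
  · intro c v
    ext i
    fin_cases i <;> simp [X, Y, B]
  · simpa [X] using congrFun h 17
  · intro l m hlm F G hX hY hB
    have r1 : X (X (F (un 0))) = X (F (un 6)) := by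
      rw [← hX, ← hX, ← hX]
      refine congrArg _ (funext fun i => ?_)
      fin_cases i <;> simp [X]
    have r2 : X (X (X (F (un 1)))) = X (X (F (un 7))) := by
      rw [← hX, ← hX, ← hX, ← hX, ← hX]
      refine congrArg _ (funext fun i => ?_)
      fin_cases i <;> simp [X]
    have r3 : B (F (un 6)) = 0 := by
      rw [← hB, ← map_zero G]
      refine congrArg _ (funext fun i => ?_)
      fin_cases i <;> simp [B]
    have r4 : B (F (un 7)) = 0 := by
      rw [← hB, ← map_zero G]
      refine congrArg _ (funext fun i => ?_)
      fin_cases i <;> simp [B]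
    have r5 : X (X (X (X (X (F (un 1)))))) = 0 := by
      rw [← hX, ← hX, ← hX, ← hX, ← hX, ← map_zero F]
      refine congrArg _ (funext fun i => ?_)
      fin_cases i <;> simp [X]
    have r6 : X (X (X (X (F (un 2))))) = 0 := by
      rw [← hX, ← hX, ← hX, ← hX, ← map_zero F]
      refine congrArg _ (funext fun i => ?_)
      fin_cases i <;> simp [X]
    have r7 : Y m (G (un 0)) = B (F (un 0) + F (un 1) + F (un 2)) := by
      rw [← hY, ← map_add, ← map_add, ← hB]
      refine congrArg _ (funext fun i => ?_)
      fin_cases i <;> simp [Y, B]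
    have r8 : Y m (Y m (G (un 1))) = Y m (B (F (un 0) + l • F (un 1))) := by
      rw [← hY, ← hY, ← map_smul, ← map_add, ← hB, ← hY]
      refine congrArg _ (funext fun i => ?_)
      fin_cases i <;> simp [Y, B]
    have ha : F (un 0) 0 = 0 := by
      have a1 : F (un 0) 1 = F (un 6) 4 := congrFun r1 9
      have a2 : F (un 0) 2 = F (un 6) 5 := congrFun r1 10
      have n1 : F (un 6) 4 = 0 := congrFun r3 7
      have n2 : F (un 6) 5 = 0 := congrFun r3 8
      have b2 : F (un 1) 2 = F (un 7) 5 := by simpa [X] using congrFun r2 14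
      have n3 : F (un 7) 5 = 0 := congrFun r4 8
      have b0 : F (un 1) 0 = 0 := by simpa [X] using congrFun r5 17
      have c0 : F (un 2) 0 = 0 := by simpa [X] using congrFun r6 15
      have c1 : F (un 2) 1 = 0 := by simpa [X] using congrFun r6 16
      have p0 : G (un 0) 0 + G (un 0) 1 = F (un 0) 0 + F (un 1) 0 + F (un 2) 0 := congrFun r7 2
      have p1 : G (un 0) 0 + m * G (un 0) 1 = F (un 0) 1 + F (un 1) 1 + F (un 2) 1 :=
        congrFun r7 3
      have p2 : G (un 0) 1 = 0 := congrFun r7 5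
      have q0 : G (un 1) 0 + G (un 1) 1 = F (un 0) 0 + l * F (un 1) 0 := by
        simpa [Y, B] using congrFun r8 6
      have q1 : G (un 1) 0 + m * G (un 1) 1 = F (un 0) 1 + l * F (un 1) 1 := by
        simpa [Y, B] using congrFun r8 7
      have q2 : G (un 1) 0 = F (un 0) 2 + l * F (un 1) 2 := by
        simpa [Y, B] using congrFun r8 8
      grind
    rw [hX, hX, hX, hX, hX]
    ext i
    fin_cases i <;> simp [X, ha]

set_option maxHeartbeats 1000000 in
theorem not_repFin_three_six {D : Set P.Obj} (hD : D.Finite) (hx : x ∈ D) (hy : y ∈ D)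
    {f : P.Hom x y} (hgen : ∀ h : P.Hom x y, ∃ i, h = f ⊚ P.pipow x i)
    (h0 : ∀ h : P.Hom y x, h = P.zero y x) (hrel : P.pipow y 1 ⊚ f = f ⊚ P.pipow x 1)
    (hX : ∀ i, I.mem _ _ (P.pipow x i) → 3 ≤ i) (hY : ∀ i, I.mem _ _ (P.pipow y i) → 6 ≤ i)
    (hB : ∀ i, I.mem _ _ (f ⊚ P.pipow x i) → 2 ≤ i) : ¬ RepFin P D I.mem := by
  let X : Module.End ℚ (Fin 9 → ℚ) :=
    .pi ![0, 0, 0, co 0, co 1, co 2, 0, co 3, co 4 + co 6]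
  let Y : ℚ → Module.End ℚ (Fin 18 → ℚ) := fun c =>
    .pi ![0, co 0, 0, co 1, co 2, 0, co 3, co 4, co 5, 0,
      co 6 + co 7 + co 8, co 6 + c • co 7 + co 9, co 6, co 6, co 7, co 10, co 11, co 12]
  let B : (Fin 9 → ℚ) →ₗ[ℚ] (Fin 18 → ℚ) :=
    .pi ![0, 0, 0, 0, 0, 0, 0, 0, 0, 0, co 0, co 1, co 2, 0, 0, co 3, co 4, co 5]
  have X3 : X ^ 3 = 0 := by
    ext i j
    fin_cases j <;> simp [X, pow_succ]
  have Y6 : ∀ c, Y c ^ 6 = 0 := by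
    intro c
    ext i j
    fin_cases j <;> simp [Y, pow_succ]
  have BX : B ∘ₗ X ^ 2 = 0 := by
    ext i j
    fin_cases j <;> simp [X, B, pow_succ]
  refine not_repFin_of_twoPoints hD hx hy hgen hrel h0 (fun _ => X) Y (fun _ => B) ?_
    (fun c i hi => pow_eq_zero_of_le (hX i hi) X3)
    (fun c i hi => pow_eq_zero_of_le (hY i hi) (Y6 c))
    (fun c i hi => comp_pow_eq_zero BX (hB i hi)) (X (X (un 0))) (fun h => ?_) ?_
  · intro c v
    ext i
    fin_cases i <;> simp [X, Y, B]
  · simpa [X] using congrFun h 7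
  · intro l m hlm F G hX hY hB
    have r1 : X (X (F (un 1))) = X (F (un 6)) := by
      rw [← hX, ← hX, ← hX]
      refine congrArg _ (funext fun i => ?_)
      fin_cases i <;> simp [X]
    have r2 : B (F (un 6)) = 0 := by
      rw [← hB, ← map_zero G]
      refine congrArg _ (funext fun i => ?_)
      fin_cases i <;> simp [B]
    have r3 : X (X (F (un 2))) = 0 := by
      rw [← hX, ← hX, ← map_zero F]
      refine congrArg _ (funext fun i => ?_)
      fin_cases i <;> simp [X]
    have r4 : Y m (G (un 9)) = B (F (un 1)) := by
      rw [← hY, ← hB]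
      refine congrArg _ (funext fun i => ?_)
      fin_cases i <;> simp [Y, B]
    have r5 : Y m (Y m (G (un 5))) = B (F (un 0)) := by
      rw [← hY, ← hY, ← hB]
      refine congrArg _ (funext fun i => ?_)
      fin_cases i <;> simp [Y, B]
    have r6 : Y m (Y m (Y m (Y m (G (un 2))))) = Y m (B (F (un 0) + l • F (un 1))) := by
      rw [← hY, ← hY, ← hY, ← hY, ← map_smul, ← map_add, ← hB, ← hY]
      refine congrArg _ (funext fun i => ?_)
      fin_cases i <;> simp [Y, B]
    have r7 : Y m (Y m (Y m (Y m (Y m (G (un 0)))))) =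
        Y m (B (F (un 0) + F (un 1) + F (un 2))) := by
      rw [← hY, ← hY, ← hY, ← hY, ← hY, ← map_add, ← map_add, ← hB, ← hY]
      refine congrArg _ (funext fun i => ?_)
      fin_cases i <;> simp [Y, B]
    have ha : F (un 0) 0 = 0 ∧ F (un 0) 1 = 0 := by
      have b0 : F (un 1) 0 = F (un 6) 3 := by simpa [X] using congrFun r1 7
      have n0 : F (un 6) 3 = 0 := congrFun r2 15
      have c0 : F (un 2) 0 = 0 := by simpa [X] using congrFun r3 7
      have c1 : F (un 2) 1 = 0 := by simpa [X] using congrFun r3 8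
      have b2 : G (un 9) 6 = F (un 1) 2 := congrFun r4 12
      have t6 : G (un 9) 6 = 0 := congrFun r4 13
      have a1 : G (un 5) 3 + m * G (un 5) 4 = F (un 0) 1 := by simpa [Y, B] using congrFun r5 11
      have a2 : G (un 5) 3 = F (un 0) 2 := by simpa [Y, B] using congrFun r5 12
      have s3 : G (un 5) 3 = 0 := by simpa [Y, B] using congrFun r5 13
      have s4 : G (un 5) 4 = 0 := by simpa [Y, B] using congrFun r5 14
      have q0 : G (un 2) 1 + G (un 2) 2 = F (un 0) 0 + l * F (un 1) 0 := by
        simpa [Y, B] using congrFun r6 15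
      have q1 : G (un 2) 1 + m * G (un 2) 2 = F (un 0) 1 + l * F (un 1) 1 := by
        simpa [Y, B] using congrFun r6 16
      have q2 : G (un 2) 1 = F (un 0) 2 + l * F (un 1) 2 := by
        simpa [Y, B] using congrFun r6 17
      have p0 : G (un 0) 0 = F (un 0) 0 + F (un 1) 0 + F (un 2) 0 := by
        simpa [Y, B] using congrFun r7 15
      have p1 : G (un 0) 0 = F (un 0) 1 + F (un 1) 1 + F (un 2) 1 := by
        simpa [Y, B] using congrFun r7 16
      grind
    rw [hX, hX]
    ext i
    fin_cases i <;> simp [X, ha]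

theorem not_repFin_of_two_le {D : Set P.Obj} (hD : D.Finite) (hx : x ∈ D) (hy : y ∈ D)
    {f : P.Hom x y} (hgen : ∀ h : P.Hom x y, ∃ i, h = f ⊚ P.pipow x i)
    (h0 : ∀ h : P.Hom y x, h = P.zero y x) {n : ℕ} (hn : 2 ≤ n)
    (hrel : P.pipow y 1 ⊚ f = f ⊚ P.pipow x n)
    (hX : ∀ i, I.mem _ _ (P.pipow x i) → 4 ≤ i) (hY : ∀ i, I.mem _ _ (P.pipow y i) → 2 ≤ i)
    (hB : ∀ i, I.mem _ _ (f ⊚ P.pipow x i) → 3 ≤ i) : ¬ RepFin P D I.mem := by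
  let d : ℚ := if n = 2 then 1 else 0
  let X : Module.End ℚ (Fin 6 → ℚ) := .pi ![0, co 0, 0, co 1, co 2, co 3]
  let Y : ℚ → Module.End ℚ (Fin 3 → ℚ) := fun c => .pi ![0, 0, (d * c) • co 0]
  let B : ℚ → ((Fin 6 → ℚ) →ₗ[ℚ] (Fin 3 → ℚ)) := fun c =>
    .pi ![co 0, co 1 + co 2, c • co 3 + co 4]
  have X4 : X ^ 4 = 0 := by
    ext i j
    fin_cases j <;> simp [X, pow_succ]
  have Y2 : ∀ c, Y c ^ 2 = 0 := by
    intro c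
    ext i j
    fin_cases j <;> simp [Y, pow_succ]
  have BX : ∀ c, B c ∘ₗ X ^ 3 = 0 := by
    intro c
    ext i j
    fin_cases j <;> simp [X, B, pow_succ]
  refine not_repFin_of_twoPoints hD hx hy hgen hrel h0 (fun _ => X) Y B ?_
    (fun c i hi => pow_eq_zero_of_le (hX i hi) X4)
    (fun c i hi => pow_eq_zero_of_le (hY i hi) (Y2 c))
    (fun c i hi => comp_pow_eq_zero (BX c) (hB i hi)) (X (X (X (un 0)))) (fun h => ?_) ?_
  · intro c v
    rcases hn.eq_or_lt with rfl | hn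
    · ext i
      fin_cases i <;> simp [X, Y, B, d, pow_succ]
    · rw [← LinearMap.comp_apply, comp_pow_eq_zero (BX c) hn]
      ext i
      fin_cases i <;> simp [Y, d, hn.ne']
  · simpa [X] using congrFun h 5
  · intro l m hlm F G hX hY hB
    have r1 : X (X (F (un 2))) = 0 := by
      rw [← hX, ← hX, ← map_zero F]
      refine congrArg _ (funext fun i => ?_)
      fin_cases i <;> simp [X]
    have r2 : B m (X (F (un 0))) = B m (F (un 2)) := by
      rw [← hX, ← hB, ← hB]
      refine congrArg _ (funext fun i => ?_)
      fin_cases i <;> simp [X, B]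
    have r3 : B m (X (X (F (un 0)))) = l • B m (X (F (un 2))) := by
      rw [← hX, ← hX, ← hX, ← hB, ← hB, ← map_smul]
      refine congrArg _ (funext fun i => ?_)
      fin_cases i <;> simp [X, B]
    have ha : F (un 0) 0 = 0 := by
      have e1 : F (un 2) 1 = 0 := by simpa [X] using congrFun r1 5
      have e2 : F (un 0) 0 = F (un 2) 1 + F (un 2) 2 := by simpa [X, B] using congrFun r2 1
      have e3 : m * F (un 0) 0 = l * (m * F (un 2) 1 + F (un 2) 2) := by
        simpa [X, B] using congrFun r3 2
      grind
    rw [hX, hX, hX]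
    ext i
    fin_cases i <;> simp [X, ha]

end CoRep

namespace CoRep

variable {P : RayCategory} {I : RIdeal P}

/-- Criterion for representation-infiniteness in terms of modules on which the morphisms `w i j n`
act by prescribed linear maps. -/
theorem not_repFin_of_words {J : Type} [Finite J] {d : J → P.Obj} {D : Set P.Obj} (hD : D.Finite)
    (hdD : ∀ j, d j ∈ D) (V : J → Type) [∀ j, AddCommGroup (V j)] [∀ j, Module ℚ (V j)]
    [∀ j, FiniteDimensional ℚ (V j)] (w : ∀ i j, ℕ → P.Hom (d i) (d j))
    (hw : ∀ i j, IsWordSeq (w i j))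
    (hall : ∀ i j (f : P.Hom (d i) (d j)), (∃ n, f = w i j n) ∨ I.mem _ _ f)
    (A : ℚ → ∀ i j, ℕ → (V i →ₗ[ℚ] V j)) (hid : ∀ i, w i i 0 = P.id (d i))
    (hAid : ∀ c i v, A c i i 0 v = v)
    (hcomp : ∀ i j l a b,
      (w j l a ⊚ w i j b = P.zero _ _ ∧ ∀ c v, A c j l a (A c i j b v) = 0) ∨
      ∃ n, w j l a ⊚ w i j b = w i l n ∧ ∀ c v, A c j l a (A c i j b v) = A c i l n v)
    (killed : ∀ c i j n, I.mem _ _ (w i j n) → A c i j n = 0)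
    (p : J) (u : V p) (hu : u ≠ 0)
    (hom : ∀ l m, l ≠ m → ∀ F : ∀ i, V i →ₗ[ℚ] V i,
      (∀ i j n v, F j (A l i j n v) = A m i j n (F i v)) → F p u = 0) : ¬ RepFin P D I.mem := by
  have happ := fun c i j => wordAct_apply (hw i j) (killed c i j)
  have hkill := fun c i j (f : P.Hom (d i) (d j)) => wordAct_killed (f := f) (killed c i j)
  refine not_repFin_of_act hD hdD V (fun c i j => wordAct (w i j) (A c i j)) ?_ ?_ hkill p u hu ?_
  · intro c i v
    rw [← hid, happ, hAid]
  · intro c i j l g f v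
    rcases hall j l g with ⟨a, rfl⟩ | hg
    · rcases hall i j f with ⟨b, rfl⟩ | hf
      · rw [happ, happ]
        rcases hcomp i j l a b with ⟨h, hA⟩ | ⟨n, h, hA⟩
        · rw [h, hA, hkill _ _ _ _ (I.zero_mem _ _)]; rfl
        · rw [h, hA, happ]
      · rw [hkill _ _ _ _ hf, hkill _ _ _ _ (I.comp_mem_left _ _ hf)]
        exact (map_zero _).symm
    · rw [hkill _ _ _ _ hg, hkill _ _ _ _ (I.comp_mem_right _ _ hg)]; rfl
  · intro l m hlm F hF
    refine hom l m hlm F fun i j n v => ?_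
    have := hF i j (w i j n) v
    rwa [happ, happ] at this

theorem pow_apply_comm {X Y : Type} [AddCommGroup X] [Module ℚ X] [AddCommGroup Y] [Module ℚ Y]
    {H : X →ₗ[ℚ] Y} {S : Module.End ℚ X} {R : Module.End ℚ Y} {m : ℕ}
    (h : ∀ v, R (H v) = H ((S ^ m) v)) (i : ℕ) (v : X) : (R ^ i) (H v) = H ((S ^ (m * i)) v) := by
  induction i with
  | zero => rfl
  | succ i ih =>
    rw [pow_succ', Module.End.mul_apply, ih, h, ← Module.End.mul_apply, ← pow_add, Nat.mul_succ,
      Nat.add_comm]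

theorem apply_pow_comm {X Y : Type} [AddCommGroup X] [Module ℚ X] [AddCommGroup Y] [Module ℚ Y]
    {H : X →ₗ[ℚ] Y} {S : Module.End ℚ X} {R : Module.End ℚ Y} {m : ℕ}
    (h : ∀ v, H (S v) = (R ^ m) (H v)) (i : ℕ) (v : X) : H ((S ^ i) v) = (R ^ (m * i)) (H v) := by
  induction i with
  | zero => rfl
  | succ i ih =>
    rw [pow_succ', Module.End.mul_apply, h, ih, ← Module.End.mul_apply, ← pow_add, Nat.mul_succ,
      Nat.add_comm]

theorem pow_comp_eq_zero {n k : ℕ} {F : (Fin n → ℚ) →ₗ[ℚ] (Fin k → ℚ)}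
    {T : Module.End ℚ (Fin k → ℚ)} {i j : ℕ} (h : (T ^ i) ∘ₗ F = 0) (hij : i ≤ j) :
    (T ^ j) ∘ₗ F = 0 := by
  obtain ⟨l, rfl⟩ := Nat.exists_eq_add_of_le' hij
  rw [pow_add, Module.End.mul_eq_comp, LinearMap.comp_assoc, h, LinearMap.comp_zero]

theorem comp_pipow_of_comp {x t : P.Obj} {f : P.Hom x t} {n : ℕ}
    (h : f ⊚ P.pipow x 1 = P.pipow t n ⊚ f) (i : ℕ) :
    f ⊚ P.pipow x i = P.pipow t (n * i) ⊚ f := by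
  induction i with
  | zero => rw [Nat.mul_zero, P.pipow_zero, P.pipow_zero, P.id_comp, P.comp_id]
  | succ i ih =>
    rw [P.pipow_succ, ← P.assoc, h, P.assoc, ih, ← P.assoc, ← pipow_add, Nat.mul_succ, Nat.add_comm]

set_option maxHeartbeats 800000 in
theorem not_repFin_of_loop_factor {x t : P.Obj} {D : Set P.Obj} (hD : D.Finite) (hx : x ∈ D)
    (ht : t ∈ D) (hxt : x ≠ t) {f : P.Hom x t} {g : P.Hom t x} {n : ℕ} (hn : 2 ≤ n)
    (hgf : g ⊚ f = P.pipow x 1) (hfg : f ⊚ g = P.pipow t n)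
    (hf : ∀ h : P.Hom x t, ∃ i, h = P.pipow t i ⊚ f) 
    (hg : ∀ h : P.Hom t x, ∃ i, h = g ⊚ P.pipow t i)
    (hX : ∀ i, I.mem _ _ (P.pipow x i) → 2 ≤ i) (hT : ∀ i, I.mem _ _ (P.pipow t i) → 3 ≤ i)
    (hF : ∀ i, I.mem _ _ (P.pipow t i ⊚ f) → 2 ≤ i)
    (hG : ∀ i, I.mem _ _ (g ⊚ P.pipow t i) → 2 ≤ i) : ¬ RepFin P D I.mem := by
  let d : ℚ := if n = 2 then 1 else 0
  let T : Module.End ℚ (Fin 4 → ℚ) := .pi ![0, co 0, 0, co 1]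
  let F : (Fin 3 → ℚ) →ₗ[ℚ] (Fin 4 → ℚ) := .pi ![0, co 0, co 0, d • co 2]
  let G : ℚ → ((Fin 4 → ℚ) →ₗ[ℚ] (Fin 3 → ℚ)) := fun c => .pi ![0, c • co 1 + co 2, co 0]
  let V : Bool → Type := fun j => Fin (bif j then 4 else 3) → ℚ
  let w : ∀ i j, ℕ → P.Hom (twoPoints x t i) (twoPoints x t j) := fun i j k =>
    match i, j with
    | false, false => P.pipow x k
    | false, true => P.pipow t k ⊚ f
    | true, false => g ⊚ P.pipow t k
    | true, true => P.pipow t k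
  let A : ℚ → ∀ i j, ℕ → (V i →ₗ[ℚ] V j) := fun c i j k =>
    match i, j with
    | false, false => ((G c ∘ₗ F) ^ k : Module.End ℚ (Fin 3 → ℚ))
    | false, true => (T ^ k) ∘ₗ F
    | true, false => G c ∘ₗ T ^ k
    | true, true => T ^ k
  have T3 : T ^ 3 = 0 := by
    ext i j
    fin_cases j <;> simp [T, pow_succ]
  have TF : (T ^ 2) ∘ₗ F = 0 := by
    ext i j
    fin_cases j <;> simp [T, F, pow_succ]
  have GT : ∀ c, G c ∘ₗ T ^ 2 = 0 := by
    intro c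
    ext i j
    fin_cases j <;> simp [T, G, pow_succ]
  have GTF : ∀ c, G c ∘ₗ T ∘ₗ F = 0 := by
    intro c
    ext i j
    fin_cases j <;> simp [T, G, F]
  have S2 : ∀ c, (G c ∘ₗ F) ^ 2 = 0 := by
    intro c
    ext i j
    fin_cases j <;> simp [F, G, pow_succ]
  have FG : ∀ c, F ∘ₗ G c = T ^ n := by
    intro c
    rcases hn.eq_or_lt with rfl | hn
    · ext i j
      fin_cases j <;> simp [T, F, G, d, pow_succ]
    · rw [pow_eq_zero_of_le hn T3]
      ext i j
      fin_cases j <;> simp [F, G, d, hn.ne']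
  have hFS : f ⊚ P.pipow x 1 = P.pipow t n ⊚ f := by rw [← hgf, ← hfg, P.assoc]
  have hSG : P.pipow x 1 ⊚ g = g ⊚ P.pipow t n := by rw [← hgf, ← hfg, P.assoc]
  have FS : ∀ c v, F ((G c ∘ₗ F) v) = (T ^ n) (F v) := fun c v => LinearMap.congr_fun (FG c) (F v)
  have SG : ∀ c v, (G c ∘ₗ F) (G c v) = G c ((T ^ n) v) := fun c v =>
    congrArg (G c) (LinearMap.congr_fun (FG c) v)
  refine not_repFin_of_words (d := twoPoints x t) hD (fun j => by cases j <;> assumption) V w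
    ?_ ?_ A ?_ ?_ ?_ ?_ true (T (T (un 0))) (fun h => ?_) ?_
  · intro i j
    match i, j with
    | false, false => exact isWordSeq_pipow x
    | false, true => exact isWordSeq_pipow_comp f
    | true, false => exact isWordSeq_comp_pipow g
    | true, true => exact isWordSeq_pipow t
  · intro i j h
    match i, j with
    | false, false => exact .inl (P.endo_cyclic x h)
    | false, true => exact .inl (hf h)
    | true, false => exact .inl (hg h)
    | true, true => exact .inl (P.endo_cyclic t h)
  · intro i
    cases i <;> exact P.pipow_zero _
  · intro c i v
    cases i <;> rfl
  · intro i j l a b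
    match i, j, l with
    | false, false, false => exact .inr ⟨a + b,
        (pipow_add _ _ _).symm, fun c v =>
        (LinearMap.congr_fun (pow_add (G c ∘ₗ F : Module.End ℚ (Fin 3 → ℚ)) a b) v).symm⟩
    | false, false, true =>
      refine .inr ⟨a + n * b, ?_, fun c v => ?_⟩
      · change (P.pipow t a ⊚ f) ⊚ P.pipow x b = P.pipow t (a + n * b) ⊚ f
        rw [P.assoc, comp_pipow_of_comp hFS, ← P.assoc, ← pipow_add]
      · change (T ^ a) (F (((G c ∘ₗ F) ^ b) v)) = (T ^ (a + n * b)) (F v)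
        rw [apply_pow_comm (FS c), ← Module.End.mul_apply, ← pow_add]
    | false, true, false =>
      change ((g ⊚ P.pipow t a) ⊚ P.pipow t b ⊚ f = P.zero x x ∧
          ∀ c v, G c ((T ^ a) ((T ^ b) (F v))) = 0) ∨
        ∃ k, (g ⊚ P.pipow t a) ⊚ P.pipow t b ⊚ f = P.pipow x k ∧
          ∀ c v, G c ((T ^ a) ((T ^ b) (F v))) = ((G c ∘ₗ F) ^ k) v
      have e : (g ⊚ P.pipow t a) ⊚ P.pipow t b ⊚ f = g ⊚ P.pipow t (a + b) ⊚ f := by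
        rw [P.assoc, pipow_comp_pipow]
      have e' : ∀ c v, G c ((T ^ a) ((T ^ b) (F v))) = G c ((T ^ (a + b)) (F v)) := fun c v => by
        rw [pow_add]; rfl
      simp only [e, e']
      generalize a + b = k
      have hk0 : k ≠ 0 → ∀ c v, G c ((T ^ k) (F v)) = 0 := by
        intro hk c v
        obtain rfl | hk : k = 1 ∨ 2 ≤ k := by omega
        · exact LinearMap.congr_fun (GTF c) v
        · exact LinearMap.congr_fun (comp_pow_eq_zero (GT c) hk) (F v)
      by_cases h0 : g ⊚ P.pipow t k ⊚ f = P.zero x x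
      · refine .inl ⟨h0, hk0 ?_⟩
        rintro rfl
        rw [P.pipow_zero, P.id_comp, hgf] at h0
        have := hX 1 (h0 ▸ I.zero_mem _ _)
        omega
      · obtain ⟨j, hj⟩ := P.endo_cyclic x (g ⊚ P.pipow t k ⊚ f)
        refine .inr ⟨j, hj, fun c v => ?_⟩
        by_cases hk : k = 0
        · subst hk
          have : j = 1 := by
            rw [P.pipow_zero, P.id_comp, hgf] at hj h0
            exact (pipow_inj hj h0).symm
          subst this
          rfl
        · rw [hk0 hk]
          have hj2 : 2 ≤ j := by
            by_contra hj2
            obtain rfl | rfl : j = 0 ∨ j = 1 := by omega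
            · rw [P.pipow_zero] at hj
              exact hxt (eq_of_retract hj)
            · rw [← hgf] at hj
              have := cancelL hj h0
              refine hk (absorb (j := 0) (ne_zero_right (ne_zero_right h0)) ?_).1
              rw [P.pipow_zero, P.comp_id, this]
          rw [pow_eq_zero_of_le hj2 (S2 c)]; rfl
    | false, true, true =>
      refine .inr ⟨a + b, pipow_comp_pipow _ _ _, fun c v => ?_⟩
      exact (LinearMap.congr_fun (pow_add T a b) (F v)).symm
    | true, false, false =>
      refine .inr ⟨n * a + b, ?_, fun c v => ?_⟩
      · change P.pipow x a ⊚ g ⊚ P.pipow t b = g ⊚ P.pipow t (n * a + b)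
        rw [← P.assoc, pipow_comp_comp_pipow hSG, P.assoc, ← pipow_add]
      · change ((G c ∘ₗ F) ^ a) (G c ((T ^ b) v)) = G c ((T ^ (n * a + b)) v)
        rw [pow_apply_comm (SG c), ← Module.End.mul_apply, ← pow_add]
    | true, false, true =>
      refine .inr ⟨a + n + b, ?_, fun c v => ?_⟩
      · change (P.pipow t a ⊚ f) ⊚ g ⊚ P.pipow t b = P.pipow t (a + n + b)
        rw [P.assoc, ← P.assoc f, hfg, ← P.assoc, ← pipow_add, ← pipow_add]
      · change (T ^ a) ((F ∘ₗ G c) ((T ^ b) v)) = (T ^ (a + n + b)) v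
        rw [FG, pow_add, pow_add]; rfl
    | true, true, false =>
      refine .inr ⟨a + b, ?_, fun c v => ?_⟩
      · change (g ⊚ P.pipow t a) ⊚ P.pipow t b = g ⊚ P.pipow t (a + b)
        rw [P.assoc, ← pipow_add]
      · change G c ((T ^ a) ((T ^ b) v)) = G c ((T ^ (a + b)) v)
        rw [pow_add]; rfl
    | true, true, true => exact .inr ⟨a + b,
        (pipow_add _ _ _).symm, fun c v =>
        (LinearMap.congr_fun (pow_add T a b) v).symm⟩
  · intro c i j k hI
    match i, j with
    | false, false => exact pow_eq_zero_of_le (hX k hI) (S2 c)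
    | false, true => exact pow_comp_eq_zero TF (hF k hI)
    | true, false => exact comp_pow_eq_zero (GT c) (hG k hI)
    | true, true => exact pow_eq_zero_of_le (hT k hI) T3
  · have := congrFun (show T (T (un 0)) = (0 : Fin 4 → ℚ) from h) 3
    simp [T] at this
  · intro l m hlm φ hφ
    suffices key : ∀ (a : Module.End ℚ (Fin 3 → ℚ)) (b : Module.End ℚ (Fin 4 → ℚ)),
        (∀ v, b (T v) = T (b v)) → (∀ v, b (F v) = F (a v)) → (∀ v, a (G l v) = G m (b v)) →
        b (T (T (un 0))) = 0 from
      key (φ false) (φ true) (hφ true true 1) (hφ false true 0) (hφ true false 0)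
    intro a b hT hF hG
    have e1 : T (F (un 0) - T (un 0)) = 0 := by
      ext i; fin_cases i <;> simp [T, F]
    have e2 : G l (T (un 0)) = l • G l (F (un 0) - T (un 0)) := by
      ext i; fin_cases i <;> simp [T, F, G]
    replace e1 := congrArg b e1
    replace e2 := congrArg a e2
    rw [map_zero, hT, map_sub, hF, hT] at e1
    rw [hG, hT, map_smul, hG, map_sub, hF, hT] at e2
    have h1 := congrFun e1 3
    have h2 := congrFun e2 1
    simp [T, F, G] at h1 h2
    have h3 : b (un 0) 0 = 0 := by grind
    rw [hT, hT]
    ext i; fin_cases i <;> simp [T, h3]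

end CoRep

theorem IsWordSeq.comp {P : RayCategory} {a b c : P.Obj} {w : ℕ → P.Hom a b} (hw : IsWordSeq w)
    (f : P.Hom b c) : IsWordSeq fun i => f ⊚ w i :=
  fun i j h h0 => hw i j (cancelL h h0) (ne_zero_right h0)

theorem isWordSeq_zero {P : RayCategory} (a b : P.Obj) : IsWordSeq fun _ => P.zero a b :=
  fun _ _ _ h => (h rfl).elim

/-- the map `none ↦ y`, `some false ↦ x`, `some true ↦ t` -/
def threePoints {P : RayCategory} (x t y : P.Obj) : Option Bool → P.Obj
  | none => y
  | some b => twoPoints x t b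

namespace CoRep

variable {P : RayCategory} {I : RIdeal P}

set_option maxHeartbeats 1600000 in
theorem not_repFin_of_loop_factor_arrow {x t y : P.Obj} {D : Set P.Obj} (hD : D.Finite)
    (hx : x ∈ D) (ht : t ∈ D) (hy : y ∈ D) {f : P.Hom x t} {g : P.Hom t x} {b : P.Hom x y}
    (hgf : g ⊚ f = P.pipow x 1) (hfg : f ⊚ g = P.pipow t 1) (hb : P.pipow y 1 ⊚ b = b ⊚ P.pipow x 1)
    (hf : ∀ h : P.Hom x t, ∃ i, h = f ⊚ P.pipow x i)
    (hg : ∀ h : P.Hom t x, ∃ i, h = P.pipow x i ⊚ g)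
    (hxy : ∀ h : P.Hom x y, ∃ i, h = b ⊚ P.pipow x i)
    (hty : ∀ h : P.Hom t y, ∃ i, h = b ⊚ P.pipow x i ⊚ g)
    (hyx : ∀ h : P.Hom y x, h = P.zero y x) (hyt : ∀ h : P.Hom y t, h = P.zero y t)
    (hX : ∀ i, I.mem _ _ (P.pipow x i) → 3 ≤ i) (hT : ∀ i, I.mem _ _ (P.pipow t i) → 2 ≤ i)
    (hY : ∀ i, I.mem _ _ (P.pipow y i) → 3 ≤ i)
    (hF : ∀ i, I.mem _ _ (f ⊚ P.pipow x i) → 2 ≤ i)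
    (hG : ∀ i, I.mem _ _ (P.pipow x i ⊚ g) → 2 ≤ i)
    (hB : ∀ i, I.mem _ _ (b ⊚ P.pipow x i) → 2 ≤ i)
    (hBG : ∀ i, I.mem _ _ (b ⊚ P.pipow x i ⊚ g) → 1 ≤ i) : ¬ RepFin P D I.mem := by
  let F : (Fin 5 → ℚ) →ₗ[ℚ] (Fin 4 → ℚ) := .pi ![co 0, 0, co 1, co 2]
  let G : (Fin 4 → ℚ) →ₗ[ℚ] (Fin 5 → ℚ) := .pi ![0, co 0, co 1, 0, co 2]
  let B : (Fin 5 → ℚ) →ₗ[ℚ] (Fin 5 → ℚ) := .pi ![0, co 0, 0, co 1 - co 3, co 2 - co 3]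
  let Y : ℚ → Module.End ℚ (Fin 5 → ℚ) := fun c => .pi ![0, co 0, c • co 0, co 1, co 2]
  let V : Option Bool → Type := fun j => Fin (match j with | some true => 4 | _ => 5) → ℚ
  let S : Module.End ℚ (Fin 5 → ℚ) := G ∘ₗ F
  let T : Module.End ℚ (Fin 4 → ℚ) := F ∘ₗ G
  let w : ∀ i j, ℕ → P.Hom (threePoints x t y i) (threePoints x t y j) := fun i j k =>
    match i, j with
    | some false, some false => P.pipow x k
    | some false, some true => f ⊚ P.pipow x k
    | some true, some false => P.pipow x k ⊚ g
    | some true, some true => P.pipow t k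
    | some false, none => b ⊚ P.pipow x k
    | some true, none => b ⊚ P.pipow x k ⊚ g
    | none, none => P.pipow y k
    | none, some _ => P.zero _ _
  let A : ℚ → ∀ i j, ℕ → (V i →ₗ[ℚ] V j) := fun c i j k =>
    match i, j with
    | some false, some false => S ^ k
    | some false, some true => F ∘ₗ S ^ k
    | some true, some false => (S ^ k) ∘ₗ G
    | some true, some true => T ^ k
    | some false, none => B ∘ₗ S ^ k
    | some true, none => B ∘ₗ (S ^ k) ∘ₗ G
    | none, none => Y c ^ k
    | none, some _ => 0
  have eS : ∀ i j v, (S ^ i) ((S ^ j) v) = (S ^ (i + j)) v := fun i j v => by rw [pow_add]; rfl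
  have eT : ∀ i j v, (T ^ i) ((T ^ j) v) = (T ^ (i + j)) v := fun i j v => by rw [pow_add]; rfl
  have eY : ∀ c i j v, (Y c ^ i) ((Y c ^ j) v) = (Y c ^ (i + j)) v := fun c i j v => by
    rw [pow_add]; rfl
  have eGF : ∀ v, G (F v) = (S ^ 1) v := fun v => by rw [pow_one]; rfl
  have eTF : ∀ i v, (T ^ i) (F v) = F ((S ^ i) v) := fun i v => by
    rw [pow_apply_comm (S := S) (m := 1) (fun v => by rw [pow_one]; rfl), one_mul]
  have eGT : ∀ i v, G ((T ^ i) v) = (S ^ i) (G v) := fun i v => by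
    rw [apply_pow_comm (R := S) (m := 1) (fun v => by rw [pow_one]; rfl), one_mul]
  have eFG : ∀ i v, F ((S ^ i) (G v)) = (T ^ (i + 1)) v := fun i v => by
    rw [← eTF, pow_succ]; rfl
  have eYB : ∀ c i v, (Y c ^ i) (B v) = B ((S ^ i) v) := fun c i v => by
    rw [pow_apply_comm (S := S) (m := 1), one_mul]
    intro v
    rw [pow_one]
    ext i; fin_cases i <;> simp [Y, B, S, F, G]
  have mGF : ∀ {z} (h : P.Hom z x), g ⊚ f ⊚ h = P.pipow x 1 ⊚ h := fun h => by
    rw [← P.assoc, hgf]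
  have mX : ∀ i j {z} (h : P.Hom z x), P.pipow x i ⊚ P.pipow x j ⊚ h = P.pipow x (i + j) ⊚ h :=
    fun i j _ h => pipow_comp_pipow ..
  have mTF : ∀ i {z} (h : P.Hom z x), P.pipow t i ⊚ f ⊚ h = f ⊚ P.pipow x i ⊚ h := fun i _ h => by
    rw [← P.assoc, ← P.assoc, pipow_comp_comp_pipow (m := 1) (by rw [← hgf, ← hfg, P.assoc]),
      one_mul]
  have mGT : ∀ i, g ⊚ P.pipow t i = P.pipow x i ⊚ g := fun i => by
    rw [← one_mul i, ← pipow_comp_comp_pipow (m := 1) (by rw [← hgf, ← hfg, P.assoc]), one_mul]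
  have mFG : ∀ i, f ⊚ P.pipow x i ⊚ g = P.pipow t (i + 1) := fun i => by
    rw [← mTF, hfg, ← pipow_add]
  have mYB : ∀ i {z} (h : P.Hom z x), P.pipow y i ⊚ b ⊚ h = b ⊚ P.pipow x i ⊚ h := fun i _ h => by
    rw [← P.assoc, ← P.assoc, pipow_comp_comp_pipow (m := 1) hb, one_mul]
  have S3 : S ^ 3 = 0 := by
    ext i j
    fin_cases j <;> simp [S, F, G, pow_succ]
  have T2 : T ^ 2 = 0 := by
    ext i j
    fin_cases j <;> simp [T, F, G, pow_succ]
  have Y3 : ∀ c, Y c ^ 3 = 0 := fun c => by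
    ext i j
    fin_cases j <;> simp [Y, pow_succ]
  have FS : F ∘ₗ S ^ 2 = 0 := by
    ext i j
    fin_cases j <;> simp [S, F, G, pow_succ]
  have SG : (S ^ 2) ∘ₗ G = 0 := by
    ext i j
    fin_cases j <;> simp [S, F, G, pow_succ]
  have BS : B ∘ₗ S ^ 2 = 0 := by
    ext i j
    fin_cases j <;> simp [S, F, G, B, pow_succ]
  have BSG : (B ∘ₗ S) ∘ₗ G = 0 := by
    ext i j
    fin_cases j <;> simp [S, F, G, B]
  refine not_repFin_of_words (d := threePoints x t y) hD
    (fun j => by rcases j with _ | _ | _ <;> assumption) V w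
    ?_ ?_ A ?_ ?_ ?_ ?_ (some false) (S (S (un 0))) (fun h => ?_) ?_
  · intro i j
    match i, j with
    | some false, some false => exact isWordSeq_pipow x
    | some false, some true => exact isWordSeq_comp_pipow f
    | some true, some false => exact isWordSeq_pipow_comp g
    | some true, some true => exact isWordSeq_pipow t
    | some false, none => exact isWordSeq_comp_pipow b
    | some true, none => exact (isWordSeq_pipow_comp g).comp b
    | none, none => exact isWordSeq_pipow y
    | none, some _ => exact isWordSeq_zero _ _
  · intro i j h
    match i, j with
    | some false, some false => exact .inl (P.endo_cyclic x h)
    | some false, some true => exact .inl (hf h)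
    | some true, some false => exact .inl (hg h)
    | some true, some true => exact .inl (P.endo_cyclic t h)
    | some false, none => exact .inl (hxy h)
    | some true, none => exact .inl (hty h)
    | none, none => exact .inl (P.endo_cyclic y h)
    | none, some false => exact .inl ⟨0, hyx h⟩
    | none, some true => exact .inl ⟨0, hyt h⟩
  · intro i
    rcases i with _ | _ | _ <;> exact P.pipow_zero _
  · intro c i v
    rcases i with _ | _ | _ <;> rfl
  · intro i j l m n
    match i, j, l with
    | none, none, none => exact .inr ⟨m + n, (pipow_add ..).symm, fun c v => eY c m n v⟩
    | none, some _, _ => exact .inl ⟨P.comp_zero _, fun c v => map_zero _⟩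
    | _, none, some _ => exact .inl ⟨P.zero_comp _, fun c v => rfl⟩
    | some false, some false, some false =>
      exact .inr ⟨m + n, (pipow_add ..).symm, fun c v => eS m n v⟩
    | some false, some false, some true =>
      exact .inr ⟨m + n,
        show (f ⊚ P.pipow x m) ⊚ P.pipow x n = (f ⊚ P.pipow x (m + n)) by
          rw [P.assoc, pipow_add], fun c v => congrArg F (eS m n v)⟩
    | some false, some false, none =>
      exact .inr ⟨m + n,
        show (b ⊚ P.pipow x m) ⊚ P.pipow x n = (b ⊚ P.pipow x (m + n)) by
          rw [P.assoc, pipow_add], fun c v => congrArg B (eS m n v)⟩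
    | some false, some true, some false => 
      refine .inr ⟨m + (1 + n),
        show (P.pipow x m ⊚ g) ⊚ (f ⊚ P.pipow x n) = P.pipow x (m + (1 + n)) by
          rw [P.assoc, mGF, pipow_add, pipow_add], fun c v => ?_⟩
      exact (congrArg (S ^ m) ((eGF _).trans (eS 1 n v))).trans (eS m (1 + n) v)
    | some false, some true, some true =>
      refine .inr ⟨m + n,
        show P.pipow t m ⊚ (f ⊚ P.pipow x n) = (f ⊚ P.pipow x (m + n)) by
          rw [mTF, pipow_add], fun c v => ?_⟩
      exact (eTF m _).trans (congrArg F (eS m n v))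
    | some false, some true, none => 
      refine .inr ⟨m + (1 + n),
        show (b ⊚ P.pipow x m ⊚ g) ⊚ (f ⊚ P.pipow x n) = (b ⊚ P.pipow x (m + (1 + n))) by
          rw [P.assoc, P.assoc, mGF, pipow_add, pipow_add], fun c v => ?_⟩
      exact congrArg B ((congrArg (S ^ m) ((eGF _).trans (eS 1 n v))).trans (eS m (1 + n) v))
    | some true, some false, some false =>
      exact .inr ⟨m + n,
        show P.pipow x m ⊚ (P.pipow x n ⊚ g) = (P.pipow x (m + n) ⊚ g) by
          rw [mX], fun c v => eS m n (G v)⟩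
    | some true, some false, some true =>
      refine .inr ⟨m + n + 1,
        show (f ⊚ P.pipow x m) ⊚ (P.pipow x n ⊚ g) = P.pipow t (m + n + 1) by
          rw [P.assoc, mX, mFG], fun c v => ?_⟩
      exact (congrArg F (eS m n (G v))).trans (eFG (m + n) v)
    | some true, some false, none =>
      exact .inr ⟨m + n,
        show (b ⊚ P.pipow x m) ⊚ (P.pipow x n ⊚ g) = (b ⊚ P.pipow x (m + n) ⊚ g) by
          rw [P.assoc, mX], fun c v => congrArg B (eS m n (G v))⟩
    | some true, some true, some false =>
      refine .inr ⟨m + n,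
        show (P.pipow x m ⊚ g) ⊚ P.pipow t n = (P.pipow x (m + n) ⊚ g) by
          rw [P.assoc, mGT, mX], fun c v => ?_⟩
      exact (congrArg (S ^ m) (eGT n v)).trans (eS m n (G v))
    | some true, some true, some true =>
      exact .inr ⟨m + n, (pipow_add ..).symm, fun c v => eT m n v⟩
    | some true, some true, none =>
      refine .inr ⟨m + n,
        show (b ⊚ P.pipow x m ⊚ g) ⊚ P.pipow t n = (b ⊚ P.pipow x (m + n) ⊚ g) by
          rw [P.assoc, P.assoc, mGT, mX], fun c v => ?_⟩
      exact congrArg B ((congrArg (S ^ m) (eGT n v)).trans (eS m n (G v)))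
    | some false, none, none =>
      refine .inr ⟨m + n,
        show P.pipow y m ⊚ (b ⊚ P.pipow x n) = (b ⊚ P.pipow x (m + n)) by
          rw [mYB, pipow_add], fun c v => ?_⟩
      exact (eYB c m _).trans (congrArg B (eS m n v))
    | some true, none, none =>
      refine .inr ⟨m + n,
        show P.pipow y m ⊚ (b ⊚ P.pipow x n ⊚ g) = (b ⊚ P.pipow x (m + n) ⊚ g) by
          rw [mYB, mX], fun c v => ?_⟩
      exact (eYB c m _).trans (congrArg B (eS m n (G v)))
  · intro c i j k hI
    match i, j with
    | some false, some false => exact pow_eq_zero_of_le (hX k hI) S3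
    | some false, some true => exact comp_pow_eq_zero FS (hF k hI)
    | some true, some false => exact pow_comp_eq_zero SG (hG k hI)
    | some true, some true => exact pow_eq_zero_of_le (hT k hI) T2
    | some false, none => exact comp_pow_eq_zero BS (hB k hI)
    | some true, none => 
      obtain ⟨k, rfl⟩ := Nat.exists_eq_add_of_le' (hBG k hI)
      refine LinearMap.ext fun v => ?_
      change B ((S ^ (k + 1)) (G v)) = 0
      rw [pow_succ', Module.End.mul_apply, ← eGT]
      exact LinearMap.congr_fun BSG ((T ^ k) v)
    | none, none => exact pow_eq_zero_of_le (hY k hI) (Y3 c)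
    | none, some _ => rfl
  · have := congrFun (show S (S (un 0)) = (0 : Fin 5 → ℚ) from h) 4
    simp [S, F, G] at this
  · intro l m hlm φ hφ
    suffices key : ∀ (a : Module.End ℚ (Fin 5 → ℚ)) (d : Module.End ℚ (Fin 4 → ℚ))
        (e : Module.End ℚ (Fin 5 → ℚ)), (∀ v, d (F v) = F (a v)) → (∀ v, a (G v) = G (d v)) →
        (∀ v, e (B v) = B (a v)) → (∀ v, e (Y l v) = Y m (e v)) → a (S (S (un 0))) = 0 from
      key (φ (some false)) (φ (some true)) (φ none) (hφ (some false) (some true) 0)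
        (hφ (some true) (some false) 0) (hφ (some false) none 0) (hφ none none 1)
    intro a d e hF hG hB hY
    have e1 : Y l (Y l (un 0)) = B (G (F (un 0))) + l • B (G (un 1)) := by
      ext i; fin_cases i <;> simp [Y, F, G, B]
    have e2 : G (F (G (un 1))) = 0 := by
      ext i; fin_cases i <;> simp [F, G]
    have e3 : B (un 3) + B (G (F (un 0))) + B (G (un 1)) = 0 := by
      ext i; fin_cases i <;> simp [F, G, B]
    have e4 : F (un 3) = 0 := by
      ext i; fin_cases i <;> simp [F]
    replace e1 := congrArg e e1
    replace e2 := congrArg a e2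
    replace e3 := congrArg e e3
    replace e4 := congrArg d e4
    rw [hY, hY, map_add, map_smul, hB, hB, hG, hG, hF] at e1
    rw [hG, hF, hG, map_zero] at e2
    rw [map_add, map_add, hB, hB, hB, hG, hG, hF, map_zero] at e3
    rw [hF, map_zero] at e4
    have h1 := congrFun e1 3
    have h2 := congrFun e1 4
    have h3 := congrFun e2 4
    have h4 := congrFun e3 3
    have h5 := congrFun e3 4
    have h6 := congrFun e4 2
    have h7 := congrFun e4 3
    simp [Y, F, G, B] at h1 h2 h3 h4 h5 h6 h7
    have h8 : a (un 0) 0 = 0 := by grind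
    change a (G (F (G (F (un 0))))) = 0
    rw [hG, hF, hG, hF]
    ext i; fin_cases i <;> simp [F, G, h8]

end CoRep

namespace CoRep

variable {P : RayCategory} {I : RIdeal P}

theorem pow_eq_pow_of_pipow_eq {x : P.Obj} {X : Type} [AddCommGroup X] [Module ℚ X]
    {T : Module.End ℚ X} (hT : ∀ i, P.pipow x i = P.zero x x → T ^ i = 0) {i j : ℕ}
    (h : P.pipow x i = P.pipow x j) : T ^ i = T ^ j := by
  by_cases h0 : P.pipow x i = P.zero x x
  · rw [hT i h0, hT j (h ▸ h0)]
  · rw [pipow_inj h h0]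

open Classical in
set_option maxHeartbeats 1600000 in
theorem not_repFin_of_two_loops {x z y : P.Obj} {D : Set P.Obj} (hD : D.Finite)
    (hx : x ∈ D) (hz : z ∈ D) (hy : y ∈ D) (hxz : x ≠ z) (hyz : y ≠ z)
    {g : P.Hom x z} {b : P.Hom z y} {k l : ℕ} (hk : 2 ≤ k) (hl : 2 ≤ l)
    (hbg : P.pipow y 1 ⊚ b ⊚ g = (b ⊚ g) ⊚ P.pipow x 1)
    (hzg : P.pipow z 1 ⊚ g = g ⊚ P.pipow x l) (hbz : b ⊚ P.pipow z 1 = P.pipow y k ⊚ b)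
    (gen_xz : ∀ h : P.Hom x z, ∃ i, h = g ⊚ P.pipow x i)
    (gen_zy : ∀ h : P.Hom z y, ∃ i, h = P.pipow y i ⊚ b)
    (gen_xy : ∀ h : P.Hom x y, ∃ i, h = (b ⊚ g) ⊚ P.pipow x i)
    (hyx : ∀ h : P.Hom y x, h = P.zero y x)
    (hzx : ∀ e : P.Hom z x, ∃ n, 2 ≤ n ∧ e ⊚ g = P.pipow x n)
    (hyz' : ∀ f : P.Hom y z, ∃ n, 2 ≤ n ∧ b ⊚ f = P.pipow y n)
    (hef : ∀ (e : P.Hom z x) (f : P.Hom y z), e ⊚ g = P.pipow x 2 → b ⊚ f = P.pipow y 2 → False)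
    (hX : ∀ i, I.mem _ _ (P.pipow x i) → 3 ≤ i) (hZ : ∀ i, I.mem _ _ (P.pipow z i) → 1 ≤ i)
    (hY : ∀ i, I.mem _ _ (P.pipow y i) → 3 ≤ i)
    (hG : ∀ i, I.mem _ _ (g ⊚ P.pipow x i) → 2 ≤ i)
    (hB : ∀ i, I.mem _ _ (P.pipow y i ⊚ b) → 2 ≤ i)
    (hBG : ∀ i, I.mem _ _ ((b ⊚ g) ⊚ P.pipow x i) → 1 ≤ i) : ¬ RepFin P D I.mem := by
  let X : Module.End ℚ (Fin 5 → ℚ) := .pi ![0, 0, co 0, co 1, co 2]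
  let G : (Fin 5 → ℚ) →ₗ[ℚ] (Fin 4 → ℚ) := .pi ![0, co 0, co 1, co 3]
  let B : (Fin 4 → ℚ) →ₗ[ℚ] (Fin 5 → ℚ) := .pi ![0, co 0, co 0, co 1, co 2]
  let Y : ℚ → Module.End ℚ (Fin 5 → ℚ) := fun c => .pi ![0, co 0, c • co 0, co 1, co 2]
  let E : (Fin 4 → ℚ) →ₗ[ℚ] (Fin 5 → ℚ) := .pi ![0, 0, 0, 0, co 1]
  let F : ℚ → ((Fin 5 → ℚ) →ₗ[ℚ] (Fin 4 → ℚ)) := fun c => .pi ![0, co 0, c • co 0, 0]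
  let Z : Module.End ℚ (Fin 4 → ℚ) := 0
  let V : Option Bool → Type := fun j => Fin (match j with | some true => 4 | _ => 5) → ℚ
  let act : ℚ → ∀ i j, P.Hom (threePoints x z y i) (threePoints x z y j) → (V i →ₗ[ℚ] V j) :=
    fun c i j => match i, j with
    | some false, some false => wordAct (P.pipow x) fun n => X ^ n
    | some false, some true => wordAct (fun n => g ⊚ P.pipow x n) fun n => G ∘ₗ X ^ n
    | some true, some false => fun f => if f ⊚ g = P.pipow x 2 then E else 0
    | some true, some true => wordAct (P.pipow z) fun n => Z ^ n
    | some false, none => wordAct (fun n => (b ⊚ g) ⊚ P.pipow x n) fun n => (B ∘ₗ G) ∘ₗ X ^ n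
    | some true, none => wordAct (fun n => P.pipow y n ⊚ b) fun n => (Y c ^ n) ∘ₗ B
    | none, none => wordAct (P.pipow y) fun n => Y c ^ n
    | none, some true => fun f => if b ⊚ f = P.pipow y 2 then F c else 0
    | none, some false => fun f => 0
  have X3 : X ^ 3 = 0 := by
    ext i j
    fin_cases j <;> simp [X, pow_succ]
  have Y3 : ∀ c, Y c ^ 3 = 0 := fun c => by
    ext i j
    fin_cases j <;> simp [Y, pow_succ]
  have GX : G ∘ₗ X ^ 2 = 0 := by
    ext i j
    fin_cases j <;> simp [X, G, pow_succ]
  have BGX : (B ∘ₗ G) ∘ₗ X ^ 1 = 0 := by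
    ext i j
    fin_cases j <;> simp [X, G, B]
  have YBG : ∀ c, (Y c ^ 1) ∘ₗ B ∘ₗ G = 0 := fun c => by
    ext i j
    fin_cases j <;> simp [Y, G, B]
  have YB : ∀ c, (Y c ^ 2) ∘ₗ B = 0 := fun c => by
    ext i j
    fin_cases j <;> simp [Y, B, pow_succ]
  have EG : E ∘ₗ G = X ^ 2 := by
    ext i j
    fin_cases j <;> simp [X, G, E, pow_succ]
  have BF : ∀ c, B ∘ₗ F c = Y c ^ 2 := fun c => by
    ext i j
    fin_cases j <;> simp [Y, B, F, pow_succ]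
  have XE : (X ^ 1) ∘ₗ E = 0 := by
    ext i j
    fin_cases j <;> simp [X, E]
  have GE : G ∘ₗ E = 0 := by
    ext i j
    fin_cases j <;> simp [G, E]
  have FY : ∀ c, F c ∘ₗ Y c ^ 1 = 0 := fun c => by
    ext i j
    fin_cases j <;> simp [Y, F]
  have FB : ∀ c, F c ∘ₗ B = 0 := fun c => by
    ext i j
    fin_cases j <;> simp [B, F]
  have kX : ∀ i, I.mem _ _ (P.pipow x i) → X ^ i = 0 := fun i h => pow_eq_zero_of_le (hX i h) X3
  have kZ : ∀ i, I.mem _ _ (P.pipow z i) → Z ^ i = 0 := fun i h =>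
    pow_eq_zero_of_le (hZ i h) (pow_one Z)
  have kY : ∀ c i, I.mem _ _ (P.pipow y i) → Y c ^ i = 0 := fun c i h =>
    pow_eq_zero_of_le (hY i h) (Y3 c)
  have kG : ∀ i, I.mem _ _ (g ⊚ P.pipow x i) → G ∘ₗ X ^ i = 0 := fun i h =>
    comp_pow_eq_zero GX (hG i h)
  have kB : ∀ c i, I.mem _ _ (P.pipow y i ⊚ b) → (Y c ^ i) ∘ₗ B = 0 := fun c i h =>
    pow_comp_eq_zero (YB c) (hB i h)
  have kBG : ∀ i, I.mem _ _ ((b ⊚ g) ⊚ P.pipow x i) → (B ∘ₗ G) ∘ₗ X ^ i = 0 := fun i h =>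
    comp_pow_eq_zero BGX (hBG i h)
  have aX : ∀ c n, act c (some false) (some false) (P.pipow x n) = X ^ n := fun c n =>
    wordAct_apply (isWordSeq_pipow x) kX n
  have aZ : ∀ c n, act c (some true) (some true) (P.pipow z n) = Z ^ n := fun c n =>
    wordAct_apply (isWordSeq_pipow z) kZ n
  have aY : ∀ c n, act c none none (P.pipow y n) = Y c ^ n := fun c n =>
    wordAct_apply (isWordSeq_pipow y) (kY c) n
  have aG : ∀ c n, act c (some false) (some true) (g ⊚ P.pipow x n) = G ∘ₗ X ^ n := fun c n =>
    wordAct_apply (isWordSeq_comp_pipow g) kG n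
  have aB : ∀ c n, act c (some true) none (P.pipow y n ⊚ b) = (Y c ^ n) ∘ₗ B := fun c n =>
    wordAct_apply (isWordSeq_pipow_comp b) (kB c) n
  have aBG : ∀ c n, act c (some false) none ((b ⊚ g) ⊚ P.pipow x n) = (B ∘ₗ G) ∘ₗ X ^ n :=
    fun c n => wordAct_apply (isWordSeq_comp_pipow (b ⊚ g)) kBG n
  have aE : ∀ c e, act c (some true) (some false) e = if e ⊚ g = P.pipow x 2 then E else 0 :=
    fun _ _ => rfl
  have aF : ∀ c f, act c none (some true) f = if b ⊚ f = P.pipow y 2 then F c else 0 :=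
    fun _ _ => rfl
  have eX : ∀ {i j}, P.pipow x i = P.pipow x j → X ^ i = X ^ j :=
    pow_eq_pow_of_pipow_eq fun i h => kX i (h ▸ I.zero_mem _ _)
  have hne_X : ∀ {n} (e : P.Hom z x), e ⊚ g ≠ P.pipow x 2 → e ⊚ g = P.pipow x n → 2 ≤ n → 3 ≤ n := by
    rintro n e h h' hn
    obtain rfl | h3 := hn.eq_or_lt
    · exact (h h').elim
    · exact h3
  have mZG : ∀ m n, P.pipow z m ⊚ g ⊚ P.pipow x n = g ⊚ P.pipow x (l * m + n) := fun m n => by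
    rw [← P.assoc, pipow_comp_comp_pipow hzg, P.assoc, ← pipow_add]
  have eY : ∀ c {i j}, P.pipow y i = P.pipow y j → Y c ^ i = Y c ^ j := fun c =>
    pow_eq_pow_of_pipow_eq fun i h => kY c i (h ▸ I.zero_mem _ _)
  have hne_Y : ∀ {n} (f : P.Hom y z), b ⊚ f ≠ P.pipow y 2 → b ⊚ f = P.pipow y n → 2 ≤ n → 3 ≤ n := by
    rintro n f h h' hn
    obtain rfl | h3 := hn.eq_or_lt
    · exact (h h').elim
    · exact h3
  have mYB : ∀ m n, P.pipow y m ⊚ (b ⊚ g) ⊚ P.pipow x n = (b ⊚ g) ⊚ P.pipow x (m + n) :=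
    fun m n => by
      rw [← P.assoc, pipow_comp_comp_pipow hbg, P.assoc, ← pipow_add, one_mul]
  have lZG : ∀ m n, G ∘ₗ X ^ (l * m + n) = (Z ^ m) ∘ₗ G ∘ₗ X ^ n := by
    rintro (_ | m) n
    · rw [mul_zero, zero_add]; rfl
    · rw [comp_pow_eq_zero GX (by nlinarith), zero_pow m.succ_ne_zero, LinearMap.zero_comp]
  have lYB : ∀ c m n, (B ∘ₗ G) ∘ₗ X ^ (m + n) = (Y c ^ m) ∘ₗ (B ∘ₗ G) ∘ₗ X ^ n := by
    rintro c (_ | m) n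
    · rw [zero_add]; rfl
    · rw [comp_pow_eq_zero BGX (by omega), ← LinearMap.comp_assoc,
        pow_comp_eq_zero (YBG c) (Nat.le_add_left 1 m), LinearMap.zero_comp]
  have lGE : ∀ m (e : P.Hom z x), (G ∘ₗ X ^ m) ∘ₗ (if e ⊚ g = P.pipow x 2 then E else 0) = 0 := by
    intro m e
    split_ifs
    · cases m with
      | zero => exact GE
      | succ m =>
        rw [LinearMap.comp_assoc, pow_comp_eq_zero XE (Nat.le_add_left 1 m), LinearMap.comp_zero]
    · exact LinearMap.comp_zero _
  have X2 : P.pipow x 2 ≠ P.zero x x := fun h => by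
    have := hX 2 (h ▸ I.zero_mem _ _)
    omega
  have Y2 : P.pipow y 2 ≠ P.zero y y := fun h => by
    have := hY 2 (h ▸ I.zero_mem _ _)
    omega
  have neX : ∀ {n}, 3 ≤ n → P.pipow x n ≠ P.pipow x 2 := fun hn h => by
    have := pipow_inj h.symm X2
    omega
  have neY : ∀ {n}, 3 ≤ n → P.pipow y n ≠ P.pipow y 2 := fun hn h => by
    have := pipow_inj h.symm Y2
    omega
  have lXE : ∀ m (f : P.Hom z x), (if (P.pipow x m ⊚ f) ⊚ g = P.pipow x 2 then E else 0) =
      (X ^ m) ∘ₗ if f ⊚ g = P.pipow x 2 then E else 0 := fun m f => by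
    obtain ⟨n, hn, e⟩ := hzx f
    cases m with
    | zero => rw [P.pipow_zero, P.id_comp]; rfl
    | succ m =>
      rw [if_neg]
      · split_ifs
        · exact (pow_comp_eq_zero XE (Nat.le_add_left 1 m)).symm
        · exact (LinearMap.comp_zero _).symm
      · rw [P.assoc, e, ← pipow_add]
        exact neX (by omega)
  have lEZ : ∀ m (h : P.Hom z x), (if (h ⊚ P.pipow z m) ⊚ g = P.pipow x 2 then E else 0) =
      (if h ⊚ g = P.pipow x 2 then E else 0) ∘ₗ Z ^ m := fun m h => by
    obtain ⟨n, hn, e⟩ := hzx h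
    cases m with
    | zero => rw [P.pipow_zero, P.comp_id]; rfl
    | succ m =>
      rw [if_neg, zero_pow m.succ_ne_zero, LinearMap.comp_zero]
      rw [P.assoc, pipow_comp_comp_pipow hzg, ← P.assoc, e, ← pipow_add]
      exact neX (by nlinarith)
  have lZF : ∀ c m (f : P.Hom y z), (if b ⊚ P.pipow z m ⊚ f = P.pipow y 2 then F c else 0) =
      (Z ^ m) ∘ₗ if b ⊚ f = P.pipow y 2 then F c else 0 := fun c m f => by
    obtain ⟨n, hn, e⟩ := hyz' f
    cases m with
    | zero => rw [P.pipow_zero, P.id_comp]; rfl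
    | succ m =>
      rw [if_neg, zero_pow m.succ_ne_zero, LinearMap.zero_comp]
      rw [← P.assoc, comp_pipow_of_comp hbz, P.assoc, e, ← pipow_add]
      exact neY (by nlinarith)
  have lFY : ∀ c m (h : P.Hom y z), (if b ⊚ h ⊚ P.pipow y m = P.pipow y 2 then F c else 0) =
      (if b ⊚ h = P.pipow y 2 then F c else 0) ∘ₗ Y c ^ m := fun c m h => by
    obtain ⟨n, hn, e⟩ := hyz' h
    cases m with
    | zero => rw [P.pipow_zero, P.comp_id]; rfl
    | succ m =>
      rw [if_neg]
      · split_ifs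
        · exact (comp_pow_eq_zero (FY c) (Nat.le_add_left 1 m)).symm
        · exact (LinearMap.zero_comp _).symm
      · rw [← P.assoc, e, ← pipow_add]
        exact neY (by omega)
  refine not_repFin_of_act (d := threePoints x z y) hD
    (fun j => by rcases j with _ | _ | _ <;> assumption) V act
    ?_ ?_ ?_ (some false) (X (X (un 0))) (fun h => ?_) ?_
  · intro c i v
    match i with
    | none => exact LinearMap.congr_fun ((congrArg _ (P.pipow_zero y).symm).trans (aY c 0)) v
    | some false => exact LinearMap.congr_fun ((congrArg _ (P.pipow_zero x).symm).trans (aX c 0)) v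
    | some true => exact LinearMap.congr_fun ((congrArg _ (P.pipow_zero z).symm).trans (aZ c 0)) v
  · intro c i j p h f v
    refine LinearMap.congr_fun (g := act c j p h ∘ₗ act c i j f) ?_ v
    clear v
    have of_eq : ∀ i j p {h f w A A' A''}, h ⊚ f = w → act c i p w = A'' → act c j p h = A →
        act c i j f = A' → A'' = A ∘ₗ A' → act c i p (h ⊚ f) = act c j p h ∘ₗ act c i j f := by
      rintro _ _ _ _ _ _ _ _ _ rfl rfl rfl rfl h
      exact h
    match i, j, p with
    | some false, some false, some false =>
      obtain ⟨m, rfl⟩ := P.endo_cyclic x h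
      obtain ⟨n, rfl⟩ := P.endo_cyclic x f
      exact of_eq (some false) (some false) (some false) (pipow_add ..).symm (aX c (m + n)) (aX c m) (aX c n) (pow_add X m n)
    | some false, some false, some true =>
      obtain ⟨m, rfl⟩ := gen_xz h
      obtain ⟨n, rfl⟩ := P.endo_cyclic x f
      refine of_eq (some false) (some false) (some true) ?_ (aG c (m + n)) (aG c m) (aX c n) ?_
      · exact (P.assoc ..).trans (congrArg (P.comp g) (pipow_add ..).symm)
      · rw [pow_add]; rfl
    | some false, some false, none =>
      obtain ⟨m, rfl⟩ := gen_xy h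
      obtain ⟨n, rfl⟩ := P.endo_cyclic x f
      refine of_eq (some false) (some false) none ?_ (aBG c (m + n)) (aBG c m) (aX c n) ?_
      · exact (P.assoc ..).trans (congrArg (P.comp _) (pipow_add ..).symm)
      · rw [pow_add]; rfl
    | some false, some true, some false =>
      obtain ⟨m, hm, e⟩ := hzx h
      obtain ⟨n, rfl⟩ := gen_xz f
      refine of_eq (some false) (some true) (some false) ?_ (aX c (m + n)) (aE c h) (aG c n) ?_
      · exact (P.assoc ..).symm.trans ((congrArg (P.comp · _) e).trans (pipow_add ..).symm)
      · rw [pow_add]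
        split_ifs with h2
        · rw [eX (e.symm.trans h2), ← LinearMap.comp_assoc, EG]; rfl
        · rw [pow_eq_zero_of_le (hne_X h h2 e hm) X3]; rfl
    | some false, some true, some true =>
      obtain ⟨m, rfl⟩ := P.endo_cyclic z h
      obtain ⟨n, rfl⟩ := gen_xz f
      refine of_eq (some false) (some true) (some true) ?_ (aG c (l * m + n)) (aZ c m) (aG c n) ?_
      · exact mZG m n
      · exact lZG m n
    | some false, some true, none =>
      obtain ⟨m, rfl⟩ := gen_zy h
      obtain ⟨n, rfl⟩ := gen_xz f
      refine of_eq (some false) (some true) none ?_ (aBG c (m + n)) (aB c m) (aG c n) ?_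
      · exact show (P.pipow y m ⊚ b) ⊚ g ⊚ P.pipow x n = (b ⊚ g) ⊚ P.pipow x (m + n) by
          rw [P.assoc, ← P.assoc b, mYB]
      · exact lYB c m n
    | some false, none, some false =>
      obtain rfl := hyx h
      refine of_eq (some false) none (some false) (P.zero_comp f) (wordAct_killed kX (I.zero_mem _ _))
        rfl rfl (LinearMap.zero_comp _).symm
    | some false, none, some true =>
      obtain ⟨n, rfl⟩ := gen_xy f
      obtain ⟨m, e⟩ := endo_of_ne hyz.symm b h
      refine of_eq (some false) none (some true) ?_ (aG c (l * (m + 1) + n)) (aF c h) (aBG c n) ?_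
      · exact (congrArg (P.comp h) (P.assoc b g _)).trans ((P.assoc h b _).symm.trans
          ((congrArg (P.comp · (g ⊚ P.pipow x n)) e).trans (mZG ..)))
      · rw [lZG, zero_pow m.succ_ne_zero]
        split_ifs
        · exact congrArg (fun T => (T ∘ₗ G) ∘ₗ X ^ n) (FB c).symm
        · rfl
    | some false, none, none =>
      obtain ⟨m, rfl⟩ := P.endo_cyclic y h
      obtain ⟨n, rfl⟩ := gen_xy f
      refine of_eq (some false) none none ?_ (aBG c (m + n)) (aY c m) (aBG c n) ?_
      · exact show P.pipow y m ⊚ (b ⊚ g) ⊚ P.pipow x n = (b ⊚ g) ⊚ P.pipow x (m + n) by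
          rw [mYB]
      · exact lYB c m n
    | some true, some false, some false =>
      obtain ⟨m, rfl⟩ := P.endo_cyclic x h
      refine of_eq (some true) (some false) (some false) rfl (aE c _) (aX c m) (aE c f) ?_
      exact lXE m f
    | some true, some false, some true =>
      obtain ⟨m, rfl⟩ := gen_xz h
      obtain ⟨n, e⟩ := endo_of_ne hxz.symm f (g ⊚ P.pipow x m)
      refine of_eq (some true) (some false) (some true) e (aZ c (n + 1)) (aG c m) (aE c f) ?_
      exact (zero_pow n.succ_ne_zero).trans (lGE m f).symm
    | some true, some false, none =>
      obtain ⟨m, rfl⟩ := gen_xy h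
      obtain ⟨n, e⟩ := endo_of_ne hxz.symm f (g ⊚ P.pipow x m)
      refine of_eq (some true) (some false) none ?_ (aB c (k * (n + 1) + 0)) (aBG c m) (aE c f) ?_
      · exact (congrArg (P.comp · f) (P.assoc b g _)).trans ((P.assoc b _ f).trans
          ((congrArg (P.comp b) e).trans (comp_pipow_of_comp hbz _)))
      · exact (pow_comp_eq_zero (YB c) (by nlinarith)).trans
          ((LinearMap.comp_zero B).symm.trans (congrArg (B ∘ₗ ·) (lGE m f).symm))
    | some true, some true, some false =>
      obtain ⟨m, rfl⟩ := P.endo_cyclic z f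
      refine of_eq (some true) (some true) (some false) rfl (aE c _) (aE c h) (aZ c m) ?_
      exact lEZ m h
    | some true, some true, some true =>
      obtain ⟨m, rfl⟩ := P.endo_cyclic z h
      obtain ⟨n, rfl⟩ := P.endo_cyclic z f
      exact of_eq (some true) (some true) (some true) (pipow_add ..).symm (aZ c (m + n)) (aZ c m)
        (aZ c n) (pow_add Z m n)
    | some true, some true, none =>
      obtain ⟨m, rfl⟩ := gen_zy h
      obtain ⟨n, rfl⟩ := P.endo_cyclic z f
      refine of_eq (some true) (some true) none ?_ (aB c (m + k * n)) (aB c m) (aZ c n) ?_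
      · exact show (P.pipow y m ⊚ b) ⊚ P.pipow z n = P.pipow y (m + k * n) ⊚ b by
          rw [P.assoc, comp_pipow_of_comp hbz, pipow_comp_pipow]
      · cases n with
        | zero => rfl
        | succ n =>
          rw [zero_pow n.succ_ne_zero, LinearMap.comp_zero]
          exact pow_comp_eq_zero (YB c) (by nlinarith)
    | some true, none, some false =>
      obtain rfl := hyx h
      refine of_eq (some true) none (some false) (P.zero_comp f) (aE c _) rfl rfl ?_
      rw [if_neg]
      · rfl
      · exact fun h0 => X2 (h0.symm.trans (P.zero_comp g))
    | some true, none, some true =>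
      obtain ⟨n, rfl⟩ := gen_zy f
      obtain ⟨m, e⟩ := endo_of_ne hyz.symm (P.pipow y n ⊚ b) h
      refine of_eq (some true) none (some true) e (aZ c (m + 1)) (aF c h) (aB c n) ?_
      rw [zero_pow m.succ_ne_zero]
      split_ifs
      · cases n with
        | zero => exact (FB c).symm
        | succ n =>
          rw [← LinearMap.comp_assoc, comp_pow_eq_zero (FY c) (Nat.le_add_left 1 n)]; rfl
      · rfl
    | some true, none, none =>
      obtain ⟨m, rfl⟩ := P.endo_cyclic y h
      obtain ⟨n, rfl⟩ := gen_zy f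
      refine of_eq (some true) none none (pipow_comp_pipow ..) (aB c (m + n)) (aY c m) (aB c n) ?_
      rw [pow_add]; rfl
    | none, some false, some false =>
      exact (LinearMap.comp_zero _).symm
    | none, some false, some true =>
      obtain rfl := hyx f
      refine of_eq none (some false) (some true) (P.comp_zero h) (aF c _) rfl rfl ?_
      rw [if_neg]
      · exact (LinearMap.comp_zero _).symm
      · exact fun h0 => Y2 (h0.symm.trans (P.comp_zero b))
    | none, some false, none =>
      obtain rfl := hyx f
      exact of_eq none (some false) none (P.comp_zero h) (wordAct_killed (kY c) (I.zero_mem _ _)) rfl rfl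
        (LinearMap.comp_zero _).symm
    | none, some true, some false =>
      refine of_eq none (some true) (some false) rfl rfl (aE c h) (aF c f) ?_
      split_ifs with h1 h2
      · exact (hef h f h1 h2).elim
      · exact (LinearMap.comp_zero _).symm
      · rfl
      · rfl
    | none, some true, some true =>
      obtain ⟨m, rfl⟩ := P.endo_cyclic z h
      refine of_eq none (some true) (some true) rfl (aF c _) (aZ c m) (aF c f) ?_
      exact lZF c m f
    | none, some true, none =>
      obtain ⟨m, rfl⟩ := gen_zy h
      obtain ⟨n, hn, e⟩ := hyz' f
      refine of_eq none (some true) none ?_ (aY c (m + n)) (aB c m) (aF c f) ?_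
      · exact (P.assoc ..).trans ((congrArg (P.comp _) e).trans (pipow_add ..).symm)
      · rw [pow_add]
        split_ifs with h2
        · rw [eY c (e.symm.trans h2), LinearMap.comp_assoc, BF]; rfl
        · rw [pow_eq_zero_of_le (hne_Y f h2 e hn) (Y3 c)]; exact (mul_zero _).trans (LinearMap.comp_zero _).symm
    | none, none, some false =>
      obtain rfl := hyx h
      exact of_eq none none (some false) (P.zero_comp f) rfl rfl rfl (LinearMap.zero_comp _).symm
    | none, none, some true =>
      obtain ⟨m, rfl⟩ := P.endo_cyclic y f
      refine of_eq none none (some true) rfl (aF c _) (aF c h) (aY c m) ?_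
      exact lFY c m h
    | none, none, none =>
      obtain ⟨m, rfl⟩ := P.endo_cyclic y h
      obtain ⟨n, rfl⟩ := P.endo_cyclic y f
      exact of_eq none none none (pipow_add ..).symm (aY c (m + n)) (aY c m) (aY c n)
        (pow_add (Y c) m n)
  · intro c i j f hI
    match i, j with
    | some false, some false => exact wordAct_killed kX hI
    | some false, some true => exact wordAct_killed kG hI
    | some true, some false => 
      refine (aE c f).trans (if_neg fun h => ?_)
      have := hX 2 (h ▸ I.comp_mem_right _ g hI)
      omega
    | some true, some true => exact wordAct_killed kZ hI
    | some false, none => exact wordAct_killed kBG hI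
    | some true, none => exact wordAct_killed (kB c) hI
    | none, none => exact wordAct_killed (kY c) hI
    | none, some true =>
      refine (aF c f).trans (if_neg fun h => ?_)
      have := hY 2 (h ▸ I.comp_mem_left b _ hI)
      omega
    | none, some false => rfl
  · have := congrFun (show X (X (un 0)) = (0 : Fin 5 → ℚ) from h) 4
    simp [X] at this
  · intro l m hlm φ hφ
    have aX1 : ∀ c, act c (some false) (some false) (P.pipow x 1) = X := fun c =>
      (aX c 1).trans (pow_one X)
    have aY1 : ∀ c, act c none none (P.pipow y 1) = Y c := fun c => (aY c 1).trans (pow_one _)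
    have aG0 : ∀ c, act c (some false) (some true) (g ⊚ P.pipow x 0) = G := fun c => aG c 0
    have aB0 : ∀ c, act c (some true) none (P.pipow y 0 ⊚ b) = B := fun c => aB c 0
    suffices key : ∀ (a : Module.End ℚ (Fin 5 → ℚ)) (d : Module.End ℚ (Fin 4 → ℚ))
        (e : Module.End ℚ (Fin 5 → ℚ)), (∀ v, a (X v) = X (a v)) → (∀ v, d (G v) = G (a v)) →
        (∀ v, e (B v) = B (d v)) → (∀ v, e (Y l v) = Y m (e v)) → a (X (X (un 0))) = 0 by
      have nat : ∀ i j f A A', act l i j f = A → act m i j f = A' →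
          ∀ v, φ j (A v) = A' (φ i v) := by
        rintro i j f _ _ rfl rfl v
        exact hφ i j f v
      exact key (φ (some false)) (φ (some true)) (φ none) (nat (some false) (some false) _ _ _ (aX1 l) (aX1 m))
        (nat (some false) (some true) _ _ _ (aG0 l) (aG0 m)) (nat (some true) none _ _ _ (aB0 l) (aB0 m))
        (nat none none _ _ _ (aY1 l) (aY1 m))
    intro a d e hX hG hB hY
    have e1 : X (X (un 1)) = 0 := by
      ext i; fin_cases i <;> simp [X]
    have e2 : G (X (un 0)) = 0 := by
      ext i; fin_cases i <;> simp [X, G]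
    have e3 : Y l (B (un 0)) = B (G (un 0)) + B (G (un 1)) := by
      ext i; fin_cases i <;> simp [Y, G, B]
    have e4 : Y l (Y l (un 0)) = B (G (un 0)) + l • B (G (un 1)) := by
      ext i; fin_cases i <;> simp [Y, G, B]
    replace e1 := congrArg a e1
    replace e2 := congrArg d e2
    replace e3 := congrArg e e3
    replace e4 := congrArg e e4
    rw [hX, hX, map_zero] at e1
    rw [hG, hX, map_zero] at e2
    rw [hY, hB, map_add, hB, hB, hG, hG] at e3
    rw [hY, hY, map_add, map_smul, hB, hB, hG, hG] at e4
    have h1 := congrFun e1 4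
    have h2 := congrFun e2 3
    have h3 := congrFun e3 3
    have h4 := congrFun e3 4
    have h5 := congrFun e4 3
    have h6 := congrFun e4 4
    simp [X, Y, G, B] at h1 h2 h3 h4 h5 h6
    have h8 : a (un 0) 0 = 0 := by grind
    rw [hX, hX]
    ext i; fin_cases i <;> simp [X, h8]

end CoRep

namespace CoRep

variable {P : RayCategory} {I : RIdeal P}

open Classical in
theorem not_repFin_of_cycle_on {S D : Set P.Obj} (hD : D.Finite) (hS : S ⊆ D)
    (hI : ∀ i j (f : P.Hom i j), I.mem _ _ f → ¬ P.IsIrreducibleOn S f)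
    (hIid : ∀ i, ¬ I.mem _ _ (P.id i)) {a b p : P.Obj} (ha : a ∈ S) (hb : b ∈ S) (hp : p ∈ S)
    (s : P.Hom a b) (hs : P.IsIrreducibleOn S s)
    (hex : ∃ i ∈ S, ∃ f : P.Hom i p, P.IsIrreducibleOn S f ∧ (i ≠ a ∨ p ≠ b))
    (eqs : ∀ u v : P.Obj → ℚ, (∀ i ∈ S, ∀ j ∈ S, ∀ f : P.Hom i j, P.IsIrreducibleOn S f →
      (i ≠ a ∨ j ≠ b) → u i = v j) → u a = v p ∧ v b = v p) : ¬ RepFin P D I.mem := by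
  have : Finite S := hD.subset hS
  have hr : Set.range (Subtype.val : S → P.Obj) = S := Subtype.range_coe
  refine not_repFin_of_cycle (d := (Subtype.val : S → P.Obj)) Subtype.val_injective hD
    (fun j => hS j.2) (by rw [hr]; exact fun i j => hI i j) (fun i => hIid i)
    ⟨⟨a, ha⟩, ⟨b, hb⟩, s⟩ (by rw [hr]; exact hs) ⟨p, hp⟩ ?_ ?_
  · obtain ⟨i, hi, f, hf, hne⟩ := hex
    refine ⟨⟨i, hi⟩, f, by rw [hr]; exact hf, fun h => ?_⟩
    rw [Sigma.mk.injEq] at h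
    obtain ⟨h1, h2⟩ := h
    cases h1
    rw [heq_eq_eq, Sigma.mk.injEq, Subtype.mk.injEq] at h2
    exact hne.elim (fun h => h rfl) fun h => h h2.1
  · rw [hr]
    intro u v h
    have := eqs (fun i => if h : i ∈ S then u ⟨i, h⟩ else 0)
      (fun i => if h : i ∈ S then v ⟨i, h⟩ else 0) fun i hi j hj f hf hne => by
        rw [dif_pos hi, dif_pos hj]
        refine h ⟨i, hi⟩ ⟨j, hj⟩ f hf fun h => ?_
        rw [Sigma.mk.injEq] at h
        obtain ⟨h1, h2⟩ := h
        cases h1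
        rw [heq_eq_eq, Sigma.mk.injEq, Subtype.mk.injEq] at h2
        exact hne.elim (fun h => h rfl) fun h => h h2.1
    simpa only [dif_pos ha, dif_pos hb, dif_pos hp] using this

/-- A cycle of type `Ã₃` of irreducible morphisms between two sources and two targets. -/
theorem not_repFin_of_cycle_four {S D : Set P.Obj} (hD : D.Finite) (hS : S ⊆ D)
    (hI : ∀ i j (f : P.Hom i j), I.mem _ _ f → ¬ P.IsIrreducibleOn S f)
    (hIid : ∀ i, ¬ I.mem _ _ (P.id i)) {a a' b b' : P.Obj} (ha : a ∈ S) (ha' : a' ∈ S)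
    (hb : b ∈ S) (hb' : b' ∈ S) (haa : a ≠ a') (hbb : b ≠ b')
    (h1 : ∃ f : P.Hom a b, P.IsIrreducibleOn S f) (h2 : ∃ f : P.Hom a b', P.IsIrreducibleOn S f)
    (h3 : ∃ f : P.Hom a' b, P.IsIrreducibleOn S f)
    (h4 : ∃ f : P.Hom a' b', P.IsIrreducibleOn S f) : ¬ RepFin P D I.mem := by
  obtain ⟨f1, h1⟩ := h1
  obtain ⟨f2, h2⟩ := h2
  obtain ⟨f3, h3⟩ := h3
  obtain ⟨f4, h4⟩ := h4
  refine not_repFin_of_cycle_on hD hS hI hIid ha hb hb' f1 h1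
    ⟨a, ha, f2, h2, .inr hbb.symm⟩ fun u v h => ⟨h a ha b' hb' f2 h2 (.inr hbb.symm), ?_⟩
  rw [← h a' ha' b hb f3 h3 (.inl haa.symm), h a' ha' b' hb' f4 h4 (.inl haa.symm)]

/-- A cycle of type `Ã₅` of irreducible morphisms between three points. -/
theorem not_repFin_of_cycle_six {x y z : P.Obj} {S D : Set P.Obj} (hD : D.Finite) (hS : S ⊆ D)
    (hI : ∀ i j (f : P.Hom i j), I.mem _ _ f → ¬ P.IsIrreducibleOn S f)
    (hIid : ∀ i, ¬ I.mem _ _ (P.id i)) (hx : x ∈ S) (hy : y ∈ S) (hz : z ∈ S)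
    (hxy : x ≠ y) (hxz : x ≠ z) (h1 : ∃ f : P.Hom x x, P.IsIrreducibleOn S f)
    (h2 : ∃ f : P.Hom x z, P.IsIrreducibleOn S f) (h3 : ∃ f : P.Hom z y, P.IsIrreducibleOn S f)
    (h4 : ∃ f : P.Hom y y, P.IsIrreducibleOn S f) (h5 : ∃ f : P.Hom y z, P.IsIrreducibleOn S f)
    (h6 : ∃ f : P.Hom z x, P.IsIrreducibleOn S f) : ¬ RepFin P D I.mem := by
  obtain ⟨f1, h1⟩ := h1
  obtain ⟨f2, h2⟩ := h2
  obtain ⟨f3, h3⟩ := h3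
  obtain ⟨f4, h4⟩ := h4
  obtain ⟨f5, h5⟩ := h5
  obtain ⟨f6, h6⟩ := h6
  refine not_repFin_of_cycle_on hD hS hI hIid hx hx hz f1 h1
    ⟨x, hx, f2, h2, .inr hxz.symm⟩ fun u v h => ⟨h x hx z hz f2 h2 (.inr hxz.symm), ?_⟩
  rw [← h z hz x hx f6 h6 (.inl hxz.symm), h z hz y hy f3 h3 (.inl hxz.symm),
    ← h y hy y hy f4 h4 (.inl hxy.symm), h y hy z hz f5 h5 (.inl hxy.symm)]

end CoRep

namespace CoRep

variable {P : RayCategory} {I : RIdeal P}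

open Classical in
set_option maxHeartbeats 1600000 in
/-- Three arrows ending in `y`, one of them a loop, define a problem of type `D̃₄`. -/
theorem not_repFin_of_three_arrows {b c y : P.Obj} {D : Set P.Obj} (hD : D.Finite) (hy : y ∈ D)
    (hb : b ∈ D) (hc : c ∈ D) (hby : b ≠ y) (hcy : c ≠ y) (hbc : b ≠ c) {β : P.Hom b y}
    {β' : P.Hom c y} (hβ : P.IsIrreducible β) (hβ' : P.IsIrreducible β')
    (hρ : P.IsIrreducible (P.pipow y 1)) (hid : ∀ i, ¬ I.mem _ _ (P.id i))
    (hIβ : ¬ I.mem _ _ (P.pipow y 1 ⊚ β)) (hIβ' : ¬ I.mem _ _ (P.pipow y 1 ⊚ β'))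
    (hIρ : ¬ I.mem _ _ (P.pipow y 2)) : ¬ RepFin P D I.mem := by
  let Y : Module.End ℚ (Fin 4 → ℚ) := .pi ![0, co 0, 0, co 1]
  have Y3 : Y ^ 3 = 0 := by
    ext i j
    fin_cases j <;> simp [Y, pow_succ]
  let W : ℚ → ℚ → Submodule ℚ (Fin 4 → ℚ) := fun s t =>
    LinearMap.ker (LinearMap.pi ![co 0, s • co 1 - t • co 2] : (Fin 4 → ℚ) →ₗ[ℚ] (Fin 2 → ℚ))
  let Z : Submodule ℚ (Fin 4 → ℚ) :=
    LinearMap.ker (LinearMap.pi ![co 0, co 1, co 2] : (Fin 4 → ℚ) →ₗ[ℚ] (Fin 3 → ℚ))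
  have mW : ∀ s t v, v ∈ W s t ↔ v 0 = 0 ∧ s * v 1 = t * v 2 := fun s t v => by
    simp [W, LinearMap.mem_ker, funext_iff, Fin.forall_fin_two, sub_eq_zero]
  have mZ : ∀ v, v ∈ Z ↔ v 0 = 0 ∧ v 1 = 0 ∧ v 2 = 0 := fun v => by
    simp [Z, LinearMap.mem_ker, funext_iff, Fin.forall_fin_succ]
  have ZW : ∀ s t, Z ≤ W s t := fun s t v hv => by
    rw [mZ] at hv
    rw [mW, hv.1, hv.2.1, hv.2.2]
    simp
  let A : ℚ → ∀ a, P.Hom a y → Submodule ℚ (Fin 4 → ℚ) := fun l a h =>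
    if P.IsId h then ⊤ else if I.mem a y h then ⊥ else
      if a = b ∧ HEq h β then W 1 1 else if a = c ∧ HEq h β' then W l 1 else
        if a = y ∧ HEq h (P.pipow y 1) then W 0 1 else Z
  have A_id : ∀ l a h, P.IsId h → A l a h = ⊤ := fun l a h h0 => if_pos h0
  have A_mem : ∀ l a h, I.mem a y h → A l a h = ⊥ := fun l a h h0 => by
    refine (if_neg fun h1 => ?_).trans (if_pos h0)
    obtain rfl := h1.eq
    exact hid a (isId_self.1 h1 ▸ h0)
  have A_le : ∀ l a h, ¬ I.mem a y h → Z ≤ A l a h := fun l a h h0 => by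
    simp only [A, if_neg h0]
    split_ifs <;> simp [ZW]
  have A_Z : ∀ l a h, ¬ P.IsId h → ¬ P.IsIrreducible h → A l a h ≤ Z := fun l a h h0 h1 => by
    simp only [A, if_neg h0]
    split_ifs with h2 h3 h4 h5
    · exact bot_le
    · obtain ⟨rfl, h3⟩ := h3
      exact (h1 (eq_of_heq h3 ▸ hβ)).elim
    · obtain ⟨rfl, h3⟩ := h4
      exact (h1 (eq_of_heq h3 ▸ hβ')).elim
    · obtain ⟨rfl, h3⟩ := h5
      exact (h1 (eq_of_heq h3 ▸ hρ)).elim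
    · exact le_rfl
  have Iβ : ¬ I.mem _ _ β := fun h => hIβ (I.comp_mem_left _ _ h)
  have Iβ' : ¬ I.mem _ _ β' := fun h => hIβ' (I.comp_mem_left _ _ h)
  have Iρ : ¬ I.mem _ _ (P.pipow y 1) := fun h => hIρ (P.pipow_succ y 1 ▸ I.comp_mem_left _ _ h)
  have A_β : ∀ l, A l b β = W 1 1 := fun l => by
    simp only [A, if_neg hβ.2.1, if_neg Iβ]
    exact if_pos ⟨trivial, HEq.rfl⟩
  have A_β' : ∀ l, A l c β' = W l 1 := fun l => by
    simp only [A, if_neg hβ'.2.1, if_neg Iβ', if_neg (show ¬ (c = b ∧ _) from fun h => hbc h.1.symm)]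
    exact if_pos ⟨trivial, HEq.rfl⟩
  have A_ρ : ∀ l, A l y (P.pipow y 1) = W 0 1 := fun l => by
    simp only [A, if_neg hρ.2.1, if_neg Iρ, if_neg (show ¬ (y = b ∧ _) from fun h => hby h.1.symm),
      if_neg (show ¬ (y = c ∧ _) from fun h => hcy h.1.symm)]
    exact if_pos ⟨trivial, HEq.rfl⟩
  have nil3 : 3 ≤ P.nilp y := by
    by_contra h
    exact hIρ ((pipow_eq_zero (x := y) (n := 2) (by omega)).symm ▸ I.zero_mem _ _)
  have nir : ∀ {a : P.Obj} (f : P.Hom a y), ¬ P.IsId f → ¬ P.IsIrreducible (P.pipow y 1 ⊚ f) :=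
    fun f hf h => (h.2.2 y _ f rfl).elim hρ.2.1 hf
  refine not_repFin_of_subspaces hD hy Y (pow_eq_zero_of_le nil3 Y3) A
    (fun l a a' h f => ?_) (fun l i v => ?_) A_mem (Pi.single 3 1) (by simp) ?_
  · by_cases hh : P.IsId h
    · rw [A_id _ _ _ hh]
      exact le_top
    · by_cases hf : P.IsId f
      · obtain rfl := hf.eq
        rw [isId_self.1 hf, P.comp_id]
      · by_cases hm : I.mem _ _ h
        · rw [A_mem _ _ _ (I.comp_mem_right _ _ hm)]
          exact bot_le
        · exact (A_Z _ _ _ (fun h0 => hh (isId_comp h0).1)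
            fun h0 => (h0.2.2 _ h f rfl).elim hh hf).trans (A_le _ _ _ hm)
  · match i with
    | 0 =>
      rw [P.pipow_zero, A_id _ _ _ (isId_id y)]
      trivial
    | 1 =>
      rw [A_ρ, mW]
      simp [Y]
    | 2 =>
      refine A_le _ _ _ hIρ ?_
      rw [mZ]
      simp [Y, pow_succ]
    | n + 3 =>
      rw [pow_eq_zero_of_le (Nat.le_add_left 3 n) Y3]
      exact Submodule.zero_mem _
  · intro l m hlm F hF hA
    have key : ∀ a ∈ D, a ≠ y → ∀ γ : P.Hom a y, P.IsIrreducible γ →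
        ¬ I.mem _ _ (P.pipow y 1 ⊚ γ) → ∀ w ∈ A l a γ, w 0 = 0 → F w ∈ A m a γ := by
      intro a ha hay γ hγ hI w hw hw0
      have n0 : P.pipow y 1 ⊚ γ ≠ P.zero a y := fun h => hI (h ▸ I.zero_mem _ _)
      have n1 : P.pipow y 1 ⊚ γ ≠ γ := fun h => by
        have := absorb hγ.1 (i := 1) (j := 0) (by rw [P.pipow_zero, P.comp_id, h])
        omega
      have n2 : ∀ h : P.Hom a y, P.pipow y 1 ⊚ h ≠ γ := fun h h1 =>
        nir h (not_isId hay) (h1 ▸ hγ)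
      have Y2 : Y (Y w) = 0 := by
        ext i
        fin_cases i <;> simp [Y, hw0]
      have := hA a ha (fun h => if h = γ then w else if h = P.pipow y 1 ⊚ γ then Y w else 0)
        (fun h => ?_) (fun h => ?_) γ
      · rwa [if_pos rfl] at this
      · rw [if_neg (n2 h)]
        by_cases h2 : h = γ
        · rw [h2, if_pos rfl, if_pos rfl]
        · rw [if_neg fun h1 => h2 (cancelL h1 (h1 ▸ n0)), if_neg h2]
          split_ifs
          · exact Y2.symm
          · exact (map_zero Y).symm
      · split_ifs with h1 h2
        · exact h1 ▸ hw
        · rw [h2]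
          refine A_le _ _ _ hI ?_
          rw [mZ]
          simp [Y, hw0]
        · exact Submodule.zero_mem _
    have kb := key b hb hby β hβ hIβ (![0, 1, 1, 0]) (by rw [A_β, mW]; simp) (by simp)
    have kc := key c hc hcy β' hβ' hIβ' (![0, 1, l, 0]) (by rw [A_β', mW]; simp) (by simp)
    rw [A_β, mW] at kb
    rw [A_β', mW] at kc
    have e1 : Y (un 0) = un 1 := by
      ext i; fin_cases i <;> simp [Y]
    have e2 : Y (un 1) = un 3 := by
      ext i; fin_cases i <;> simp [Y]
    have e3 : Y (un 2) = 0 := by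
      ext i; fin_cases i <;> simp [Y]
    have e4 : (![0, 1, 1, 0] : Fin 4 → ℚ) = un 1 + un 2 := by
      ext i; fin_cases i <;> simp
    have e5 : (![0, 1, l, 0] : Fin 4 → ℚ) = un 1 + l • un 2 := by
      ext i; fin_cases i <;> simp
    rw [e4, map_add] at kb
    rw [e5, map_add, map_smul] at kc
    replace e3 := congrArg F e3
    rw [hF, map_zero] at e3
    have h1 := congrFun e3 1
    have h3 := congrFun e3 3
    change F (un 3) = 0
    rw [← e2, ← e1, hF, hF]
    rw [← e1, hF] at kb kc
    simp [Y] at h1 h3 kb kc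
    have : F (un 0) 0 = 0 := by grind
    ext i
    fin_cases i <;> simp [Y, this]

end CoRep

namespace CoRep

variable {P : RayCategory} {I : RIdeal P}

set_option maxHeartbeats 1600000 in
/-- A loop at `y` of high order together with an arrow `b → y` over which it acts almost freely
define a problem of type `D̃₅`. -/
theorem not_repFin_of_loop_arrow {b y : P.Obj} {D : Set P.Obj} (hD : D.Finite) (hy : y ∈ D)
    (hb : b ∈ D) {β : P.Hom b y} (gen : ∀ h : P.Hom b y, ∃ i, h = P.pipow y i ⊚ β)
    (hyb : ∀ f : P.Hom y b, ∃ n, 3 ≤ n ∧ β ⊚ f = P.pipow y n)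
    (hbb : ∀ f : P.Hom b b, β ⊚ f = β ∨ ∃ n, 2 ≤ n ∧ β ⊚ f = P.pipow y n ⊚ β)
    (hI : ∀ i, I.mem _ _ (P.pipow y i) → 4 ≤ i)
    (hIβ : ∀ i, I.mem _ _ (P.pipow y i ⊚ β) → 3 ≤ i) : ¬ RepFin P D I.mem := by
  let Y : Module.End ℚ (Fin 6 → ℚ) := .pi ![0, co 0, co 1, co 2, 0, co 4]
  have Y4 : Y ^ 4 = 0 := by
    ext i j
    fin_cases j <;> simp [Y, pow_succ]
  let W0 : ℚ → Submodule ℚ (Fin 6 → ℚ) := fun l =>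
    LinearMap.ker (LinearMap.pi ![co 0, co 1 - co 4, co 5 - l • co 2] :
      (Fin 6 → ℚ) →ₗ[ℚ] (Fin 3 → ℚ))
  let W1 : Submodule ℚ (Fin 6 → ℚ) :=
    LinearMap.ker (LinearMap.pi ![co 0, co 1, co 4, co 5 - co 2] :
      (Fin 6 → ℚ) →ₗ[ℚ] (Fin 4 → ℚ))
  let W2 : Submodule ℚ (Fin 6 → ℚ) :=
    LinearMap.ker (LinearMap.pi ![co 0, co 1, co 4, co 5, co 2] :
      (Fin 6 → ℚ) →ₗ[ℚ] (Fin 5 → ℚ))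
  have mW0 : ∀ l v, v ∈ W0 l ↔ v 0 = 0 ∧ v 1 = v 4 ∧ v 5 = l * v 2 := fun l v => by
    simp [W0, LinearMap.mem_ker, funext_iff, Fin.forall_fin_succ, sub_eq_zero]
  have mW1 : ∀ v, v ∈ W1 ↔ v 0 = 0 ∧ v 1 = 0 ∧ v 4 = 0 ∧ v 5 = v 2 := fun v => by
    simp [W1, LinearMap.mem_ker, funext_iff, Fin.forall_fin_succ, sub_eq_zero]
  have mW2 : ∀ v, v ∈ W2 ↔ v 0 = 0 ∧ v 1 = 0 ∧ v 4 = 0 ∧ v 5 = 0 ∧ v 2 = 0 := fun v => by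
    simp [W2, LinearMap.mem_ker, funext_iff, Fin.forall_fin_succ]
  let W : ℚ → ℕ → Submodule ℚ (Fin 6 → ℚ) := fun l n => match n with
    | 0 => W0 l
    | 1 => W1
    | 2 => W2
    | _ => ⊥
  have W3 : ∀ l n, 3 ≤ n → W l n = ⊥ := fun l n hn => by
    obtain ⟨n, rfl⟩ := Nat.exists_eq_add_of_le' hn
    rfl
  have W20 : ∀ l, W2 ≤ W0 l := fun l v hv => by
    rw [mW2] at hv
    rw [mW0]
    obtain ⟨h0, h1, h4, h5, h2⟩ := hv
    simp [h0, h1, h2, h4, h5]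
  have WY : ∀ l v, v ∈ W0 l → ∀ n, (Y ^ n) v ∈ W l n := by
    intro l v hv n
    obtain ⟨h0, h1, h5⟩ := (mW0 l v).1 hv
    match n with
    | 0 => exact hv
    | 1 => exact (mW1 _).2 (by simp [Y, h0, h1])
    | 2 => exact (mW2 _).2 (by simp [Y, pow_succ, h0])
    | n + 3 =>
      have : (Y ^ 3) v = 0 := by
        ext i; fin_cases i <;> simp [Y, pow_succ, h0]
      rw [pow_add, Module.End.mul_apply, this, map_zero]
      exact Submodule.zero_mem _
  have ρ0 : ∀ {i}, P.pipow y i = P.zero y y → Y ^ i = 0 := fun {i} h =>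
    pow_eq_zero_of_le (hI i (h ▸ I.zero_mem _ _)) Y4
  have β0 : ∀ {i}, P.pipow y i ⊚ β = P.zero b y → 3 ≤ i := fun {i} h =>
    hIβ i (h ▸ I.zero_mem _ _)
  have βinj : ∀ {i j}, P.pipow y i ⊚ β = P.pipow y j ⊚ β → i = j ∨ 3 ≤ i ∧ 3 ≤ j :=
    fun {i j} h => by
      by_cases h0 : P.pipow y i ⊚ β = P.zero b y
      · exact .inr ⟨β0 h0, β0 (h ▸ h0)⟩
      · exact .inl (pipow_comp_inj h h0)
  let Ay : P.Hom y y → Submodule ℚ (Fin 6 → ℚ) := fun f =>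
    ⨅ (i : ℕ) (_ : f = P.pipow y i), LinearMap.range (Y ^ i)
  let Ab : ℚ → P.Hom b y → Submodule ℚ (Fin 6 → ℚ) := fun l f =>
    ⨅ (i : ℕ) (_ : f = P.pipow y i ⊚ β), W l i
  have Ay_le : ∀ i f, f = P.pipow y i → Ay f ≤ LinearMap.range (Y ^ i) := fun i f hf =>
    iInf₂_le i hf
  have Ab_le : ∀ l i f, f = P.pipow y i ⊚ β → Ab l f ≤ W l i := fun l i f hf => iInf₂_le i hf
  have mem_Ay : ∀ i v, (Y ^ i) v ∈ Ay (P.pipow y i) := fun i v => by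
    simp only [Ay, Submodule.mem_iInf]
    intro j hj
    by_cases h0 : P.pipow y i = P.zero y y
    · rw [ρ0 h0]
      exact Submodule.zero_mem _
    · rw [pipow_inj hj h0]
      exact ⟨v, rfl⟩
  have mem_Ab : ∀ l v i, v ∈ W0 l → (Y ^ i) v ∈ Ab l (P.pipow y i ⊚ β) := fun l v i hv => by
    simp only [Ab, Submodule.mem_iInf]
    intro j hj
    obtain rfl | ⟨h1, h2⟩ := βinj hj
    · exact WY l v hv i
    · have := WY l v hv i
      rw [W3 l i h1, Submodule.mem_bot] at this
      rw [this]
      exact Submodule.zero_mem _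
  let A : ℚ → ∀ a, P.Hom a y → Submodule ℚ (Fin 6 → ℚ) := fun l a h =>
    (⨆ g : P.Hom y a, Ay (h ⊚ g)) ⊔ ⨆ g : P.Hom b a, Ab l (h ⊚ g)
  have Aβ : ∀ l, A l b β ≤ W0 l := by
    intro l
    refine sup_le (iSup_le fun g => ?_) (iSup_le fun g => ?_)
    · obtain ⟨n, hn, e⟩ := hyb g
      refine (Ay_le n _ e).trans (le_trans ?_ (W20 l))
      rintro _ ⟨v, rfl⟩
      obtain ⟨n, rfl⟩ := Nat.exists_eq_add_of_le hn
      rw [pow_add, Module.End.mul_apply, mW2]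
      simp [Y, pow_succ]
    · obtain e | ⟨n, hn, e⟩ := hbb g
      · exact Ab_le l 0 _ (by rw [e, P.pipow_zero, P.id_comp])
      · refine (Ab_le l n _ e).trans ?_
        obtain rfl | h3 := hn.eq_or_lt
        · exact W20 l
        · rw [W3 l n h3]
          exact bot_le
  have Y4' : Y ^ P.nilp y = 0 := ρ0 (P.pipow_nilp y)
  refine not_repFin_of_subspaces hD hy Y Y4' A
    (fun l a a' h f => ?_) (fun l i v => ?_) (fun l a h hh => ?_) (Pi.single 3 1) (by simp) ?_
  · refine sup_le (iSup_le fun g => ?_) (iSup_le fun g => ?_)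
    · rw [P.assoc]
      exact (le_iSup (fun g => Ay (h ⊚ g)) (f ⊚ g)).trans le_sup_left
    · rw [P.assoc]
      exact (le_iSup (fun g => Ab l (h ⊚ g)) (f ⊚ g)).trans le_sup_right
  · refine Submodule.mem_sup_left (Submodule.mem_iSup_of_mem (P.id y) ?_)
    rw [P.comp_id]
    exact mem_Ay i v
  · refine eq_bot_iff.2 (sup_le (iSup_le fun g => ?_) (iSup_le fun g => ?_))
    · obtain ⟨i, e⟩ := P.endo_cyclic y (h ⊚ g)
      refine (Ay_le i _ e).trans ?_
      rw [pow_eq_zero_of_le (hI i (e ▸ I.comp_mem_right _ _ hh)) Y4, LinearMap.range_zero]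
    · obtain ⟨i, e⟩ := gen (h ⊚ g)
      refine (Ab_le l i _ e).trans ?_
      rw [W3 l i (hIβ i (e ▸ I.comp_mem_right _ _ hh))]
  · intro l m hlm F hF hA
    have key : ∀ w ∈ W0 l, F w ∈ W0 m := by
      intro w hw
      choose c hc using gen
      have hc' : ∀ i h, h = P.pipow y i ⊚ β → (Y ^ (c h)) w = (Y ^ i) w := by
        intro i h hh
        obtain e | ⟨h1, h2⟩ := βinj ((hc h).symm.trans hh)
        · rw [e]
        · have h3 := WY l w hw (c h)
          have h4 := WY l w hw i
          rw [W3 l _ h1, Submodule.mem_bot] at h3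
          rw [W3 l _ h2, Submodule.mem_bot] at h4
          rw [h3, h4]
      have := hA b hb (fun h => (Y ^ (c h)) w) (fun h => ?_) (fun h => ?_) β
      · refine Aβ m ?_
        rwa [hc' 0 β (by rw [P.pipow_zero, P.id_comp])] at this
      · have e : P.pipow y 1 ⊚ h = P.pipow y (c h + 1) ⊚ β := by
          conv_lhs => rw [hc h]
          rw [P.pipow_succ y (c h), P.assoc]
        rw [hc' (c h + 1) _ e, pow_succ']
        rfl
      · refine Submodule.mem_sup_right (Submodule.mem_iSup_of_mem (P.id b) ?_)
        rw [P.comp_id]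
        have e := mem_Ab l w (c h) hw
        rw [← hc h] at e
        exact e
    have k0 := key (![0, 1, 0, 0, 1, 0]) (by rw [mW0]; simp)
    have k1 := key (![0, 0, 1, 0, 0, l]) (by rw [mW0]; simp)
    rw [mW0] at k0 k1
    have e1 : Y (un 0) = un 1 := by
      ext i; fin_cases i <;> simp [Y]
    have e2 : Y (un 1) = un 2 := by
      ext i; fin_cases i <;> simp [Y]
    have e3 : Y (un 2) = un 3 := by
      ext i; fin_cases i <;> simp [Y]
    have e4 : Y (un 4) = un 5 := by
      ext i; fin_cases i <;> simp [Y]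
    have e5 : Y (un 5) = 0 := by
      ext i; fin_cases i <;> simp [Y]
    have e6 : (![0, 1, 0, 0, 1, 0] : Fin 6 → ℚ) = un 1 + un 4 := by
      ext i; fin_cases i <;> simp
    have e7 : (![0, 0, 1, 0, 0, l] : Fin 6 → ℚ) = un 2 + l • un 5 := by
      ext i; fin_cases i <;> simp
    rw [e6, map_add, ← e1, hF] at k0
    rw [e7, map_add, map_smul, ← e2, ← e1, ← e4, hF, hF, hF] at k1
    replace e5 := congrArg F e5
    rw [← e4, hF, hF, map_zero] at e5
    have h2 := congrFun e5 2
    have h3 := congrFun e5 3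
    change F (un 3) = 0
    rw [← e3, ← e2, ← e1, hF, hF, hF]
    simp [Y] at h2 h3 k0 k1
    have : F (un 0) 0 = 0 := by grind
    ext i
    fin_cases i <;> simp [Y, this]

end CoRep

namespace RPath

variable {P : RayCategory} {x y z w t : P.Obj}

theorem isId_toHom {p : RPath P x y} : P.IsId p.toHom ↔ p.length = 0 := by
  refine ⟨fun h => ?_, toHom_of_length_eq_zero⟩
  cases p with
  | nil => rw [length]
  | cons f hf p =>
    rw [toHom] at h
    exact absurd (isId_comp h).1 hf.2.1

theorem points_of_isId {p : RPath P x y} (h : P.IsId p.toHom) : p.points = {x} := by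
  cases p with
  | nil => exact points_nil x
  | cons f hf p =>
    rw [toHom] at h
    exact absurd (isId_comp h).1 hf.2.1

/-- The path `v` is interlaced with the refinements of the nontrivial factorization `g ⊚ h`. -/
def Links (v : RPath P x y) (g : P.Hom z y) (h : P.Hom x z) : Prop :=
  ¬ P.IsId g ∧ ¬ P.IsId h ∧ g ⊚ h ≠ P.zero x y ∧
    ∃ (r : RPath P z y) (s : RPath P x z), r.toHom = g ∧ s.toHom = h ∧ Interlaced v (r.append s)

theorem interlaced_append {r r' : RPath P z y} {s s' : RPath P x z} (hr : r.toHom = r'.toHom)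
    (hs : s.toHom = s'.toHom) (h1 : ¬ P.IsId r.toHom) (h2 : ¬ P.IsId s.toHom)
    (h0 : r.toHom ⊚ s.toHom ≠ P.zero x y) : Interlaced (r.append s) (r'.append s') :=
  .tail (.single (interlaceStep_left (mt isId_toHom.2 h1) hs (ne_zero_right h0)))
    (interlaceStep_right (mt isId_toHom.2 (hs ▸ h2)) hr (ne_zero_left h0))

theorem links_append {r : RPath P z y} {s : RPath P x z} (h1 : ¬ P.IsId r.toHom)
    (h2 : ¬ P.IsId s.toHom) (h0 : r.toHom ⊚ s.toHom ≠ P.zero x y) :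
    Links (r.append s) r.toHom s.toHom :=
  ⟨h1, h2, h0, r, s, rfl, rfl, interlaced_append rfl rfl h1 h2 h0⟩

theorem links_cons {f : P.Hom z y} {hf : P.IsIrreducible f} {s : RPath P x z}
    (h2 : ¬ P.IsId s.toHom) (h0 : f ⊚ s.toHom ≠ P.zero x y) :
    Links (.cons f hf s) f s.toHom := by
  have e : (RPath.cons f hf (.nil z)).toHom = f := by rw [toHom, toHom_nil, P.comp_id]
  have := links_append (r := .cons f hf (.nil z)) (s := s) (e.symm ▸ hf.2.1) h2 (e.symm ▸ h0)
  rwa [append, nil_append, e] at this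

namespace Links

variable {v : RPath P x y}

theorem interlaced {g : P.Hom z y} {h : P.Hom x z} (H : Links v g h) {r : RPath P z y}
    {s : RPath P x z} (hr : r.toHom = g) (hs : s.toHom = h) : Interlaced v (r.append s) := by
  obtain ⟨h1, h2, h0, r', s', rfl, rfl, H⟩ := H
  exact H.trans (interlaced_append hr.symm hs.symm h1 h2 h0)

theorem interlaced_cons {g : P.Hom z y} {h : P.Hom x z} (H : Links v g h)
    (hg : P.IsIrreducible g) {s : RPath P x z} (hs : s.toHom = h) :
    Interlaced v (.cons g hg s) := by
  have := H.interlaced (r := .cons g hg (.nil z)) (by rw [toHom, toHom_nil, P.comp_id]) hs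
  rwa [append, nil_append] at this

theorem right {a : P.Hom z y} {b : P.Hom w z} {c : P.Hom x w} (H : Links v a (b ⊚ c))
    (hc : ¬ P.IsId c) : Links v (a ⊚ b) c := by
  have h0 := H.2.2.1
  obtain ⟨r, hr⟩ := exists_toHom_eq a (ne_zero_left h0)
  obtain ⟨s, hs⟩ := exists_toHom_eq b (ne_zero_left (ne_zero_right h0))
  obtain ⟨t, ht⟩ := exists_toHom_eq c (ne_zero_right (ne_zero_right h0))
  refine ⟨fun h => H.1 (isId_comp h).1, hc, by rwa [P.assoc], r.append s, t,
    by rw [toHom_append, hr, hs], ht, ?_⟩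
  rw [append_assoc]
  exact H.interlaced hr (by rw [toHom_append, hs, ht])

theorem left {a : P.Hom z y} {b : P.Hom w z} {c : P.Hom x w} (H : Links v (a ⊚ b) c)
    (ha : ¬ P.IsId a) : Links v a (b ⊚ c) := by
  have h0 := H.2.2.1
  obtain ⟨r, hr⟩ := exists_toHom_eq a (ne_zero_left (ne_zero_left h0))
  obtain ⟨s, hs⟩ := exists_toHom_eq b (ne_zero_right (ne_zero_left h0))
  obtain ⟨t, ht⟩ := exists_toHom_eq c (ne_zero_right h0)
  refine ⟨ha, fun h => H.2.1 (isId_comp h).2, by rwa [← P.assoc], r, s.append t,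
    hr, by rw [toHom_append, hs, ht], ?_⟩
  rw [← append_assoc]
  exact H.interlaced (by rw [toHom_append, hr, hs]) ht

end Links

end RPath

namespace RayCategory

variable {P : RayCategory} {x y : P.Obj}

/-- A generator of the morphisms between two points is irreducible in the full subcategory
they support. -/
theorem irreducibleOn_pair {a b : P.Obj} (hab : a ≠ b) {f : P.Hom a b} (h0 : f ≠ P.zero a b)
    (gen : (∀ h : P.Hom a b, ∃ i, h = P.pipow b i ⊚ f) ∨
      (∀ h : P.Hom a b, ∃ i, h = f ⊚ P.pipow a i)) : P.IsIrreducibleOn {a, b} f := by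
  have gen' : ∀ h : P.Hom a b, ∃ i j, h = P.pipow b i ⊚ f ⊚ P.pipow a j := by
    intro h
    obtain gen | gen := gen
    · obtain ⟨i, hi⟩ := gen h
      exact ⟨i, 0, by rw [P.pipow_zero, P.comp_id, hi]⟩
    · obtain ⟨i, hi⟩ := gen h
      exact ⟨0, i, by rw [P.pipow_zero, P.id_comp, hi]⟩
  refine ⟨h0, not_isId hab, ?_⟩
  rintro z (rfl | rfl) g h e
  · obtain ⟨i, j, rfl⟩ := gen' g
    obtain ⟨l, rfl⟩ := P.endo_cyclic z h
    have := (absorb h0 (i := i) (j := j + l) (by rw [pipow_add, ← P.assoc f, ← P.assoc, ← e])).2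
    exact .inr (pipow_isId.2 (by omega))
  · obtain ⟨i, j, rfl⟩ := gen' h
    obtain ⟨l, rfl⟩ := P.endo_cyclic z g
    have := (absorb h0 (i := l + i) (j := j) (by rw [pipow_add, P.assoc, ← e])).1
    exact .inl (pipow_isId.2 (by omega))

theorem exists_irreducibleOn_pair {a b : P.Obj} (hab : a ≠ b) {f : P.Hom a b}
    (h0 : f ≠ P.zero a b) : ∃ g : P.Hom a b, P.IsIrreducibleOn {a, b} g := by
  obtain ⟨g, hg⟩ := P.hom_cyclic a b
  refine ⟨g, irreducibleOn_pair hab ?_ hg⟩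
  rintro rfl
  obtain hg | hg := hg <;> obtain ⟨i, hi⟩ := hg f
  · exact h0 (hi.trans (P.comp_zero _))
  · exact h0 (hi.trans (P.zero_comp _))

/-- If a loop factors through a generator of the morphisms to a second point, then the generator
of the radical there factors the other way. -/
theorem loop_irreducibleOn_pair {a b : P.Obj} (hab : a ≠ b) (h0 : P.pipow a 1 ≠ P.zero a a)
    (h : ∀ (f : P.Hom a b) (g : P.Hom b a), g ⊚ f ≠ P.pipow a 1) :
    P.IsIrreducibleOn {a, b} (P.pipow a 1) := by
  refine ⟨h0, fun h => one_ne_zero (pipow_isId.1 h), ?_⟩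
  rintro z (rfl | rfl) g f e
  · obtain ⟨i, rfl⟩ := P.endo_cyclic z g
    obtain ⟨j, rfl⟩ := P.endo_cyclic z f
    rw [← pipow_add] at e
    have := pipow_inj e h0
    rcases i with _ | i
    · exact .inl (pipow_isId.2 rfl)
    · exact .inr (pipow_isId.2 (by omega))
  · exact absurd e.symm (h f g)

/-- The properties of the composite `v` of the paths of a mild contour used below. -/
structure IsMildHom (v : P.Hom x y) : Prop where
  not_id : ¬ P.IsId v
  arrow : P.IsIrreducible (P.pipow y 1)
  comp_ne : P.pipow y 1 ⊚ v ≠ P.zero x y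
  act : ∃ a, 1 ≤ a ∧ v ⊚ P.pipow x 1 = P.pipow y a ⊚ v
  repFin : ∀ D : Set P.Obj, x ∈ D → y ∈ D →
    D ⊆ ProjSupp P (IdealOf P (P.pipow y 1 ⊚ v)) x ∪ InjSupp P (IdealOf P (P.pipow y 1 ⊚ v)) y →
    D.Finite → D.ncard ≤ 4 → RepFin P D (IdealOf P (P.pipow y 1 ⊚ v))

namespace IsMildHom

variable {v : P.Hom x y}

theorem ne_zero (H : IsMildHom v) : v ≠ P.zero x y := ne_zero_right H.comp_ne

theorem irreducible_not_mem (H : IsMildHom v) {S : Set P.Obj} (hy : y ∈ S)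
    {a b : P.Obj} (f : P.Hom a b)
    (hf : (RIdeal.of (P.pipow y 1 ⊚ v)).mem _ _ f) : ¬ P.IsIrreducibleOn S f := by
  obtain ⟨g, h, rfl⟩ := hf
  rintro ⟨-, -, h3⟩
  obtain h3 | h3 := h3 y hy (g ⊚ P.pipow y 1) (v ⊚ h) (by simp only [P.assoc])
  · exact one_ne_zero (pipow_isId.1 (isId_comp h3).2)
  · exact H.not_id (isId_comp h3).1

theorem id_not_mem (H : IsMildHom v) (a : P.Obj) :
    ¬ (RIdeal.of (P.pipow y 1 ⊚ v)).mem _ _ (P.id a) := by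
  rintro ⟨g, h, e⟩
  have := isId_id a
  rw [e] at this
  exact H.not_id (isId_comp (isId_comp (isId_comp this).2).1).2

theorem repFin_pair (H : IsMildHom v) {b c : P.Obj}
    (hb : (∃ f : P.Hom x b, ¬ (RIdeal.of (P.pipow y 1 ⊚ v)).mem _ _ f) ∨
      ∃ f : P.Hom b y, ¬ (RIdeal.of (P.pipow y 1 ⊚ v)).mem _ _ f)
    (hc : (∃ f : P.Hom x c, ¬ (RIdeal.of (P.pipow y 1 ⊚ v)).mem _ _ f) ∨
      ∃ f : P.Hom c y, ¬ (RIdeal.of (P.pipow y 1 ⊚ v)).mem _ _ f) :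
    RepFin P {x, y, b, c} (RIdeal.of (P.pipow y 1 ⊚ v)).mem := by
  have key : ∀ t, ((∃ f : P.Hom x t, ¬ (RIdeal.of (P.pipow y 1 ⊚ v)).mem _ _ f) ∨
      ∃ f : P.Hom t y, ¬ (RIdeal.of (P.pipow y 1 ⊚ v)).mem _ _ f) →
      t ∈ ProjSupp P (IdealOf P (P.pipow y 1 ⊚ v)) x ∪
        InjSupp P (IdealOf P (P.pipow y 1 ⊚ v)) y := by
    rintro t (⟨f, hf⟩ | ⟨f, hf⟩)
    · exact .inl ⟨f, fun h => hf (h ▸ RIdeal.zero_mem _ _ _), hf⟩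
    · exact .inr ⟨f, fun h => hf (h ▸ RIdeal.zero_mem _ _ _), hf⟩
  refine H.repFin _ (by simp) (by simp) ?_ (Set.toFinite _) ?_
  · rintro t (rfl | rfl | rfl | rfl)
    · exact key _ (.inl ⟨_, H.id_not_mem _⟩)
    · exact key _ (.inr ⟨_, H.id_not_mem _⟩)
    · exact key _ hb
    · exact key _ hc
  · refine (Set.ncard_insert_le _ _).trans (Nat.succ_le_succ ?_)
    refine (Set.ncard_insert_le _ _).trans (Nat.succ_le_succ ?_)
    refine (Set.ncard_insert_le _ _).trans (Nat.succ_le_succ ?_)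
    rw [Set.ncard_singleton]

theorem repFin_one (H : IsMildHom v) {b : P.Obj}
    (hb : (∃ f : P.Hom x b, ¬ (RIdeal.of (P.pipow y 1 ⊚ v)).mem _ _ f) ∨
      ∃ f : P.Hom b y, ¬ (RIdeal.of (P.pipow y 1 ⊚ v)).mem _ _ f) :
    RepFin P {x, y, b} (RIdeal.of (P.pipow y 1 ⊚ v)).mem := by
  simpa only [Set.pair_eq_singleton] using H.repFin_pair hb hb

theorem repFin_zero (H : IsMildHom v) : RepFin P {x, y} (RIdeal.of (P.pipow y 1 ⊚ v)).mem := by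
  simpa only [Set.pair_eq_singleton] using H.repFin_one (.inr ⟨_, H.id_not_mem y⟩)

end IsMildHom

end RayCategory

theorem Contour.Mild.isMildHom {P : RayCategory} {x y : P.Obj} {C : Contour P x y} (hM : C.Mild)
    (hT : P.IsTransit C.v.toHom) (hid : ¬ P.IsId C.v.toHom)
    (hρ : P.IsIrreducible (P.pipow y 1)) : IsMildHom C.v.toHom := by
  obtain ⟨g, ⟨i, j, hg⟩, gen⟩ := hT.2
  have hv : C.v.toHom = g := by
    obtain ⟨k, hk⟩ := gen C.v.toHom ⟨0, 0, by rw [P.pipow_zero, P.pipow_zero, P.id_comp, P.comp_id]⟩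
    have := absorb C.nz (i := k + i) (j := j) (by rw [pipow_add, P.assoc, ← hg, ← hk])
    rw [show i = 0 by omega, this.2, P.pipow_zero, P.pipow_zero, P.id_comp, P.comp_id] at hg
    exact hg.symm
  rw [← hv] at gen
  obtain ⟨a, ha⟩ := gen (C.v.toHom ⊚ P.pipow x 1) ⟨0, 1, by rw [P.pipow_zero, P.id_comp]⟩
  have ha1 : 1 ≤ a := by
    by_contra h
    rw [show a = 0 by omega, P.pipow_zero, P.id_comp] at ha
    have := (absorb C.nz (i := 0) (j := 1) (by rw [P.pipow_zero, P.id_comp, ha])).2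
    omega
  have hnd : C.NonDeep := hM.elim (·.1) (·.1)
  have hne : P.pipow y 1 ⊚ C.v.toHom ≠ P.zero x y := by
    intro h
    refine hnd ⟨C.nz, h, ?_⟩
    obtain ⟨b, rfl⟩ := Nat.exists_eq_add_of_le' ha1
    exact ha.trans (by rw [pipow_add, P.assoc, h, P.comp_zero])
  refine ⟨hid, hρ, hne, ⟨a, ha1, ha⟩, ?_⟩
  obtain hM | ⟨-, ⟨-, g', ⟨i', j', hg'⟩, gen'⟩, hM⟩ := hM
  · exact fun D hx hy hD => hM.2.2 D ⟨hx, hy, hD⟩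
  have hv' : C.v.toHom = g' := by
    obtain ⟨k, hk⟩ :=
      gen' C.v.toHom ⟨0, 0, by rw [P.pipow_zero, P.pipow_zero, P.id_comp, P.comp_id]⟩
    have := absorb C.nz (i := i') (j := j' + k)
      (by rw [pipow_add, ← P.assoc C.v.toHom, ← P.assoc, ← hg', ← hk])
    rw [show j' = 0 by omega, this.1, P.pipow_zero, P.pipow_zero, P.id_comp, P.comp_id] at hg'
    exact hg'.symm
  rw [← hv'] at gen'
  obtain ⟨b, hb⟩ := gen' (P.pipow y 1 ⊚ C.v.toHom) ⟨1, 0, by rw [P.pipow_zero, P.comp_id]⟩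
  have key : ∀ n, C.v.toHom ⊚ P.pipow x n = P.pipow y (a * n) ⊚ C.v.toHom := by
    intro n
    induction n with
    | zero => rw [P.pipow_zero, Nat.mul_zero, P.pipow_zero, P.id_comp, P.comp_id]
    | succ n ih =>
      rw [Nat.add_comm, pipow_add, ← P.assoc, ha, P.assoc, ih, pipow_comp_pipow,
        Nat.mul_add, Nat.mul_one]
  rw [key] at hb
  have hab := pipow_comp_inj hb hne
  obtain rfl : a = 1 := Nat.eq_one_of_mul_eq_one_right hab.symm
  have e : C.Ic = IdealOf P (P.pipow y 1 ⊚ C.v.toHom) := by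
    rw [← ha, Contour.Ic, pi]
  intro D hx hy hD
  rw [← e] at hD ⊢
  exact hM D ⟨hx, hy, hD⟩

namespace RayCategory

variable {P : RayCategory} {x y : P.Obj}

/-- The relations of a dumb-bell for the morphism `γ`, together with mildness. -/
structure IsDumbBellHom (γ : P.Hom x y) : Prop where
  mild : IsMildHom (P.pipow y 1 ⊚ γ)
  ne : x ≠ y
  comm : P.pipow y 1 ⊚ γ = γ ⊚ P.pipow x 1
  gen : ∀ h : P.Hom x y, ∃ i, h = γ ⊚ P.pipow x i

namespace IsDumbBellHom

variable {γ : P.Hom x y}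

theorem pipow_comp (H : IsDumbBellHom γ) (i : ℕ) : P.pipow y i ⊚ γ = γ ⊚ P.pipow x i := by
  have := pipow_comp_comp_pipow H.comm i
  rwa [Nat.one_mul] at this

theorem comp_two_ne (H : IsDumbBellHom γ) : γ ⊚ P.pipow x 2 ≠ P.zero x y := by
  have := H.mild.comp_ne
  rwa [pipow_comp_pipow, H.pipow_comp] at this

theorem ne_zero (H : IsDumbBellHom γ) : γ ≠ P.zero x y := ne_zero_left H.comp_two_ne

theorem source_ne_zero (H : IsDumbBellHom γ) : P.pipow x 1 ≠ P.zero x x := by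
  have := ne_zero_right H.comp_two_ne
  rw [pipow_add x 1 1] at this
  exact ne_zero_left this

theorem irreducibleOn_hom (H : IsDumbBellHom γ) : P.IsIrreducibleOn {x, y} γ :=
  irreducibleOn_pair H.ne H.ne_zero (.inr H.gen)

theorem irreducibleOn_source (H : IsDumbBellHom γ) : P.IsIrreducibleOn {x, y} (P.pipow x 1) := by
  refine loop_irreducibleOn_pair H.ne H.source_ne_zero fun f g e => ?_
  obtain ⟨i, rfl⟩ := H.gen f
  have hi : i = 0 := by
    rw [← P.assoc] at e
    obtain ⟨j, hj⟩ := endo_of_ne H.ne γ g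
    rw [hj, ← pipow_add] at e
    have := pipow_inj e.symm H.source_ne_zero
    omega
  subst hi
  rw [P.pipow_zero, P.comp_id] at e
  obtain ⟨m, hm⟩ := P.endo_cyclic y (γ ⊚ g)
  have h1 : P.pipow y 1 ⊚ γ = P.pipow y m ⊚ γ := by rw [H.comm, ← e, ← P.assoc, hm]
  have := pipow_comp_inj h1 H.mild.ne_zero
  subst this
  exact (H.mild.arrow.2.2 _ _ _ hm.symm).elim (not_isId H.ne) (not_isId H.ne.symm)

theorem back_eq_zero (H : IsDumbBellHom γ) (f : P.Hom y x) : f = P.zero y x := by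
  by_contra h0
  obtain ⟨g, hg⟩ := exists_irreducibleOn_pair H.ne.symm h0
  rw [Set.pair_comm] at hg
  exact CoRep.not_repFin_of_cycle_four (Set.toFinite _) subset_rfl
    (fun i j f hf => H.mild.irreducible_not_mem (by simp) f hf) H.mild.id_not_mem
    (by simp) (by simp) (by simp) (by simp) H.ne H.ne
    ⟨_, H.irreducibleOn_source⟩ ⟨_, H.irreducibleOn_hom⟩ ⟨_, hg⟩ ⟨_, H.mild.arrow.on _⟩
    H.mild.repFin_zero

theorem source_mem (H : IsDumbBellHom γ) {i : ℕ}
    (h : (RIdeal.of (P.pipow y 1 ⊚ P.pipow y 1 ⊚ γ)).mem _ _ (P.pipow x i)) : P.nilp x ≤ i := by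
  obtain ⟨g, h, e⟩ := h
  rw [H.back_eq_zero g, P.zero_comp] at e
  exact pipow_eq_zero_iff.1 e

theorem target_mem (H : IsDumbBellHom γ) {i : ℕ}
    (h : (RIdeal.of (P.pipow y 1 ⊚ P.pipow y 1 ⊚ γ)).mem _ _ (P.pipow y i)) : P.nilp y ≤ i := by
  obtain ⟨g, h, e⟩ := h
  rw [H.back_eq_zero h, P.comp_zero, P.comp_zero] at e
  exact pipow_eq_zero_iff.1 e

theorem two_le_of_mem (H : IsDumbBellHom γ) {i : ℕ}
    (h : (RIdeal.of (P.pipow y 1 ⊚ P.pipow y 1 ⊚ γ)).mem _ _ (γ ⊚ P.pipow x i)) : 2 ≤ i := by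
  by_contra hi
  obtain ⟨g, h, e⟩ := h
  obtain ⟨j, rfl⟩ := P.endo_cyclic y g
  obtain ⟨l, rfl⟩ := P.endo_cyclic x h
  have e1 : γ ⊚ P.pipow x i = γ ⊚ P.pipow x (j + 2 + l) := by
    rw [e, pipow_comp_pipow, H.pipow_comp, P.assoc, ← pipow_add, ← P.assoc, H.pipow_comp, P.assoc,
      ← pipow_add]
    congr 2
    omega
  have h0 : γ ⊚ P.pipow x i ≠ P.zero x y := by
    intro h0
    apply H.comp_two_ne
    rw [show 2 = i + (2 - i) by omega, pipow_add, ← P.assoc, h0, P.zero_comp]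
  have := comp_pipow_inj e1 h0
  omega

theorem three_le_source (H : IsDumbBellHom γ) : 3 ≤ P.nilp x := by
  by_contra h
  exact ne_zero_right H.comp_two_ne (pipow_eq_zero (by omega))

theorem three_le_target (H : IsDumbBellHom γ) : 3 ≤ P.nilp y := by
  by_contra h
  have := H.comp_two_ne
  rw [← H.pipow_comp] at this
  exact ne_zero_left this (pipow_eq_zero (by omega))

theorem nilp_source_le (H : IsDumbBellHom γ) : P.nilp x ≤ 5 := by
  by_contra h
  exact CoRep.not_repFin_six_three (Set.toFinite _) (by simp) (by simp) H.gen H.back_eq_zero H.comm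
    (fun i hi => (show 6 ≤ _ by omega).trans (H.source_mem hi))
    (fun i hi => H.three_le_target.trans (H.target_mem hi)) (fun i hi => H.two_le_of_mem hi)
    H.mild.repFin_zero

theorem nilp_target_le (H : IsDumbBellHom γ) : P.nilp y ≤ 5 := by
  by_contra h
  exact CoRep.not_repFin_three_six (Set.toFinite _) (by simp) (by simp) H.gen H.back_eq_zero H.comm
    (fun i hi => H.three_le_source.trans (H.source_mem hi))
    (fun i hi => (show 6 ≤ _ by omega).trans (H.target_mem hi)) (fun i hi => H.two_le_of_mem hi)
    H.mild.repFin_zero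

theorem min_nilp (H : IsDumbBellHom γ) : min (P.nilp x) (P.nilp y) = 3 := by
  refine le_antisymm (le_of_not_gt fun h => ?_) (le_min H.three_le_source H.three_le_target)
  rw [lt_min_iff] at h
  exact CoRep.not_repFin_four_four (Set.toFinite _) (by simp) (by simp) H.gen H.back_eq_zero H.comm
    (fun i hi => (show 4 ≤ _ by omega).trans (H.source_mem hi))
    (fun i hi => (show 4 ≤ _ by omega).trans (H.target_mem hi)) (fun i hi => H.two_le_of_mem hi)
    H.mild.repFin_zero

theorem dumbBellData (H : IsDumbBellHom γ) :
    DumbBellData P x y (P.pipow x 1) γ (P.pipow y 1) (P.nilp x) (P.nilp y) := by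
  have hpow : ∀ (a : P.Obj) n, P.pow (P.pipow a 1) n = P.pipow a n := fun a n => pipow_pow _ n rfl
  have h3 := H.min_nilp
  refine ⟨H.ne, H.irreducibleOn_source, H.irreducibleOn_hom, H.mild.arrow.on _, ?_, H.comm.symm,
    ?_, ?_, ?_, ?_, h3, max_le H.nilp_source_le H.nilp_target_le, ?_, ?_, ?_, ?_, H.back_eq_zero⟩
  · rintro a b (rfl | rfl) (rfl | rfl) f hf
    · exact .inl (heq_of_eq (irreducibleOn_loop (by simp) hf))
    · obtain ⟨i, rfl⟩ := H.gen f
      obtain h | h := hf.2.2 a (by simp) _ _ rfl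
      · exact absurd h (not_isId H.ne)
      · rw [pipow_isId.1 h, P.pipow_zero, P.comp_id]
        exact .inr (.inl HEq.rfl)
    · exact absurd (H.back_eq_zero f) hf.1
    · exact .inr (.inr (heq_of_eq (irreducibleOn_loop (by simp) hf)))
  · rw [hpow, P.pipow_nilp]
  · rw [hpow, P.pipow_nilp]
  · rw [hpow]
    exact P.pipow_nilp_ne x
  · rw [hpow]
    exact P.pipow_nilp_ne y
  · simpa only [hpow] using P.endo_cyclic x
  · simpa only [hpow] using P.endo_cyclic y
  · simpa only [hpow] using fun f => .inr (H.gen f)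
  · intro i hi h0
    rw [hpow] at h0
    apply H.comp_two_ne
    rw [show 2 = i + (2 - i) by omega, pipow_add, ← P.assoc, h0, P.zero_comp]

end IsDumbBellHom

end RayCategory

namespace RayCategory

variable {P : RayCategory} {x y t : P.Obj}

theorem IsIrreducibleOn.insert {S : Set P.Obj} {f : P.Hom x y} (h : P.IsIrreducibleOn S f)
    (ht : ∀ (g : P.Hom t y) (k : P.Hom x t), f = g ⊚ k → P.IsId g ∨ P.IsId k) :
    P.IsIrreducibleOn (insert t S) f :=
  ⟨h.1, h.2.1, fun z hz => hz.elim (fun e => by subst e; exact ht) (h.2.2 z)⟩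

/-- If the generator of the radical at `x` factors through `t`, it is the product of
generators, and the morphisms between `x` and `t` are generated over `t`. -/
theorem exists_loop_factor (hxt : x ≠ t) (h0 : P.pipow x 2 ≠ P.zero x x) {f : P.Hom x t}
    {g : P.Hom t x} (e : g ⊚ f = P.pipow x 1) :
    ∃ (f' : P.Hom x t) (g' : P.Hom t x) (c : ℕ), 1 ≤ c ∧ g' ⊚ f' = P.pipow x 1 ∧
      f' ⊚ g' = P.pipow t c ∧ (∀ h : P.Hom x t, ∃ j, h = P.pipow t j ⊚ f') ∧
      ∀ h : P.Hom t x, ∃ j, h = g' ⊚ P.pipow t j := by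
  have h1 : P.pipow x 1 ≠ P.zero x x := by
    rw [pipow_add x 1 1] at h0
    exact ne_zero_left h0
  obtain ⟨f', hf⟩ := P.hom_cyclic x t
  obtain ⟨g', hg⟩ := P.hom_cyclic t x
  have hfi : ∃ i, f = P.pipow t i ⊚ f' := by
    obtain hf | hf := hf
    · exact hf f
    · obtain ⟨i, rfl⟩ := hf f
      obtain ⟨n, hn⟩ := endo_of_ne hxt f' g
      rw [← P.assoc, hn, ← pipow_add] at e
      have := pipow_inj e.symm h1
      exact ⟨0, by rw [show i = 0 by omega, P.pipow_zero, P.pipow_zero, P.id_comp, P.comp_id]⟩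
  have hgi : ∃ i, g = g' ⊚ P.pipow t i := by
    obtain hg | hg := hg
    · obtain ⟨i, rfl⟩ := hg g
      obtain ⟨n, hn⟩ := endo_of_ne hxt f g'
      rw [P.assoc, hn, ← pipow_add] at e
      have := pipow_inj e.symm h1
      exact ⟨0, by rw [show i = 0 by omega, P.pipow_zero, P.pipow_zero, P.id_comp, P.comp_id]⟩
    · exact hg g
  obtain ⟨i, rfl⟩ := hfi
  obtain ⟨j, rfl⟩ := hgi
  rw [P.assoc, pipow_comp_pipow] at e
  obtain ⟨n, hn⟩ := endo_of_ne hxt f' g'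
  obtain ⟨m, hm⟩ := endo_of_ne hxt.symm g' f'
  obtain ⟨l, hl⟩ := endo_of_ne hxt (P.pipow t ((j + i) + (j + i)) ⊚ f') g'
  have key : P.pipow x 2 = P.pipow x (l + 1 + (n + 1)) := by
    rw [pipow_add x 1 1, pipow_add x (l + 1), ← hn, ← hl, ← e]
    simp only [P.assoc]
    rw [← P.assoc f', hm, ← P.assoc f' g', hm, pipow_comp_pipow, pipow_comp_pipow, pipow_comp_pipow]
    congr 3
    omega
  have hn0 : n = 0 := by
    have := pipow_inj key h0
    omega
  subst hn0
  refine ⟨f', g', m + 1, by omega, hn, hm, fun h => ?_, fun h => ?_⟩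
  · obtain hf | hf := hf
    · exact hf h
    · obtain ⟨i, rfl⟩ := hf h
      exact ⟨(m + 1) * i, CoRep.comp_pipow_of_comp (by rw [← hn, ← P.assoc, hm]) i⟩
  · obtain hg | hg := hg
    · obtain ⟨i, rfl⟩ := hg h
      exact ⟨(m + 1) * i, pipow_comp_comp_pipow (by rw [← hn, P.assoc, hm]) i⟩
    · exact hg h

namespace IsDumbBellHom

variable {β : P.Hom x y}

/-- The loop at the source of a dumb-bell does not factor through a third point. -/
theorem source_loop_no_factor (H : IsDumbBellHom β) (hβ : P.IsIrreducible β) (hxt : x ≠ t)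
    (f : P.Hom x t) (g : P.Hom t x) : g ⊚ f ≠ P.pipow x 1 := by
  intro e
  have h2 : P.pipow x 2 ≠ P.zero x x := ne_zero_right H.comp_two_ne
  obtain ⟨f, g, c, hc, e, efg, hf, hg⟩ := exists_loop_factor hxt h2 e
  have hyt : y ≠ t := by
    rintro rfl
    exact H.source_ne_zero (by rw [← e, H.back_eq_zero g, P.zero_comp])
  have h3 := H.three_le_source
  have h2' : g ⊚ P.pipow t c ⊚ f ≠ P.zero x x := by
    rwa [← efg, P.assoc f, e, ← P.assoc g, e, ← pipow_add]
  have hfI : ¬ (RIdeal.of (P.pipow y 1 ⊚ P.pipow y 1 ⊚ β)).mem _ _ f := by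
    intro h
    have := H.source_mem (i := 1) (e ▸ RIdeal.comp_mem_left _ g f h)
    omega
  have hfin := H.mild.repFin_one (.inl ⟨f, hfI⟩)
  have hf0 : f ≠ P.zero x t := by
    rintro rfl
    exact hfI (RIdeal.zero_mem _ _ _)
  have hback : ∀ k : P.Hom y t, k = P.zero y t := by
    intro k
    by_contra hk
    obtain ⟨k, hk⟩ := exists_irreducibleOn_pair hyt hk
    have hk' : P.IsIrreducibleOn {x, y, t} k := hk.insert fun a b e => by
      rw [H.back_eq_zero b, P.comp_zero] at e
      exact absurd e hk.1
    have hf' : P.IsIrreducibleOn {x, y, t} f := by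
      rw [Set.insert_comm]
      refine (irreducibleOn_pair hxt hf0 (.inl hf)).insert fun a b e' => ?_
      rw [e', ← P.assoc, H.back_eq_zero (g ⊚ a), P.zero_comp] at e
      exact absurd e.symm H.source_ne_zero
    exact CoRep.not_repFin_of_cycle_four (Set.toFinite _) subset_rfl
      (fun i j f hf => H.mild.irreducible_not_mem (by simp) f hf) H.mild.id_not_mem
      (by simp) (by simp) (by simp) (by simp) H.ne hyt.symm
      ⟨_, hf'⟩ ⟨_, hβ.on _⟩ ⟨_, hk'⟩ ⟨_, H.mild.arrow.on _⟩ hfin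
  have hmt : ∀ {a : P.Obj} (h : P.Hom a t),
      (RIdeal.of (P.pipow y 1 ⊚ P.pipow y 1 ⊚ β)).mem _ _ h → h = P.zero a t := by
    rintro a _ ⟨k, h, rfl⟩
    rw [hback k, P.zero_comp]
  have hmx : ∀ {a : P.Obj} (h : P.Hom a x),
      (RIdeal.of (P.pipow y 1 ⊚ P.pipow y 1 ⊚ β)).mem _ _ h → h = P.zero a x := by
    rintro a _ ⟨k, h, rfl⟩
    rw [H.back_eq_zero k, P.zero_comp]
  have hT : ∀ i, (RIdeal.of (P.pipow y 1 ⊚ P.pipow y 1 ⊚ β)).mem _ _ (P.pipow t i) → c < i := by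
    intro i hi
    by_contra h
    apply ne_zero_left (ne_zero_right h2')
    rw [show c = i + (c - i) by omega, pipow_add, hmt _ hi, P.zero_comp]
  by_cases hc2 : 2 ≤ c
  · refine CoRep.not_repFin_of_loop_factor (Set.toFinite _) (by simp) (by simp) hxt hc2 e efg hf hg
      (fun i hi => (H.source_mem hi).trans' (by omega)) (fun i hi => (hT i hi).trans_le' (by omega))
      (fun i hi => ?_) (fun i hi => ?_) hfin
    · by_contra h
      apply ne_zero_right h2'
      rw [show c = c - i + i by omega, pipow_add, P.assoc, hmt _ hi, P.comp_zero]
    · by_contra h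
      apply h2'
      rw [show c = i + (c - i) by omega, pipow_add, P.assoc, ← P.assoc, hmx _ hi, P.zero_comp]
  · obtain rfl : c = 1 := by omega
    have hfx : ∀ i, f ⊚ P.pipow x i = P.pipow t i ⊚ f := fun i => by
      have := CoRep.comp_pipow_of_comp (f := f) (n := 1) (by rw [← e, ← P.assoc, efg]) i
      rwa [Nat.one_mul] at this
    have hgx : ∀ i, P.pipow x i ⊚ g = g ⊚ P.pipow t i := fun i => by
      have := pipow_comp_comp_pipow (f := g) (m := 1) (by rw [← e, P.assoc, efg]) i
      rwa [Nat.one_mul] at this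
    have hβ1 : β ⊚ P.pipow x 1 ≠ P.zero x y := by
      have := H.comp_two_ne
      rw [pipow_add x 1 1, ← P.assoc] at this
      exact ne_zero_left this
    have hty : ∀ h : P.Hom t y, ∃ i, h = β ⊚ P.pipow x i ⊚ g := by
      obtain ⟨κ, hκ⟩ := P.hom_cyclic t y
      obtain ⟨m, hm⟩ := H.gen (κ ⊚ f)
      have key : ∀ i, β ⊚ P.pipow x 1 = β ⊚ P.pipow x (i + m) → i = 0 := by
        intro i hi
        by_contra h0
        have := comp_pipow_inj hi hβ1
        rw [show m = 0 by omega, P.pipow_zero, P.comp_id] at hm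
        exact (hβ.2.2 _ _ _ hm.symm).elim (not_isId hyt.symm) (not_isId hxt)
      obtain hκ | hκ := hκ <;> obtain ⟨i, hi⟩ := hκ (β ⊚ g)
      · have := key i (by rw [← e, ← P.assoc, hi, P.assoc, hm, ← P.assoc, H.pipow_comp, P.assoc,
          ← pipow_add])
        rw [this, P.pipow_zero, P.id_comp] at hi
        intro h
        obtain ⟨j, rfl⟩ := hκ h
        exact ⟨j, by rw [← hi, ← P.assoc, H.pipow_comp, P.assoc]⟩
      · have := key i (by rw [← e, ← P.assoc, hi, P.assoc, ← hfx, ← P.assoc, hm, P.assoc,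
          ← pipow_add, Nat.add_comm])
        rw [this, P.pipow_zero, P.comp_id] at hi
        intro h
        obtain ⟨j, rfl⟩ := hκ h
        exact ⟨j, by rw [← hi, P.assoc, hgx]⟩
    refine CoRep.not_repFin_of_loop_factor_arrow (Set.toFinite _) (by simp) (by simp) (by simp)
      e efg H.comm (fun h => ?_) (fun h => ?_) H.gen hty H.back_eq_zero hback
      (fun i hi => (H.source_mem hi).trans' h3) hT
      (fun i hi => (H.target_mem hi).trans' H.three_le_target)
      (fun i hi => ?_) (fun i hi => ?_) (fun i hi => H.two_le_of_mem hi) (fun i hi => ?_) hfin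
    · obtain ⟨i, rfl⟩ := hf h
      exact ⟨i, (hfx i).symm⟩
    · obtain ⟨i, rfl⟩ := hg h
      exact ⟨i, (hgx i).symm⟩
    · by_contra h
      apply ne_zero_right h2'
      rw [← hfx, show 1 = i + (1 - i) by omega, pipow_add, ← P.assoc, hmt _ hi, P.zero_comp]
    · by_contra h
      apply h2'
      rw [← P.assoc, ← hgx, show 1 = 1 - i + i by omega, pipow_add, P.assoc (P.pipow x (1 - i)),
        hmx _ hi, P.comp_zero, P.zero_comp]
    · by_contra h
      rw [show i = 0 by omega, P.pipow_zero, P.id_comp] at hi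
      have := RIdeal.comp_mem_right _ _ f hi
      rw [P.assoc, e] at this
      have := H.two_le_of_mem this
      omega

end IsDumbBellHom

end RayCategory

namespace RayCategory

namespace IsMildHom

variable {P : RayCategory} {x y b c : P.Obj}

/-- A mild contour whose paths end with the loop at `y` preceded by an arrow `β'`, and with
an arrow `β`, cannot have `β` and `β'` starting at different points. -/
theorem false_of_three_arrows {β : P.Hom b y} {β' : P.Hom c y} {p : P.Hom x c} {q : P.Hom x b}
    (H : IsMildHom (P.pipow y 1 ⊚ β' ⊚ p)) (hβ : P.IsIrreducible β) (hβ' : P.IsIrreducible β')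
    (hby : b ≠ y) (hcy : c ≠ y) (hbc : b ≠ c) (hq : ¬ P.IsId q)
    (e : P.pipow y 1 ⊚ β' ⊚ p = β ⊚ q) : False := by
  have h0 := H.comp_ne
  have hρ : ¬ (RIdeal.of (P.pipow y 1 ⊚ P.pipow y 1 ⊚ β' ⊚ p)).mem _ _ (P.pipow y 2) := by
    rintro ⟨g, h, hm⟩
    obtain ⟨i, rfl⟩ := P.endo_cyclic y g
    obtain ⟨j, hj⟩ := endo_of_ne hcy.symm (p ⊚ h) β'
    have h2 : P.pipow y 2 ≠ P.zero y y := by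
      rw [pipow_comp_pipow] at h0
      exact ne_zero_left h0
    have e1 : P.pipow y 2 = P.pipow y (i + 2 + (j + 1)) := by
      rw [hm, pipow_add, pipow_add, pipow_add y 1 1, ← hj]
      simp only [P.assoc]
    have := pipow_inj e1 h2
    omega
  have hIβ : ¬ (RIdeal.of (P.pipow y 1 ⊚ P.pipow y 1 ⊚ β' ⊚ p)).mem _ _ (P.pipow y 1 ⊚ β) := by
    rintro ⟨g, h, hm⟩
    obtain ⟨i, rfl⟩ := P.endo_cyclic y g
    obtain ⟨j, hj⟩ := P.endo_cyclic b (q ⊚ h)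
    have h2 : P.pipow y 1 ⊚ β ≠ P.zero b y := by
      rw [e, ← P.assoc] at h0
      exact ne_zero_left h0
    have := (absorb h2 (i := i) (j := j) (by
      conv_rhs => rw [hm, e]
      rw [← hj]
      simp only [P.assoc])).2
    subst this
    rw [P.pipow_zero] at hj
    have hi := isId_id b
    rw [← hj] at hi
    exact hq (isId_comp hi).1
  have hIβ' : ¬ (RIdeal.of (P.pipow y 1 ⊚ P.pipow y 1 ⊚ β' ⊚ p)).mem _ _ (P.pipow y 1 ⊚ β') := by
    rintro ⟨g, h, hm⟩
    obtain ⟨i, rfl⟩ := P.endo_cyclic y g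
    obtain ⟨j, hj⟩ := P.endo_cyclic c (p ⊚ h)
    have h2 : P.pipow y 1 ⊚ β' ≠ P.zero c y := by
      have := H.ne_zero
      rw [← P.assoc] at this
      exact ne_zero_left this
    have := (absorb h2 (i := i + 1) (j := j) (by
      conv_rhs => rw [hm]
      rw [← hj, pipow_add]
      simp only [P.assoc])).1
    omega
  exact CoRep.not_repFin_of_three_arrows (Set.toFinite _) (by simp) (by simp) (by simp) hby hcy hbc
    hβ hβ' H.arrow H.id_not_mem hIβ hIβ' hρ (H.repFin_pair (.inr ⟨_, hIβ⟩) (.inr ⟨_, hIβ'⟩))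

end IsMildHom

end RayCategory

namespace RayCategory

variable {P : RayCategory} {x y b : P.Obj}

/-- An arrow between different points generates the morphisms between them. -/
theorem IsIrreducible.gen {β : P.Hom b y} (hβ : P.IsIrreducible β) (hby : b ≠ y) :
    (∀ h : P.Hom b y, ∃ i, h = P.pipow y i ⊚ β) ∨ ∀ h : P.Hom b y, ∃ i, h = β ⊚ P.pipow b i := by
  obtain ⟨g, hg⟩ := P.hom_cyclic b y
  suffices β = g by rwa [this]
  obtain hg | hg := hg <;> obtain ⟨i, hi⟩ := hg β
  · obtain h | h := hβ.2.2 _ _ _ hi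
    · rwa [pipow_isId.1 h, P.pipow_zero, P.id_comp] at hi
    · exact absurd h (not_isId hby)
  · obtain h | h := hβ.2.2 _ _ _ hi
    · exact absurd h (not_isId hby)
    · rwa [pipow_isId.1 h, P.pipow_zero, P.comp_id] at hi

theorem ne_zero_of_card_eq (e : Nat.card (P.Hom b y) = Nat.card (P.Hom y y)) (F : ℕ → P.Hom b y)
    (hF : ∀ h, ∃ i, h = F i) (hz : ∀ i j, F i = P.zero b y → F (i + j) = P.zero b y) {i : ℕ}
    (hi : i < P.nilp y) : F i ≠ P.zero b y := by
  intro h0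
  have h1 : Nat.card (P.Hom b y) ≤ i + 1 := by
    have : Function.Surjective fun j : Fin (i + 1) => F j := by
      intro h
      obtain ⟨j, rfl⟩ := hF h
      obtain hj | hj := Nat.lt_or_ge j (i + 1)
      · exact ⟨⟨j, hj⟩, rfl⟩
      · obtain ⟨l, rfl⟩ := Nat.exists_eq_add_of_le (show i ≤ j by omega)
        exact ⟨⟨i, by omega⟩, h0.trans (hz i l h0).symm⟩
    simpa using Nat.card_le_card_of_surjective _ this
  have h2 : P.nilp y + 1 ≤ Nat.card (P.Hom y y) := by
    have : Function.Injective fun j : Fin (P.nilp y + 1) => P.pipow y j := by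
      rintro ⟨j, hj⟩ ⟨l, hl⟩ h
      have key : P.pipow y j = P.pipow y l := h
      have : j = l := by
        by_cases h0 : P.pipow y j = P.zero y y
        · have h1 := pipow_eq_zero_iff.1 h0
          have h2 := pipow_eq_zero_iff.1 (key ▸ h0)
          omega
        · exact pipow_inj key h0
      simpa using this
    simpa using Nat.card_le_card_of_injective _ this
  omega

/-- The loop at the source of an arrow `β` satisfying `π(y)β = βπ(b)ᵐ`. -/
theorem IsIrreducible.irreducibleOn_source {β : P.Hom b y} (hρ : P.IsIrreducible (P.pipow y 1))
    (hby : b ≠ y) (gen : ∀ h : P.Hom b y, ∃ i, h = β ⊚ P.pipow b i) {m : ℕ}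
    (hm : P.pipow y 1 ⊚ β = β ⊚ P.pipow b m) (h0 : β ⊚ P.pipow b 1 ≠ P.zero b y) :
    P.IsIrreducibleOn {b, y} (P.pipow b 1) := by
  have h1 := ne_zero_right h0
  refine loop_irreducibleOn_pair hby h1 fun f g e => ?_
  obtain ⟨i, rfl⟩ := gen f
  rw [← P.assoc] at e
  obtain ⟨j, hj⟩ := endo_of_ne hby β g
  rw [hj, ← pipow_add] at e
  have hi := pipow_inj e.symm h1
  rw [show j + 1 = 1 by omega] at hj
  obtain ⟨l, hl⟩ := endo_of_ne hby.symm g β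
  have := comp_pipow_inj (i := 1) (j := m * (l + 1)) (by
    rw [← pipow_comp_comp_pipow hm, ← hj, ← P.assoc, hl]) h0
  have hl1 := Nat.eq_one_of_mul_eq_one_left this.symm
  rw [hl1] at hl
  exact (hρ.2.2 _ _ _ hl.symm).elim (not_isId hby) (not_isId hby.symm)

namespace IsMildHom

variable {β : P.Hom b y} {p : P.Hom x y} {q : P.Hom x b}

theorem four_le_nilp (H : IsMildHom (P.pipow y 1 ⊚ P.pipow y 1 ⊚ p)) : 4 ≤ P.nilp y := by
  by_contra h
  refine H.comp_ne ?_
  rw [pipow_comp_pipow, pipow_comp_pipow, pipow_eq_zero (by omega), P.zero_comp]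

theorem not_mem_arrow {v : P.Hom x y} (H : IsMildHom v) (hβ : P.IsIrreducible β) :
    ¬ (RIdeal.of (P.pipow y 1 ⊚ v)).mem _ _ β :=
  fun h => H.irreducible_not_mem (Set.mem_univ y) β h (hβ.on _)

theorem false_of_comp_pipow (H : IsMildHom (P.pipow y 1 ⊚ P.pipow y 1 ⊚ p))
    (hβ : P.IsIrreducible β) (hby : b ≠ y) (e : P.pipow y 1 ⊚ P.pipow y 1 ⊚ p = β ⊚ q)
    (gen : ∀ h : P.Hom b y, ∃ i, h = β ⊚ P.pipow b i)
    (hc : ∀ i < P.nilp y, β ⊚ P.pipow b i ≠ P.zero b y) : False := by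
  have h4 := H.four_le_nilp
  obtain ⟨m, hm⟩ := gen (P.pipow y 1 ⊚ β)
  have hm1 : 1 ≤ m := by
    by_contra h
    rw [show m = 0 by omega, P.pipow_zero, P.comp_id] at hm
    have := (absorb hβ.1 (i := 1) (j := 0) (by rw [P.pipow_zero, P.comp_id, hm])).1
    omega
  have hσ := IsIrreducible.irreducibleOn_source H.arrow hby gen hm (hc 1 (by omega))
  have hfin := H.repFin_one (.inr ⟨β, H.not_mem_arrow hβ⟩)
  have hyb : ∀ f : P.Hom y b, f = P.zero y b := by
    intro f
    by_contra h0
    obtain ⟨g, hg⟩ := exists_irreducibleOn_pair hby.symm h0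
    rw [Set.pair_comm] at hg
    refine CoRep.not_repFin_of_cycle_four (S := {b, y}) (Set.toFinite _) ?_
      (fun i j f hf => H.irreducible_not_mem (by simp) f hf) H.id_not_mem
      (by simp) (by simp) (by simp) (by simp) hby hby
      ⟨_, hσ⟩ ⟨_, hβ.on _⟩ ⟨_, hg⟩ ⟨_, H.arrow.on _⟩ hfin
    rintro t (rfl | rfl) <;> simp
  have hX : ∀ i, (RIdeal.of (P.pipow y 1 ⊚ P.pipow y 1 ⊚ P.pipow y 1 ⊚ p)).mem _ _
      (P.pipow b i) → 4 ≤ i := by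
    rintro i ⟨g, h, hi⟩
    rw [hyb g, P.zero_comp] at hi
    by_contra h
    refine hc 3 (by omega) ?_
    rw [pipow_eq_zero ((pipow_eq_zero_iff.1 hi).trans (by omega)), P.comp_zero]
  have hY : ∀ i, (RIdeal.of (P.pipow y 1 ⊚ P.pipow y 1 ⊚ P.pipow y 1 ⊚ p)).mem _ _
      (P.pipow y i) → 4 ≤ i := by
    rintro i ⟨g, h, hi⟩
    rw [e, P.assoc, P.assoc, hyb (q ⊚ h), P.comp_zero, P.comp_zero, P.comp_zero] at hi
    exact h4.trans (pipow_eq_zero_iff.1 hi)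
  have hB : ∀ i, (RIdeal.of (P.pipow y 1 ⊚ P.pipow y 1 ⊚ P.pipow y 1 ⊚ p)).mem _ _
      (β ⊚ P.pipow b i) → 3 ≤ i := by
    rintro i ⟨g, h, hi⟩
    by_contra h3
    obtain ⟨j, rfl⟩ := P.endo_cyclic y g
    obtain ⟨l, hl⟩ := gen (p ⊚ h)
    have e1 : β ⊚ P.pipow b i = β ⊚ P.pipow b (m * (j + (1 + (1 + 1))) + l) := by
      rw [hi]
      simp only [P.assoc]
      rw [hl, pipow_comp_pipow, pipow_comp_pipow, pipow_comp_pipow, ← P.assoc,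
        pipow_comp_comp_pipow hm, P.assoc, ← pipow_add]
    have := comp_pipow_inj e1 (hc i (by omega))
    nlinarith
  obtain hm1 | hm2 := hm1.eq_or_lt
  · subst hm1
    exact CoRep.not_repFin_four_four (Set.toFinite _) (by simp) (by simp) gen hyb hm hX hY
      (fun i hi => (show 2 ≤ 3 by omega).trans (hB i hi)) hfin
  · exact CoRep.not_repFin_of_two_le (Set.toFinite _) (by simp) (by simp) gen hyb hm2 hm hX
      (fun i hi => (show 2 ≤ 4 by omega).trans (hY i hi)) hB hfin

/-- A mild contour whose paths end with the loop at `y` preceded by itself, and with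
an arrow `β`: the sets `P(b,y)` and `P(y,y)` have different cardinalities. -/
theorem false_of_loop_loop (H : IsMildHom (P.pipow y 1 ⊚ P.pipow y 1 ⊚ p))
    (hβ : P.IsIrreducible β) (hby : b ≠ y) (e : P.pipow y 1 ⊚ P.pipow y 1 ⊚ p = β ⊚ q)
    (hc : Nat.card (P.Hom b y) = Nat.card (P.Hom y y)) : False := by
  have h4 := H.four_le_nilp
  obtain gen | gen := hβ.gen hby
  swap
  · exact H.false_of_comp_pipow hβ hby e gen fun i hi => ne_zero_of_card_eq hc
      (fun i => β ⊚ P.pipow b i) gen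
      (fun i j h => by rw [pipow_add, ← P.assoc, h, P.zero_comp]) hi
  have hne : ∀ i < P.nilp y, P.pipow y i ⊚ β ≠ P.zero b y := fun i hi => ne_zero_of_card_eq hc
    (fun i => P.pipow y i ⊚ β) gen
    (fun i j h => by rw [Nat.add_comm, pipow_add, P.assoc, h, P.comp_zero]) hi
  obtain ⟨k, hk⟩ := gen (β ⊚ P.pipow b 1)
  have hk' := CoRep.comp_pipow_of_comp hk
  by_cases hk1 : k = 1
  · subst hk1
    simp only [Nat.one_mul] at hk'
    refine H.false_of_comp_pipow hβ hby e (fun h => ?_) fun i hi => by rw [hk']; exact hne i hi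
    obtain ⟨i, rfl⟩ := gen h
    exact ⟨i, (hk' i).symm⟩
  have hk2 : 2 ≤ k := by
    by_contra h
    rw [show k = 0 by omega, P.pipow_zero, P.id_comp] at hk
    have := (absorb hβ.1 (i := 0) (j := 1) (by rw [P.pipow_zero, P.id_comp, hk])).2
    omega
  have hyb : ∀ (f : P.Hom y b) n, β ⊚ f = P.pipow y n → P.nilp y ≤ n + 1 := by
    intro f n hf
    by_contra hn
    obtain ⟨c, hc⟩ := P.endo_cyclic b (f ⊚ β)
    obtain ⟨a, ha⟩ := P.endo_cyclic b (f ⊚ P.pipow y 1 ⊚ β)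
    have h1 := pipow_comp_inj (i := n) (j := k * c) (by
      rw [← hk', ← hc, ← P.assoc, hf]) (hne n (by omega))
    have h2 := pipow_comp_inj (i := n + 1) (j := k * a) (by
      rw [← hk', ← ha, ← P.assoc, hf, pipow_comp_pipow]) (hne _ (by omega))
    have h3 : k ∣ 1 := (Nat.dvd_add_right ⟨c, h1⟩).1 ⟨a, h2⟩
    have := Nat.le_of_dvd one_pos h3
    omega
  have hxy : x ≠ y := by
    rintro rfl
    obtain ⟨i, rfl⟩ := P.endo_cyclic _ p
    have h0 := H.comp_ne
    rw [← pipow_add, ← pipow_add] at e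
    rw [← pipow_add, ← pipow_add, ← pipow_add, Ne, pipow_eq_zero_iff] at h0
    have := hyb q _ e.symm
    omega
  refine CoRep.not_repFin_of_loop_arrow (Set.toFinite _) (by simp) (by simp) gen ?_ ?_ ?_ ?_
    (H.repFin_one (.inr ⟨β, H.not_mem_arrow hβ⟩))
  · intro f
    obtain ⟨n, hn⟩ := P.endo_cyclic y (β ⊚ f)
    have := hyb f n hn
    exact ⟨n, by omega, hn⟩
  · intro f
    obtain ⟨i, rfl⟩ := P.endo_cyclic b f
    obtain rfl | hi := Nat.eq_zero_or_pos i
    · exact .inl (by rw [P.pipow_zero, P.comp_id])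
    · exact .inr ⟨k * i, by nlinarith, hk' i⟩
  · rintro i ⟨g, h, hi⟩
    by_contra h3
    obtain ⟨j, rfl⟩ := P.endo_cyclic y g
    obtain ⟨l, hl⟩ := endo_of_ne hxy.symm h p
    have e1 : P.pipow y i = P.pipow y (j + (1 + (1 + (1 + (l + 1))))) := by
      rw [hi]
      simp only [P.assoc]
      rw [hl]
      simp only [pipow_add]
    have := pipow_inj e1 (pipow_ne_zero (by omega))
    omega
  · rintro i ⟨g, h, hi⟩
    by_contra h3
    obtain ⟨j, rfl⟩ := P.endo_cyclic y g
    obtain ⟨l, hl⟩ := gen (p ⊚ h)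
    have e1 : P.pipow y i ⊚ β = P.pipow y (j + (1 + (1 + (1 + l)))) ⊚ β := by
      rw [hi]
      simp only [P.assoc]
      rw [hl, pipow_comp_pipow, pipow_comp_pipow, pipow_comp_pipow, pipow_comp_pipow]
      simp only [Nat.add_assoc]
    have := pipow_comp_inj e1 (hne i (by omega))
    omega

end IsMildHom

end RayCategory

namespace RayCategory

variable {P : RayCategory} {x y z : P.Obj}

namespace IsDumbBellHom

/-- The morphism of a dumb-bell does not factor through an arrow `β` generating `P(z,y)`
over `y` and a morphism generating `P(x,z)` over `x`. -/
theorem false_of_factor {β : P.Hom z y} {g : P.Hom x z} (H : IsDumbBellHom (β ⊚ g))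
    (hβ : P.IsIrreducible β) (hxz : x ≠ z) (hyz : y ≠ z) {k l : ℕ} (hk : 2 ≤ k) (hl : 2 ≤ l)
    (hzg : P.pipow z 1 ⊚ g = g ⊚ P.pipow x l) (hbz : β ⊚ P.pipow z 1 = P.pipow y k ⊚ β)
    (gen_xz : ∀ h : P.Hom x z, ∃ i, h = g ⊚ P.pipow x i)
    (gen_zy : ∀ h : P.Hom z y, ∃ i, h = P.pipow y i ⊚ β) : False := by
  have hbz' := CoRep.comp_pipow_of_comp hbz
  have hzg' := pipow_comp_comp_pipow hzg
  have hX2 : P.pipow x 2 ≠ P.zero x x := pipow_ne_zero H.three_le_source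
  have hY2 : P.pipow y 2 ≠ P.zero y y := pipow_ne_zero H.three_le_target
  have hG2 : g ⊚ P.pipow x 2 ≠ P.zero x z := ne_zero_right (by rw [← P.assoc]; exact H.comp_two_ne)
  have hB2 : P.pipow y 2 ⊚ β ≠ P.zero z y := by
    have := H.comp_two_ne
    rw [← H.pipow_comp, ← P.assoc] at this
    exact ne_zero_left this
  have hB : ∀ i < 3, P.pipow y i ⊚ β ≠ P.zero z y := by
    intro i hi h0
    apply hB2
    rw [show 2 = (2 - i) + i by omega, pipow_add, P.assoc, h0, P.comp_zero]
  have hG : ∀ i < 3, g ⊚ P.pipow x i ≠ P.zero x z := by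
    intro i hi h0
    apply hG2
    rw [show 2 = i + (2 - i) by omega, pipow_add, ← P.assoc, h0, P.zero_comp]
  have hzx : ∀ e : P.Hom z x, ∃ n, 2 ≤ n ∧ e ⊚ g = P.pipow x n := by
    intro e
    obtain ⟨n, hn⟩ := endo_of_ne hxz g e
    refine ⟨n + 1, ?_, hn⟩
    by_contra h
    obtain ⟨m, hm⟩ := P.endo_cyclic z (g ⊚ e)
    have := pipow_comp_inj (i := 1) (j := k * m) (f := β ⊚ g) (by
      rw [H.comm, ← P.assoc (P.pipow y (k * m)), ← hbz', P.assoc, P.assoc, ← hm, P.assoc, hn,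
        show n + 1 = 1 by omega]) H.mild.ne_zero
    have := Nat.eq_one_of_mul_eq_one_right this.symm
    omega
  have hyz' : ∀ f : P.Hom y z, ∃ n, 2 ≤ n ∧ β ⊚ f = P.pipow y n := by
    intro f
    obtain ⟨n, hn⟩ := endo_of_ne hyz f β
    refine ⟨n + 1, ?_, hn⟩
    by_contra h
    rw [show n + 1 = 1 by omega] at hn
    exact (H.mild.arrow.2.2 _ _ _ hn.symm).elim (not_isId hyz.symm) (not_isId hyz)
  have hrep := H.mild.repFin_one (.inr ⟨β, H.mild.not_mem_arrow hβ⟩)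
  refine CoRep.not_repFin_of_two_loops (Set.toFinite _) (by simp) (by simp) (by simp) hxz hyz hk hl
    H.comm hzg hbz gen_xz gen_zy H.gen H.back_eq_zero hzx hyz' ?_
    (fun i hi => H.three_le_source.trans (H.source_mem hi)) ?_
    (fun i hi => H.three_le_target.trans (H.target_mem hi)) ?_ ?_
    (fun i hi => (show 1 ≤ 2 by omega).trans (H.two_le_of_mem hi)) hrep
  · intro e f he hf
    refine CoRep.not_repFin_of_cycle_six (S := {z, x, y}) (x := x) (y := y) (z := z)
      (Set.toFinite _) ?_ (fun i j f hf => H.mild.irreducible_not_mem (by simp) f hf)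
      H.mild.id_not_mem (by simp) (by simp) (by simp) H.ne hxz
      ⟨P.pipow x 1, H.irreducibleOn_source.insert fun g' f' e' => ?_⟩ ⟨g, ?_⟩ ⟨β, hβ.on _⟩
      ⟨P.pipow y 1, H.mild.arrow.on _⟩ ⟨f, ?_, not_isId hyz, ?_⟩ ⟨e, ?_, not_isId hxz.symm, ?_⟩ hrep
    · rintro t (rfl | rfl | rfl) <;> simp
    · obtain ⟨i, rfl⟩ := gen_xz f'
      obtain ⟨n, hn2, hn⟩ := hzx g'
      rw [← P.assoc, hn, ← pipow_add] at e'
      have := pipow_inj e' H.source_ne_zero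
      omega
    · have := (irreducibleOn_pair hxz (ne_zero_left hG2) (.inr gen_xz)).insert (t := y)
        fun g' f' e' => by
          obtain ⟨i, rfl⟩ := H.gen f'
          obtain ⟨j, hj⟩ := endo_of_ne hyz.symm β g'
          have := (absorb (ne_zero_left hG2) (i := j + 1) (j := i) (by
            conv_rhs => rw [e']
            rw [← hj]
            simp only [P.assoc])).1
          omega
      exact this.mono (by rintro t (rfl | rfl | rfl) <;> simp)
    · rintro rfl
      exact hY2 (hf.symm.trans (P.comp_zero _))
    · rintro t (rfl | rfl | rfl) g' f' e'
      · obtain ⟨i, rfl⟩ := P.endo_cyclic _ g'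
        obtain ⟨n, hn2, hn⟩ := hyz' f'
        rw [e', ← P.assoc, hbz', P.assoc, hn, ← pipow_add] at hf
        have := pipow_inj hf.symm hY2
        obtain rfl | hi := Nat.eq_zero_or_pos i
        · exact .inl (pipow_isId.2 rfl)
        · have := Nat.mul_pos (show 0 < k by omega) hi
          omega
      · rw [H.back_eq_zero f', P.comp_zero] at e'
        exact absurd (hf.symm.trans (by rw [e', P.comp_zero])) hY2
      · obtain ⟨i, rfl⟩ := P.endo_cyclic _ f'
        obtain ⟨n, hn2, hn⟩ := hyz' g'
        rw [e', ← P.assoc, hn, ← pipow_add] at hf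
        have := pipow_inj hf.symm hY2
        exact .inr (pipow_isId.2 (by omega))
    · rintro rfl
      exact hX2 (he.symm.trans (P.zero_comp _))
    · rintro t (rfl | rfl | rfl) g' f' e'
      · obtain ⟨i, rfl⟩ := P.endo_cyclic _ f'
        obtain ⟨n, hn2, hn⟩ := hzx g'
        rw [e', P.assoc, hzg', ← P.assoc, hn, ← pipow_add] at he
        have := pipow_inj he.symm hX2
        obtain rfl | hi := Nat.eq_zero_or_pos i
        · exact .inr (pipow_isId.2 rfl)
        · have := Nat.mul_pos (show 0 < l by omega) hi
          omega
      · obtain ⟨i, rfl⟩ := P.endo_cyclic _ g'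
        obtain ⟨n, hn2, hn⟩ := hzx f'
        rw [e', P.assoc, hn, ← pipow_add] at he
        have := pipow_inj he.symm hX2
        exact .inl (pipow_isId.2 (by omega))
      · rw [H.back_eq_zero g', P.zero_comp] at e'
        exact absurd (he.symm.trans (by rw [e', P.zero_comp])) hX2
  · intro i hi
    by_contra h
    rw [show i = 0 by omega, P.pipow_zero] at hi
    exact H.mild.id_not_mem _ hi
  · rintro i ⟨f, h, e⟩
    by_contra hi
    obtain ⟨j, rfl⟩ := P.endo_cyclic x h
    obtain ⟨m, hm⟩ := P.endo_cyclic z (f ⊚ β)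
    have e1 : g ⊚ P.pipow x i = g ⊚ P.pipow x (l * m + (1 + 1 + j)) := by
      rw [e, pipow_comp_pipow, H.pipow_comp, pipow_add x (l * m), ← P.assoc g, ← hzg', ← hm,
        pipow_add x (1 + 1) j]
      simp only [P.assoc]
    have := comp_pipow_inj e1 (hG i (by omega))
    omega
  · rintro i ⟨f, h, e⟩
    by_contra hi
    obtain ⟨j, rfl⟩ := P.endo_cyclic y f
    obtain ⟨m, hm⟩ := P.endo_cyclic z (g ⊚ h)
    have e1 : P.pipow y i ⊚ β = P.pipow y (j + (1 + (1 + k * m))) ⊚ β := by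
      rw [e]
      simp only [P.assoc]
      rw [hm, hbz', pipow_comp_pipow, pipow_comp_pipow, pipow_comp_pipow]
      simp only [Nat.add_assoc]
    have := pipow_comp_inj e1 (hB i (by omega))
    omega

end IsDumbBellHom

end RayCategory

namespace RPath

variable {P : RayCategory} {x y z : P.Obj}

/-- A mild path ending with `π(y)β`, where `π(y)β = βπ(z)ᵏ`, that is not interlaced with a parallel
path ending with `β`. -/
theorem dumbBell_of_comm {v : RPath P x y} {β : P.Hom z y} {g : P.Hom x z} {q : RPath P x z}
    (hβ : P.IsIrreducible β) (hv : ¬ P.IsId g → Links v (P.pipow y 1) (β ⊚ g))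
    (hvw : ¬ Interlaced v (.cons β hβ q)) (H : IsMildHom (P.pipow y 1 ⊚ β ⊚ g))
    (e : P.pipow y 1 ⊚ β ⊚ g = β ⊚ q.toHom) (hzy : z ≠ y) {k : ℕ}
    (hk : P.pipow y 1 ⊚ β = β ⊚ P.pipow z k) :
    x = z ∧ P.IsId g ∧ q.points ⊆ {x} ∧ ∃ γ : P.Hom x y, IsDumbBellHom γ := by
  have hk' := pipow_comp_comp_pipow hk
  have hq : P.pipow z k ⊚ g = q.toHom :=
    cancelL (by rw [← e, ← P.assoc, ← hk, P.assoc]) (by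
      rw [← P.assoc, ← hk, P.assoc]; exact H.ne_zero)
  have hg : P.IsId g := by
    by_contra hg
    have L := (hv hg).right hg
    rw [hk] at L
    exact hvw ((L.left hβ.2.1).interlaced_cons hβ hq.symm)
  obtain rfl := hg.eq
  refine ⟨rfl, hg, ?_⟩
  rw [isId_self] at hg
  subst hg
  simp only [P.comp_id] at H e hq
  have h2 : β ⊚ P.pipow x (k * 2) ≠ P.zero x y := by
    have := H.comp_ne
    rwa [pipow_comp_pipow, hk'] at this
  have hk0 : k ≠ 0 := by
    rintro rfl
    rw [P.pipow_zero, P.comp_id] at hk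
    have := (absorb hβ.1 (i := 1) (j := 0) (by rw [P.pipow_zero, P.comp_id, hk])).1
    omega
  obtain ⟨a, ha1, ha⟩ := H.act
  have hk1 : k = 1 := by
    have := comp_pipow_inj (f := β) (i := k + 1) (j := k * (a + 1)) (by
      rw [← hk', pipow_add x k, ← P.assoc, ← hk, ha, pipow_comp_pipow]) (by
        intro h0
        apply h2
        rw [show k * 2 = k + 1 + (k - 1) by omega, pipow_add, ← P.assoc, h0, P.zero_comp])
    have : k * a = 1 := by
      rw [Nat.mul_add] at this
      omega
    exact Nat.eq_one_of_mul_eq_one_right this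
  subst hk1
  simp only [Nat.one_mul] at hk'
  have D : IsDumbBellHom β := by
    refine ⟨H, hzy, hk, ?_⟩
    obtain gen | gen := hβ.gen hzy
    · intro h
      obtain ⟨i, rfl⟩ := gen h
      exact ⟨i, hk' i⟩
    · exact gen
  refine ⟨fun t ht => ?_, β, D⟩
  obtain ⟨g, h, hgh⟩ := exists_factor ht
  by_contra hxt
  exact D.source_loop_no_factor hβ (Ne.symm hxt) h g (hgh.symm.trans hq.symm)

theorem Links.of_comm {v : RPath P x y} {γ : P.Hom x y} (L : Links v (P.pipow y 1) γ)
    (hc : P.pipow y 1 ⊚ γ = γ ⊚ P.pipow x 1) {δ : P.Hom x y} (hδ : γ = δ ⊚ P.pipow x 1) :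
    Links v γ (P.pipow x 1) := by
  have h0 := L.2.2.1
  rw [hδ] at L
  have L := L.right (mt pipow_isId.1 one_ne_zero)
  rwa [cancelR (a := P.pipow y 1 ⊚ δ) (b := γ) (g := P.pipow x 1)
    (by rw [P.assoc, ← hδ, hc]) L.2.2.1] at L

/-- A mild path ending with `π(y)β`, where `P(z,y)` is not generated by `β` over `z`,
is interlaced with every parallel path ending with `β`. -/
theorem interlaced_of_not_comm {v : RPath P x y} {β : P.Hom z y} {g : P.Hom x z} {q : RPath P x z}
    (hβ : P.IsIrreducible β) (hv : ¬ P.IsId g → Links v (P.pipow y 1) (β ⊚ g))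
    (H : IsMildHom (P.pipow y 1 ⊚ β ⊚ g))
    (e : P.pipow y 1 ⊚ β ⊚ g = β ⊚ q.toHom) (hzy : z ≠ y)
    (hk : ∀ k, P.pipow y 1 ⊚ β ≠ β ⊚ P.pipow z k) : Interlaced v (.cons β hβ q) := by
  by_contra hvw
  have gen_zy : ∀ h : P.Hom z y, ∃ i, h = P.pipow y i ⊚ β :=
    (hβ.gen hzy).resolve_right fun h => (h _).elim hk
  obtain ⟨k, hbz⟩ := gen_zy (β ⊚ P.pipow z 1)
  have hbz' := CoRep.comp_pipow_of_comp hbz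
  have hk1 : k ≠ 1 := by
    rintro rfl
    exact hk 1 hbz.symm
  have hk2 : 2 ≤ k := by
    by_contra h
    rw [show k = 0 by omega, P.pipow_zero, P.id_comp] at hbz
    have := (absorb hβ.1 (i := 0) (j := 1) (by rw [P.pipow_zero, P.id_comp, hbz])).2
    omega
  have hne : P.pipow y 1 ⊚ P.pipow y 1 ⊚ β ⊚ g ≠ P.zero x y := H.comp_ne
  have no_σ : ∀ (h : P.Hom x z) i j, g = P.pipow z i ⊚ h → q.toHom = P.pipow z j ⊚ h → False := by
    intro h i j hi hj
    have := pipow_comp_inj (f := β ⊚ h) (i := 1 + k * i) (j := k * j) (by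
      rw [pipow_add, ← P.assoc (P.pipow y (k * j)), ← hbz', P.assoc, P.assoc,
        ← P.assoc (P.pipow y (k * i)), ← hbz', P.assoc, ← hi, ← hj, e]) (by
      rw [pipow_add, P.assoc, ← P.assoc (P.pipow y (k * i)), ← hbz', P.assoc, ← hi]
      exact H.ne_zero)
    have := Nat.le_of_dvd one_pos ((Nat.dvd_add_left (Dvd.intro i rfl)).1 (Dvd.intro j this.symm))
    omega
  obtain ⟨h, gen | gen⟩ := P.hom_cyclic x z
  · obtain ⟨i, hi⟩ := gen g
    obtain ⟨j, hj⟩ := gen q.toHom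
    exact no_σ h i j hi hj
  obtain ⟨i, hi⟩ := gen g
  obtain ⟨j, hj⟩ := gen q.toHom
  have hij : i ≤ j := by
    by_contra hij
    obtain ⟨d, rfl⟩ := Nat.exists_eq_add_of_lt (not_le.1 hij)
    have e1 : P.pipow y 1 ⊚ (β ⊚ h) ⊚ P.pipow x (d + 1) = β ⊚ h := by
      refine cancelR (g := P.pipow x j) ?_ ?_
      · simp only [P.assoc]
        rw [← pipow_add, show d + 1 + j = j + d + 1 by omega, ← hi, e, hj]
      · simp only [P.assoc]
        rw [← pipow_add, show d + 1 + j = j + d + 1 by omega, ← hi]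
        exact H.ne_zero
    have := (absorb (fun h0 => H.ne_zero (by rw [e, hj, ← P.assoc, h0, P.zero_comp])) e1).1
    omega
  obtain ⟨d, rfl⟩ := Nat.exists_eq_add_of_le' hij
  have hcd : P.pipow y 1 ⊚ β ⊚ h = (β ⊚ h) ⊚ P.pipow x d := by
    refine cancelR (g := P.pipow x i) ?_ ?_
    · simp only [P.assoc]
      rw [← pipow_add, ← hi, e, hj]
    · simp only [P.assoc]
      rw [← hi]
      exact H.ne_zero
  have link_end : Links v ((β ⊚ h) ⊚ P.pipow x d) (P.pipow x i) → False := by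
    intro L
    have L := (L.left fun h => hβ.2.1 (isId_comp h).1).left hβ.2.1
    rw [← pipow_add, ← hj] at L
    exact hvw (L.interlaced_cons hβ rfl)
  obtain rfl | hi0 := Nat.eq_zero_or_pos i
  swap
  · have hid : ¬ P.IsId (P.pipow x i) := mt pipow_isId.1 hi0.ne'
    have L := hv fun h => hid (isId_comp (hi ▸ h)).2
    rw [hi, ← P.assoc] at L
    have L := L.right hid
    rw [hcd] at L
    exact link_end L
  rw [P.pipow_zero, P.comp_id] at hi
  subst hi
  rw [Nat.add_zero] at hj
  obtain ⟨a, ha1, ha⟩ := H.act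
  have hcd' := pipow_comp_comp_pipow hcd
  have h2 : (β ⊚ g) ⊚ P.pipow x (d * 2) ≠ P.zero x y := by
    rwa [pipow_comp_pipow, hcd'] at hne
  have hd0 : d ≠ 0 := by
    rintro rfl
    rw [P.pipow_zero, P.comp_id] at hcd
    have := (absorb (ne_zero_right H.ne_zero) (i := 1) (j := 0)
      (by rw [P.pipow_zero, P.comp_id, hcd])).1
    omega
  have hd1 : d = 1 := by
    have := comp_pipow_inj (f := β ⊚ g) (i := d + 1) (j := d * (a + 1)) (by
      rw [← hcd', pipow_add x d, ← P.assoc, ← hcd, ha, pipow_comp_pipow]) (by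
        intro h0
        apply h2
        rw [show d * 2 = d + 1 + (d - 1) by omega, pipow_add, ← P.assoc, h0, P.zero_comp])
    have : d * a = 1 := by
      rw [Nat.mul_add] at this
      omega
    exact Nat.eq_one_of_mul_eq_one_right this
  subst hd1
  have hxz : x ≠ z := by
    rintro rfl
    obtain ⟨i, hi⟩ := P.endo_cyclic x g
    exact no_σ (P.id x) i (i + 1) (by rw [P.comp_id, hi]) (by rw [hj, hi, P.comp_id, pipow_add])
  obtain ⟨l, hzg⟩ := gen (P.pipow z 1 ⊚ g)
  have hl0 : l ≠ 0 := by
    rintro rfl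
    rw [P.pipow_zero, P.comp_id] at hzg
    have := (absorb (ne_zero_right (ne_zero_right H.ne_zero)) (i := 1) (j := 0)
      (by rw [P.pipow_zero, P.comp_id, hzg])).1
    omega
  have hl1 : l ≠ 1 := by
    rintro rfl
    exact no_σ g 0 1 (by rw [P.pipow_zero, P.id_comp]) (by rw [hj, hzg])
  have key : ∀ δ : P.Hom x y, β ⊚ g ≠ δ ⊚ P.pipow x 1 := by
    intro δ hδ
    have L := (hv (not_isId hxz)).of_comm hcd hδ
    exact hvw ((L.left hβ.2.1).interlaced_cons hβ hj)
  have hc' : ∀ i, P.pipow y i ⊚ β ⊚ g = (β ⊚ g) ⊚ P.pipow x i := by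
    intro i
    rw [hcd', Nat.one_mul]
  have D : IsDumbBellHom (β ⊚ g) := by
    refine ⟨H, ?_, hcd, ?_⟩
    · rintro rfl
      obtain ⟨i, hi⟩ := endo_of_ne hxz g β
      exact key (P.pipow x i) (by rw [hi, pipow_add])
    · obtain ⟨h, gen | gen⟩ := P.hom_cyclic x y
      · obtain ⟨i, hi⟩ := gen (β ⊚ g)
        obtain ⟨m, hm⟩ := gen (h ⊚ P.pipow x 1)
        have hm1 := pipow_comp_inj (i := i + m) (j := 1 + i) (f := h) (by
          rw [pipow_add, P.assoc, ← hm, ← P.assoc, ← hi, ← hcd, pipow_add, P.assoc, ← hi]) (by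
          rw [pipow_add, P.assoc, ← hm, ← P.assoc, ← hi, ← hcd]
          exact H.ne_zero)
        obtain rfl | hi0 := Nat.eq_zero_or_pos i
        · rw [P.pipow_zero, P.id_comp] at hi
          intro f
          obtain ⟨n, rfl⟩ := gen f
          exact ⟨n, by rw [← hi, hc']⟩
        · obtain ⟨i, rfl⟩ := Nat.exists_eq_add_of_le' hi0
          refine absurd ?_ (key (P.pipow y i ⊚ h))
          rw [P.assoc, hm, show m = 1 by omega, pipow_comp_pipow, hi]
      · obtain ⟨i, hi⟩ := gen (β ⊚ g)
        obtain rfl | hi0 := Nat.eq_zero_or_pos i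
        · rw [P.pipow_zero, P.comp_id] at hi
          rwa [hi]
        · obtain ⟨i, rfl⟩ := Nat.exists_eq_add_of_le' hi0
          exact absurd (by rw [hi, pipow_add, P.assoc]) (key (h ⊚ P.pipow x i))
  exact D.false_of_factor hβ hxz hzy.symm hk2 (by omega) hzg hbz gen gen_zy

end RPath

open RPath

/-- **Proposition 2.3 (case (DB)).** Let `C = {v,w}` be a mild contour from `x` to `y`
with `v⃗` transit, `α = v⃗_1`, `β = w⃗_1` and `ρ = π(y) = αω`.  If `ω` is an identity
and `v⃗_2 = β`, then the full subcategory `P(C)` is a dumb-bell. -/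
theorem mild_contour_case_DB (P : RayCategory) {x y : P.Obj} (C : Contour P x y)
    (hM : C.Mild) (hT : P.IsTransit C.v.toHom)
    {a1 b1 : P.Obj} (alp : P.Hom a1 y) (halp : P.IsIrreducible alp) (p : RPath P x a1)
    (hv : C.v = RPath.cons alp halp p)
    (bet : P.Hom b1 y) (hbet : P.IsIrreducible bet) (q : RPath P x b1)
    (hw : C.w = RPath.cons bet hbet q)
    (om : P.Hom y a1) (hom : P.pi y = P.comp alp om) (hid : P.IsId om)
    (h2 : ∃ (c1 : P.Obj) (v2 : P.Hom c1 a1) (hv2 : P.IsIrreducible v2) (p2 : RPath P x c1),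
        p = RPath.cons v2 hv2 p2 ∧ HEq v2 bet) :
    IsDumbBellOn P C.points := by
  obtain rfl := hid.eq
  rw [isId_self.1 hid, P.comp_id] at hom
  obtain rfl : P.pipow y 1 = alp := hom
  obtain ⟨c1, v2, hv2, p2, rfl, hh⟩ := h2
  have hv' : C.v.toHom = P.pipow y 1 ⊚ v2 ⊚ p2.toHom := by rw [hv, toHom, toHom]
  have e : P.pipow y 1 ⊚ v2 ⊚ p2.toHom = bet ⊚ q.toHom := by rw [← hv', C.hom_eq, hw, toHom]
  have nz := C.nz
  have nint := C.nint
  have H : IsMildHom C.v.toHom :=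
    hM.isMildHom hT (fun h => halp.2.1 (isId_comp (hv' ▸ h)).1) halp
  rw [hv'] at nz H
  have hS : C.points = insert y (insert y p2.points) ∪ insert y q.points := by
    rw [Contour.points, hv, hw, points_cons, points_cons, points_cons]
  rw [hw] at nint
  have hp : ¬ P.IsId (v2 ⊚ p2.toHom) := fun h => hv2.2.1 (isId_comp h).1
  have L : Links C.v (P.pipow y 1) (RPath.cons v2 hv2 p2).toHom := by
    rw [hv]
    exact links_cons (by rwa [toHom]) (by rwa [toHom])
  rw [toHom] at L
  have hq : ¬ P.IsId q.toHom := by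
    intro h
    obtain rfl := h.eq
    rw [isId_self.1 h, P.comp_id] at e
    exact (hbet.2.2 _ _ _ e.symm).elim halp.2.1 hp
  have hby : b1 ≠ y := by
    rintro rfl
    obtain rfl := irreducible_loop hbet
    exact nint (L.interlaced_cons hbet (cancelL e nz).symm)
  by_cases hcb : c1 = b1
  · subst hcb
    obtain rfl := eq_of_heq hh
    by_cases hk : ∃ k, P.pipow y 1 ⊚ v2 = v2 ⊚ P.pipow c1 k
    · obtain ⟨k, hk⟩ := hk
      obtain ⟨rfl, hg, hqx, γ, hγ⟩ := dumbBell_of_comm hbet (fun _ => L) nint H e hby hk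
      refine ⟨_, _, _, _, _, _, _, hγ.dumbBellData, ?_⟩
      rw [hS, points_of_isId hg, Set.insert_idem, Set.union_eq_left.2, Set.pair_comm]
      exact Set.insert_subset_insert hqx
    · exact absurd (interlaced_of_not_comm hbet (fun _ => L) H e hby (not_exists.1 hk)) nint
  · by_cases hcy : c1 = y
    · subst hcy
      obtain rfl := irreducible_loop hv2
      exact (H.false_of_loop_loop hbet hby e (congrArg Nat.card (type_eq_of_heq hh)).symm).elim
    · exact (H.false_of_three_arrows hbet hv2 hby hcy (Ne.symm hcb) hq e).elim
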